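/- Let S be a nonempty set of prime numbers such that ℤ_S contains a unit λ with λ² − 1 also a unit. Then the cokernel of the homomorphism H₂(SL₂(ℤ_S), ℤ) → H₂(SL₂(ℚ), ℤ) induced by the inclusion ℤ_S ⊆ ℚ is isomorphic to the direct sum ⊕_{q ∉ S} (ℤ/qℤ)^× over all prime numbers q not in S. -/

import Mathlib

open Finsupp DirectSum

set_option maxHeartbeats 1000000
set_option synthInstance.maxHeartbeats 400000

/-- `ℤ_S`: the subring of `ℚ` obtained by localizing `ℤ` at the primes in `S`, i.e. the smallest
subring of `ℚ` containing the inverses of the elements of `S`. -/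
def ZS (S : Set ℕ) : Subring ℚ :=
  Subring.closure ((fun p : ℕ => (p : ℚ)⁻¹) '' S)





noncomputable section

/-- Degree-2 differential of the bar complex of `G` with trivial `ℤ` coefficients:
`d₂([g|h]) = [h] - [gh] + [g]`. -/
def barD2 (G : Type*) [Group G] : ((G × G) →₀ ℤ) →ₗ[ℤ] (G →₀ ℤ) :=
  Finsupp.lsum ℤ fun p => LinearMap.toSpanSingleton ℤ _
    (Finsupp.single p.2 1 - Finsupp.single (p.1 * p.2) 1 + Finsupp.single p.1 1)

/-- Degree-3 differential of the bar complex of `G` with trivial `ℤ` coefficients: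
`d₃([g|h|k]) = [h|k] - [gh|k] + [g|hk] - [g|h]`. -/
def barD3 (G : Type*) [Group G] : ((G × G × G) →₀ ℤ) →ₗ[ℤ] ((G × G) →₀ ℤ) :=
  Finsupp.lsum ℤ fun t => LinearMap.toSpanSingleton ℤ _
    (Finsupp.single (t.2.1, t.2.2) 1 - Finsupp.single (t.1 * t.2.1, t.2.2) 1 +
      Finsupp.single (t.1, t.2.1 * t.2.2) 1 - Finsupp.single (t.1, t.2.1) 1)

/-- The second homology group `H₂(G, ℤ)` of a group `G` with trivial integer coefficients,
computed via the bar complex: 2-cycles modulo 2-boundaries. -/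
abbrev H2 (G : Type*) [Group G] :=
  ↥(LinearMap.ker (barD2 G)) ⧸
    (LinearMap.range (barD3 G)).comap (LinearMap.ker (barD2 G)).subtype

variable {G G' : Type*} [Group G] [Group G']

/-- The map on degree-1 bar chains induced by a group homomorphism. -/
def mapC1 (f : G →* G') : (G →₀ ℤ) →ₗ[ℤ] (G' →₀ ℤ) :=
  Finsupp.lmapDomain ℤ ℤ f

/-- The map on degree-2 bar chains induced by a group homomorphism. -/
def mapC2 (f : G →* G') : ((G × G) →₀ ℤ) →ₗ[ℤ] ((G' × G') →₀ ℤ) :=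
  Finsupp.lmapDomain ℤ ℤ (Prod.map f f)

/-- The map on degree-3 bar chains induced by a group homomorphism. -/
def mapC3 (f : G →* G') : ((G × G × G) →₀ ℤ) →ₗ[ℤ] ((G' × G' × G') →₀ ℤ) :=
  Finsupp.lmapDomain ℤ ℤ (fun t => (f t.1, f t.2.1, f t.2.2))

lemma mapC1_single (f : G →* G') (a : G) (b : ℤ) :
    mapC1 f (Finsupp.single a b) = Finsupp.single (f a) b := by
  simp [mapC1, Finsupp.lmapDomain_apply, Finsupp.mapDomain_single]

lemma mapC2_single (f : G →* G') (a : G × G) (b : ℤ) :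
    mapC2 f (Finsupp.single a b) = Finsupp.single (f a.1, f a.2) b := by
  simp [mapC2, Finsupp.lmapDomain_apply, Finsupp.mapDomain_single, Prod.map]

lemma mapC3_single (f : G →* G') (a : G × G × G) (b : ℤ) :
    mapC3 f (Finsupp.single a b) = Finsupp.single (f a.1, f a.2.1, f a.2.2) b := by
  simp [mapC3, Finsupp.lmapDomain_apply, Finsupp.mapDomain_single]

lemma barD2_comm (f : G →* G') :
    (barD2 G').comp (mapC2 f) = (mapC1 f).comp (barD2 G) := by
  apply Finsupp.lhom_ext
  intro p b
  simp only [LinearMap.comp_apply, mapC2_single, barD2, Finsupp.lsum_single,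
    LinearMap.toSpanSingleton_apply, map_smul, map_add, map_sub, mapC1_single, map_mul]

lemma barD3_comm (f : G →* G') :
    (barD3 G').comp (mapC3 f) = (mapC2 f).comp (barD3 G) := by
  apply Finsupp.lhom_ext
  intro t b
  simp only [LinearMap.comp_apply, mapC3_single, barD3, Finsupp.lsum_single,
    LinearMap.toSpanSingleton_apply, map_smul, map_add, map_sub, mapC2_single, map_mul]

/-- The map `H₂(G, ℤ) → H₂(G′, ℤ)` induced by a group homomorphism `f : G → G′`. -/
def mapH2 (f : G →* G') : H2 G →ₗ[ℤ] H2 G' :=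
  Submodule.mapQ _ _
    ((mapC2 f).restrict (p := LinearMap.ker (barD2 G)) (q := LinearMap.ker (barD2 G'))
      (fun x hx => by
        have := LinearMap.congr_fun (barD2_comm f) x
        simp only [LinearMap.comp_apply] at this
        simp only [LinearMap.mem_ker] at hx ⊢
        rw [this, hx, map_zero]))
    (by
      rintro ⟨x, hx⟩ hmem
      simp only [Submodule.mem_comap, LinearMap.mem_range, Submodule.coe_subtype] at hmem ⊢
      obtain ⟨z, hz⟩ := hmem
      refine ⟨mapC3 f z, ?_⟩
      have := LinearMap.congr_fun (barD3_comm f) z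
      simp only [LinearMap.comp_apply] at this
      rw [this, hz]
      rfl)

open Matrix (SpecialLinearGroup)
open scoped commutatorElement

/-- A 2-cocycle on `Γ` with values in the trivial module `M`. -/
def IsCocycle {Γ M : Type*} [Group Γ] [AddCommGroup M] (β : Γ → Γ → M) : Prop :=
  ∀ g h k, β h k - β (g * h) k + β g (h * k) - β g h = 0

/-- The central extension of `Γ` by `M` attached to a 2-cocycle. -/
@[ext]
structure CocExt {Γ M : Type*} [Group Γ] [AddCommGroup M] (β : Γ → Γ → M) (hβ : IsCocycle β) where
  /-- the fibre coordinate -/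
  fib : M
  /-- the base coordinate -/
  base : Γ

namespace CocExt

variable {Γ M : Type*} [Group Γ] [AddCommGroup M] {β : Γ → Γ → M} {hβ : IsCocycle β}

lemma cocycle_one_left (hβ : IsCocycle β) (g : Γ) : β 1 g = β 1 1 := by
  have := hβ 1 1 g
  simp only [one_mul, mul_one, sub_self, zero_add] at this
  exact sub_eq_zero.mp this

lemma cocycle_one_right (hβ : IsCocycle β) (g : Γ) : β g 1 = β 1 1 := by
  have := hβ g 1 1
  simp only [mul_one] at this
  rw [sub_add_cancel] at this
  exact (sub_eq_zero.mp this).symm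

lemma cocycle_inv (hβ : IsCocycle β) (g : Γ) : β g⁻¹ g = β g g⁻¹ := by
  have := hβ g g⁻¹ g
  rw [mul_inv_cancel, inv_mul_cancel, cocycle_one_left hβ, cocycle_one_right hβ g,
    sub_add_cancel] at this
  exact sub_eq_zero.mp this

instance : Mul (CocExt β hβ) := ⟨fun x y => ⟨x.fib + y.fib + β x.base y.base, x.base * y.base⟩⟩
instance : One (CocExt β hβ) := ⟨⟨-β 1 1, 1⟩⟩
instance : Inv (CocExt β hβ) := ⟨fun x => ⟨-x.fib - β x.base x.base⁻¹ - β 1 1, x.base⁻¹⟩⟩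

@[simp] lemma mul_fib (x y : CocExt β hβ) :
    (x * y).fib = x.fib + y.fib + β x.base y.base := rfl
@[simp] lemma mul_base (x y : CocExt β hβ) : (x * y).base = x.base * y.base := rfl
@[simp] lemma one_fib : (1 : CocExt β hβ).fib = -β 1 1 := rfl
@[simp] lemma one_base : (1 : CocExt β hβ).base = 1 := rfl
@[simp] lemma inv_fib (x : CocExt β hβ) :
    x⁻¹.fib = -x.fib - β x.base x.base⁻¹ - β 1 1 := rfl
@[simp] lemma inv_base (x : CocExt β hβ) : x⁻¹.base = x.base⁻¹ := rfl

instance : Group (CocExt β hβ) :=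
  Group.ofLeftAxioms
    (fun x y z => by
      ext
      · have h := hβ x.base y.base z.base
        simp only [mul_fib, mul_base]
        rw [← sub_eq_zero, ← neg_eq_zero, ← h]
        abel
      · simp [mul_assoc])
    (fun x => by
      ext
      · simp [cocycle_one_left hβ]
      · simp)
    (fun x => by
      ext
      · simp only [mul_fib, inv_fib, inv_base, one_fib, cocycle_inv hβ]
        abel
      · simp)

/-- The projection to the base group. -/
def proj : CocExt β hβ →* Γ where
  toFun := base
  map_one' := rfl
  map_mul' _ _ := rfl

@[simp] lemma proj_apply (x : CocExt β hβ) : proj x = x.base := rfl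

/-- The inclusion of the central fibre. -/
def incl (m : M) : CocExt β hβ := ⟨m - β 1 1, 1⟩

@[simp] lemma incl_fib (m : M) : (incl m : CocExt β hβ).fib = m - β 1 1 := rfl
@[simp] lemma incl_base (m : M) : (incl m : CocExt β hβ).base = 1 := rfl

lemma incl_add (a b : M) : (incl (a + b) : CocExt β hβ) = incl a * incl b := by
  ext1
  · simp only [incl_fib, mul_fib, incl_base]; abel
  · simp

lemma incl_mul_mk (m : M) (g : Γ) : (incl m : CocExt β hβ) * ⟨0, g⟩ = ⟨m, g⟩ := by
  ext1
  · simp only [incl_fib, mul_fib, incl_base, cocycle_one_left hβ]; abel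
  · simp

lemma mk_zero_mul_mk_zero (g h : Γ) :
    (⟨0, g⟩ : CocExt β hβ) * ⟨0, h⟩ = incl (β g h) * ⟨0, g * h⟩ := by
  rw [incl_mul_mk]
  ext1
  · simp
  · rfl

end CocExt

/-- A central extension `E` of `SL₂(ℚ)` with kernel identified with the additive group `K`. -/
structure CentralExt (K E : Type*) [AddCommGroup K] [Group E] where
  /-- the projection -/
  π : E →* SpecialLinearGroup (Fin 2) ℚ
  /-- the inclusion of the kernel -/
  ι : K → E
  ι_add : ∀ a b, ι (a + b) = ι a * ι b
  ι_inj : Function.Injective ι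
  π_surj : Function.Surjective π
  ι_comm : ∀ k e, ι k * e = e * ι k
  π_ι : ∀ k, π (ι k) = 1
  exists_ι : ∀ e, π e = 1 → ∃ k, ι k = e

/-- The central extension of `SL₂(ℚ)` attached to a 2-cocycle. -/
def CocExt.centralExt {M : Type*} [AddCommGroup M]
    {β : SpecialLinearGroup (Fin 2) ℚ → SpecialLinearGroup (Fin 2) ℚ → M} (hβ : IsCocycle β) :
    CentralExt M (CocExt β hβ) where
  π := CocExt.proj
  ι := CocExt.incl
  ι_add := CocExt.incl_add
  ι_inj a b h := by simpa using congrArg CocExt.fib h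
  π_surj g := ⟨⟨0, g⟩, rfl⟩
  ι_comm k e := by
    ext1
    · simp only [CocExt.incl_fib, CocExt.mul_fib, CocExt.incl_base, CocExt.cocycle_one_left hβ,
        CocExt.cocycle_one_right hβ]
      abel
    · simp
  π_ι k := rfl
  exists_ι e he := ⟨e.fib + β 1 1, CocExt.ext (by simp) he.symm⟩

section Homology

variable {Γ : Type*} [Group Γ]

lemma barD2_single (p : Γ × Γ) (n : ℤ) : barD2 Γ (single p n) =
    n • (single p.2 1 - single (p.1 * p.2) 1 + single p.1 1) := by
  simp [barD2]

lemma barD3_single (t : Γ × Γ × Γ) (n : ℤ) : barD3 Γ (single t n) =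
    n • (single (t.2.1, t.2.2) 1 - single (t.1 * t.2.1, t.2.2) 1 +
      single (t.1, t.2.1 * t.2.2) 1 - single (t.1, t.2.1) 1) := by
  simp [barD3]

lemma barD2_barD3 (z : (Γ × Γ × Γ) →₀ ℤ) : barD2 Γ (barD3 Γ z) = 0 := by
  have : (barD2 Γ).comp (barD3 Γ) = 0 := by
    apply Finsupp.lhom_ext
    intro t b
    simp only [LinearMap.comp_apply, barD3_single, map_smul, map_sub, map_add, barD2_single,
      one_smul, mul_assoc, LinearMap.zero_apply]
    rw [smul_eq_zero]
    right
    abel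
  exact LinearMap.congr_fun this z

/-- The class of the universal cocycle modulo a submodule containing all boundaries. -/
def barCocycle (R : Submodule ℤ ((Γ × Γ) →₀ ℤ)) (g h : Γ) : ((Γ × Γ) →₀ ℤ) ⧸ R :=
  R.mkQ (single (g, h) 1)

lemma isCocycle_barCocycle {R : Submodule ℤ ((Γ × Γ) →₀ ℤ)}
    (hR : LinearMap.range (barD3 Γ) ≤ R) : IsCocycle (barCocycle R) := by
  intro g h k
  have : R.mkQ (barD3 Γ (single (g, h, k) 1)) = 0 := by
    rw [Submodule.mkQ_apply, Submodule.Quotient.mk_eq_zero]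
    exact hR ⟨_, rfl⟩
  rw [barD3_single] at this
  simpa [barCocycle] using this

lemma mkQ_eq_of_mem_commutator {R : Submodule ℤ ((Γ × Γ) →₀ ℤ)}
    (hR : LinearMap.range (barD3 Γ) ≤ R) (hR' : R ≤ LinearMap.ker (barD2 Γ))
    {e : CocExt (barCocycle R) (isCocycle_barCocycle hR)}
    (he : e ∈ commutator (CocExt (barCocycle R) (isCocycle_barCocycle hR)))
    (hb : e.base = 1) :
    ∃ z ∈ LinearMap.ker (barD2 Γ), e = CocExt.incl (R.mkQ z) := by
  let D : ((Γ × Γ) →₀ ℤ) ⧸ R →ₗ[ℤ] (Γ →₀ ℤ) := R.liftQ (barD2 Γ) hR'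
  let φ : CocExt (barCocycle R) (isCocycle_barCocycle hR) →* Multiplicative (Γ →₀ ℤ) :=
    MonoidHom.mk' (fun x => Multiplicative.ofAdd (D x.fib + single x.base 1)) (fun x y => by
      rw [← ofAdd_add]
      congr 1
      have : D (barCocycle R x.base y.base) = barD2 Γ (single (x.base, y.base) 1) := by
        simp [D, barCocycle]
      rw [CocExt.mul_fib, map_add, map_add, this, barD2_single]
      simp only [CocExt.mul_base, one_smul]
      abel)
  have h1 : φ e = 1 := by
    have := Abelianization.commutator_subset_ker φ he
    exact this
  have h2 : D e.fib + single e.base 1 = 0 := h1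
  obtain ⟨z, hz⟩ := R.mkQ_surjective (e.fib + barCocycle R 1 1)
  refine ⟨z, ?_, ?_⟩
  · have h3 : barD2 Γ z = D (R.mkQ z) := by simp [D]
    rw [LinearMap.mem_ker, h3, hz, map_add]
    have : D (barCocycle R 1 1) = barD2 Γ (single (1, 1) 1) := by simp [D, barCocycle]
    rw [this, barD2_single]
    rw [hb] at h2
    simpa using h2
  · rw [hz]
    ext1
    · simp
    · exact hb

lemma incl_mem_commutator {R : Submodule ℤ ((Γ × Γ) →₀ ℤ)}
    (hR : LinearMap.range (barD3 Γ) ≤ R) {z : (Γ × Γ) →₀ ℤ} (hz : barD2 Γ z = 0) :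
    (CocExt.incl (R.mkQ z) : CocExt (barCocycle R) (isCocycle_barCocycle hR)) ∈
      commutator (CocExt (barCocycle R) (isCocycle_barCocycle hR)) := by
  let q : CocExt (barCocycle R) (isCocycle_barCocycle hR) →*
      Abelianization (CocExt (barCocycle R) (isCocycle_barCocycle hR)) := Abelianization.of
  let i : ((Γ × Γ) →₀ ℤ) →+ Additive (Abelianization
      (CocExt (barCocycle R) (isCocycle_barCocycle hR))) :=
    AddMonoidHom.mk' (fun z => Additive.ofMul (q (CocExt.incl (R.mkQ z))))
      (fun a b => by rw [map_add, CocExt.incl_add, map_mul, ofMul_mul])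
  let ψ : (Γ →₀ ℤ) →ₗ[ℤ] Additive (Abelianization
      (CocExt (barCocycle R) (isCocycle_barCocycle hR))) :=
    Finsupp.lsum ℤ fun g => LinearMap.toSpanSingleton ℤ _ (Additive.ofMul (q ⟨0, g⟩))
  have hψ : ∀ g, ψ (single g 1) = Additive.ofMul (q ⟨0, g⟩) := by
    intro g; simp [ψ]
  have key : ψ.comp (barD2 Γ) = i.toIntLinearMap := by
    apply Finsupp.lhom_ext
    intro p b
    have h' := congrArg (fun x => Additive.ofMul (q x))
      (CocExt.mk_zero_mul_mk_zero (hβ := isCocycle_barCocycle hR) p.1 p.2)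
    simp only [map_mul, ofMul_mul] at h'
    have hb : (single p b : (Γ × Γ) →₀ ℤ) = b • single p 1 := by simp
    rw [hb, map_smul, map_smul]
    congr 1
    simp only [LinearMap.comp_apply, barD2_single, one_smul, map_add, map_sub, hψ]
    change _ = Additive.ofMul (q (CocExt.incl (barCocycle R p.1 p.2)))
    rw [sub_add_eq_add_sub, sub_eq_iff_eq_add, add_comm, h']
  have h0 : i z = 0 := by
    have := LinearMap.congr_fun key z
    simp only [LinearMap.comp_apply, hz, map_zero] at this
    exact this.symm
  have h1 : q (CocExt.incl (R.mkQ z)) = 1 := h0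
  rwa [← MonoidHom.mem_ker, Abelianization.ker_of] at h1

end Homology

/-- The group `SL₂(ℚ)`. -/
abbrev SL2Q := SpecialLinearGroup (Fin 2) ℚ

/-- The upper elementary matrix. -/
def u12 (t : ℚ) : SL2Q := ⟨!![1, t; 0, 1], by simp⟩

/-- The diagonal matrix with entries `u, u⁻¹`. -/
def diag (u : ℚˣ) : SL2Q := ⟨!![(u : ℚ), 0; 0, (u : ℚ)⁻¹], by simp⟩

/-- The Weyl element with upper right entry `u`. -/
def wmat (u : ℚˣ) : SL2Q := ⟨!![0, (u : ℚ); -(u : ℚ)⁻¹, 0], by simp⟩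

/-- The lower elementary matrix. -/
def u21 (t : ℚ) : SL2Q := ⟨!![1, 0; t, 1], by simp⟩

lemma SL2Q.ext_fin {g h : SL2Q} (h00 : g 0 0 = h 0 0) (h01 : g 0 1 = h 0 1)
    (h10 : g 1 0 = h 1 0) (h11 : g 1 1 = h 1 1) : g = h := by
  ext i j
  fin_cases i <;> fin_cases j <;> assumption

section Entries

variable (t : ℚ) (u : ℚˣ) (g h : SL2Q)

@[simp] lemma u12_00 : u12 t 0 0 = 1 := rfl
@[simp] lemma u12_01 : u12 t 0 1 = t := rfl
@[simp] lemma u12_10 : u12 t 1 0 = 0 := rfl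
@[simp] lemma u12_11 : u12 t 1 1 = 1 := rfl
@[simp] lemma u21_00 : u21 t 0 0 = 1 := rfl
@[simp] lemma u21_01 : u21 t 0 1 = 0 := rfl
@[simp] lemma u21_10 : u21 t 1 0 = t := rfl
@[simp] lemma u21_11 : u21 t 1 1 = 1 := rfl
@[simp] lemma diag_00 : diag u 0 0 = u := rfl
@[simp] lemma diag_01 : diag u 0 1 = 0 := rfl
@[simp] lemma diag_10 : diag u 1 0 = 0 := rfl
@[simp] lemma diag_11 : diag u 1 1 = (u : ℚ)⁻¹ := rfl
@[simp] lemma wmat_00 : wmat u 0 0 = 0 := rfl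
@[simp] lemma wmat_01 : wmat u 0 1 = u := rfl
@[simp] lemma wmat_10 : wmat u 1 0 = -(u : ℚ)⁻¹ := rfl
@[simp] lemma wmat_11 : wmat u 1 1 = 0 := rfl

lemma SL2Q.mul_entry (i j : Fin 2) : (g * h) i j = g i 0 * h 0 j + g i 1 * h 1 j := by
  change ((g : Matrix (Fin 2) (Fin 2) ℚ) * (h : Matrix (Fin 2) (Fin 2) ℚ)) i j = _
  rw [Matrix.mul_apply, Fin.sum_univ_two]

lemma SL2Q.det_eq : g 0 0 * g 1 1 - g 0 1 * g 1 0 = 1 := by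
  rw [← Matrix.det_fin_two, g.det_coe]

@[simp] lemma SL2Q.one_entry_00 : (1 : SL2Q) 0 0 = 1 := rfl
@[simp] lemma SL2Q.one_entry_01 : (1 : SL2Q) 0 1 = 0 := rfl
@[simp] lemma SL2Q.one_entry_10 : (1 : SL2Q) 1 0 = 0 := rfl
@[simp] lemma SL2Q.one_entry_11 : (1 : SL2Q) 1 1 = 1 := rfl

end Entries

lemma u12_add (s t : ℚ) : u12 (s + t) = u12 s * u12 t := by
  apply SL2Q.ext_fin <;> simp [SL2Q.mul_entry, add_comm]

lemma u12_zero : u12 0 = 1 := by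
  apply SL2Q.ext_fin <;> simp

lemma u12_zpow (s : ℚ) (n : ℤ) : u12 s ^ n = u12 (n * s) := by
  let φ : Multiplicative ℚ →* SL2Q := MonoidHom.mk' (fun t => u12 t.toAdd) (fun a b => u12_add _ _)
  have := map_zpow φ (Multiplicative.ofAdd s) n
  rw [← ofAdd_zsmul, zsmul_eq_mul] at this
  exact this.symm

lemma u12_neg (s : ℚ) : u12 (-s) = (u12 s)⁻¹ := by
  rw [eq_inv_iff_mul_eq_one, ← u12_add, neg_add_cancel, u12_zero]

lemma diag_mul_u12 (u : ℚˣ) (t : ℚ) : diag u * u12 t = u12 (u ^ 2 * t) * diag u := by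
  apply SL2Q.ext_fin <;> simp [SL2Q.mul_entry]
  field_simp

lemma diag_mul (u v : ℚˣ) : diag (u * v) = diag u * diag v := by
  apply SL2Q.ext_fin <;> simp [SL2Q.mul_entry, mul_comm]

lemma wmat_eq (u : ℚˣ) : wmat u = wmat 1 * diag u⁻¹ := by
  apply SL2Q.ext_fin <;> simp [SL2Q.mul_entry]

lemma diag_mul_wmat (u v : ℚˣ) : diag u * wmat v = wmat (u * v) := by
  apply SL2Q.ext_fin <;> simp [SL2Q.mul_entry, mul_comm]

lemma wmat_mul_wmat (u v : ℚˣ) : wmat u * wmat v = diag (-(u * v⁻¹)) := by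
  apply SL2Q.ext_fin <;> simp [SL2Q.mul_entry, mul_comm]

lemma wmat_mul_u12 (u : ℚˣ) (t : ℚ) :
    wmat u * u12 t = u21 (-((u : ℚ)⁻¹ ^ 2 * t)) * wmat u := by
  apply SL2Q.ext_fin <;> simp [SL2Q.mul_entry]
  field_simp

lemma u12_mul_u21_mul_u12 (u : ℚˣ) : u12 u * u21 (-(u : ℚ)⁻¹) * u12 u = wmat u := by
  apply SL2Q.ext_fin <;> simp [SL2Q.mul_entry]

namespace CentralExt

variable {K E : Type*} [AddCommGroup K] [Group E] (X : CentralExt K E)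

lemma ι_zero : X.ι 0 = 1 := by
  have := X.ι_add 0 0
  rw [add_zero] at this
  exact (mul_eq_left.mp this.symm)

lemma ι_neg (a : K) : X.ι (-a) = (X.ι a)⁻¹ := by
  rw [eq_inv_iff_mul_eq_one, ← X.ι_add, neg_add_cancel, X.ι_zero]

lemma commute_ι (k : K) (e : E) : Commute (X.ι k) e := X.ι_comm k e

lemma exists_mul {e f : E} (h : X.π e = X.π f) : ∃ k, e = X.ι k * f := by
  obtain ⟨k, hk⟩ := X.exists_ι (e * f⁻¹) (by rw [map_mul, map_inv, h, mul_inv_cancel])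
  exact ⟨k, by rw [hk, inv_mul_cancel_right]⟩

lemma conj_eq {e f : E} (h : X.π e = X.π f) (a : E) : e * a * e⁻¹ = f * a * f⁻¹ := by
  obtain ⟨k, rfl⟩ := X.exists_mul h
  rw [mul_inv_rev, mul_assoc (X.ι k) f a, X.ι_comm]
  simp only [mul_assoc]
  rw [← mul_assoc (X.ι k) f⁻¹, X.ι_comm]
  simp

lemma commutator_eq {e e' f f' : E} (h : X.π e = X.π e') (h' : X.π f = X.π f') :
    ⁅e, f⁆ = ⁅e', f'⁆ := by
  rw [commutatorElement_def, X.conj_eq h]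
  have := X.conj_eq h' e'⁻¹
  rw [commutatorElement_def, mul_assoc, mul_assoc, ← mul_assoc f, this]
  simp only [mul_assoc]

lemma commute_of_zpow {γ : SL2Q} {m n : ℤ} {e f : E} (he : X.π e = γ ^ m) (hf : X.π f = γ ^ n) :
    Commute e f := by
  obtain ⟨g, rfl⟩ := X.π_surj γ
  rw [← map_zpow] at he hf
  obtain ⟨k, rfl⟩ := X.exists_mul he
  obtain ⟨l, rfl⟩ := X.exists_mul hf
  exact (X.commute_ι _ _).mul_left
    ((X.commute_ι _ _).symm.mul_right (Commute.zpow_zpow_self g m n))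

lemma commute_of_unipotent {s t : ℚ} {e f : E} (he : X.π e = u12 s) (hf : X.π f = u12 t) :
    Commute e f := by
  refine X.commute_of_zpow (γ := u12 ((s.den : ℚ)⁻¹ * (t.den : ℚ)⁻¹)) (m := s.num * t.den)
    (n := t.num * s.den) ?_ ?_
  · rw [he, u12_zpow]
    congr 1
    have h1 : (s.den : ℚ) ≠ 0 := by exact_mod_cast s.den_nz
    have h2 : (t.den : ℚ) ≠ 0 := by exact_mod_cast t.den_nz
    push_cast
    rw [eq_comm]
    field_simp
    rw [mul_comm, s.mul_den_eq_num]
  · rw [hf, u12_zpow]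
    congr 1
    have h1 : (t.den : ℚ) ≠ 0 := by exact_mod_cast t.den_nz
    have h2 : (s.den : ℚ) ≠ 0 := by exact_mod_cast s.den_nz
    push_cast
    rw [eq_comm]
    field_simp
    rw [mul_comm, t.mul_den_eq_num]

/-- A set-theoretic section of the projection. -/
def lift (g : SL2Q) : E := (X.π_surj g).choose

@[simp] lemma π_lift (g : SL2Q) : X.π (X.lift g) = g := (X.π_surj g).choose_spec

/-- The rational unit `2`. -/
def two : ℚˣ := Units.mk0 2 two_ne_zero

/-- The canonical lift of the upper elementary matrix. -/
def x (t : ℚ) : E := ⁅X.lift (diag two), X.lift (u12 (t / 3))⁆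

lemma x_eq {t : ℚ} {e f : E} (he : X.π e = diag two) (hf : X.π f = u12 (t / 3)) :
    X.x t = ⁅e, f⁆ :=
  X.commutator_eq (by simp [he]) (by simp [hf])

@[simp] lemma π_x (t : ℚ) : X.π (X.x t) = u12 t := by
  rw [x, commutatorElement_def]
  simp only [map_mul, map_inv, π_lift]
  rw [diag_mul_u12, mul_inv_cancel_right, ← u12_neg, ← u12_add]
  congr 1
  simp [two]
  ring

lemma x_add (s t : ℚ) : X.x (s + t) = X.x s * X.x t := by
  have h : X.x (s + t) = ⁅X.lift (diag two), X.lift (u12 (s / 3)) * X.lift (u12 (t / 3))⁆ :=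
    X.x_eq (by simp) (by rw [map_mul, π_lift, π_lift, ← u12_add, add_div])
  have hc : Commute (X.lift (u12 (s / 3))) (X.x t) :=
    X.commute_of_unipotent (X.π_lift _) (X.π_x t)
  rw [h]
  have h2 : X.x s * X.x t = X.x s * (X.lift (u12 (s / 3)) * X.x t * (X.lift (u12 (s / 3)))⁻¹) := by
    rw [hc.eq, mul_inv_cancel_right]
  rw [h2]
  simp only [x, commutatorElement_def]
  group

@[simp] lemma x_zero : X.x 0 = 1 := by
  have := X.x_add 0 0
  rw [add_zero] at this
  exact (mul_eq_left.mp this.symm)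

lemma x_neg (t : ℚ) : X.x (-t) = (X.x t)⁻¹ := by
  rw [eq_inv_iff_mul_eq_one, ← X.x_add, neg_add_cancel, X.x_zero]

lemma conj_diag_x {e : E} {u : ℚˣ} (he : X.π e = diag u) (t : ℚ) :
    e * X.x t * e⁻¹ = X.x (u ^ 2 * t) := by
  have h : e * X.x t * e⁻¹ =
      ⁅e * X.lift (diag two) * e⁻¹, e * X.lift (u12 (t / 3)) * e⁻¹⁆ := by
    simp only [x, commutatorElement_def]; group
  rw [h]
  refine (X.x_eq ?_ ?_).symm
  · simp only [map_mul, map_inv, π_lift, he]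
    rw [← diag_mul, mul_comm, diag_mul, mul_inv_cancel_right]
  · simp only [map_mul, map_inv, π_lift, he]
    rw [diag_mul_u12, mul_inv_cancel_right, mul_div_assoc]

/-- The canonical lift of the lower elementary matrix. -/
def y (t : ℚ) : E := X.lift (wmat 1) * X.x (-t) * (X.lift (wmat 1))⁻¹

lemma y_add (s t : ℚ) : X.y (s + t) = X.y s * X.y t := by
  rw [y, neg_add, x_add, y, y]; group

@[simp] lemma y_zero : X.y 0 = 1 := by simp [y]

lemma y_neg (t : ℚ) : X.y (-t) = (X.y t)⁻¹ := by
  rw [eq_inv_iff_mul_eq_one, ← X.y_add, neg_add_cancel, X.y_zero]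

@[simp] lemma π_y (t : ℚ) : X.π (X.y t) = u21 t := by
  simp only [y, map_mul, map_inv, π_lift, π_x]
  rw [wmat_mul_u12, mul_inv_cancel_right]
  simp

lemma conj_wmat_x {e : E} {u : ℚˣ} (he : X.π e = wmat u) (t : ℚ) :
    e * X.x t * e⁻¹ = X.y (-((u : ℚ)⁻¹ ^ 2 * t)) := by
  have h : e * X.x t * e⁻¹ = X.lift (wmat 1) * (((X.lift (wmat 1))⁻¹ * e) * X.x t *
      ((X.lift (wmat 1))⁻¹ * e)⁻¹) * (X.lift (wmat 1))⁻¹ := by group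
  rw [h, X.conj_diag_x (u := u⁻¹), y, neg_neg]
  · simp
  · rw [map_mul, map_inv, π_lift, he, wmat_eq u, inv_mul_cancel_left]

lemma conj_wmat_y {e : E} {u : ℚˣ} (he : X.π e = wmat u) (t : ℚ) :
    e * X.y t * e⁻¹ = X.x (-((u : ℚ) ^ 2 * t)) := by
  have h : X.y t = e * X.x (-((u : ℚ) ^ 2 * t)) * e⁻¹ := by
    rw [X.conj_wmat_x he]
    congr 1
    field_simp
  have h2 : e * (e * X.x (-((u : ℚ) ^ 2 * t)) * e⁻¹) * e⁻¹ =
    (e * e) * X.x (-((u : ℚ) ^ 2 * t)) * (e * e)⁻¹ := by group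
  rw [h, h2, X.conj_diag_x (u := -1)]
  · simp
  · rw [map_mul, he, wmat_mul_wmat]; simp

lemma conj_diag_y {e : E} {u : ℚˣ} (he : X.π e = diag u) (t : ℚ) :
    e * X.y t * e⁻¹ = X.y ((u : ℚ)⁻¹ ^ 2 * t) := by
  have h2 : e * X.y t * e⁻¹ =
    (e * X.lift (wmat 1)) * X.x (-t) * (e * X.lift (wmat 1))⁻¹ := by rw [y]; group
  rw [h2, X.conj_wmat_x (u := u)]
  · congr 1; ring
  · rw [map_mul, he, π_lift, diag_mul_wmat, mul_one]

/-- The canonical lift of the Weyl element. -/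
def w (u : ℚˣ) : E := X.x u * X.y (-(u : ℚ)⁻¹) * X.x u

@[simp] lemma π_w (u : ℚˣ) : X.π (X.w u) = wmat u := by
  simp only [w, map_mul, π_x, π_y, u12_mul_u21_mul_u12]

lemma w_eq (u : ℚˣ) : X.w u = X.y (-(u : ℚ)⁻¹) * X.x u * X.y (-(u : ℚ)⁻¹) := by
  have h := X.conj_wmat_x (X.π_w u) u
  have h1 : -((u : ℚ)⁻¹ ^ 2 * u) = -(u : ℚ)⁻¹ := by field_simp
  rw [h1, mul_inv_eq_iff_eq_mul] at h
  apply mul_right_cancel (b := X.x u)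
  rw [h, w]
  simp only [mul_assoc]

lemma w_neg (u : ℚˣ) : X.w (-u) = (X.w u)⁻¹ := by
  simp only [w, Units.val_neg, X.x_neg, inv_neg, X.y_neg, mul_inv_rev, inv_inv, mul_assoc]

lemma conj_diag_w {e : E} {a : ℚˣ} (he : X.π e = diag a) (u : ℚˣ) :
    e * X.w u * e⁻¹ = X.w (a ^ 2 * u) := by
  have h : e * X.w u * e⁻¹ = (e * X.x u * e⁻¹) * (e * X.y (-(u : ℚ)⁻¹) * e⁻¹) *
    (e * X.x u * e⁻¹) := by rw [w]; group
  rw [h, X.conj_diag_x he, X.conj_diag_y he, w]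
  congr 3
  simp [mul_comm]

lemma conj_wmat_w {e : E} {a : ℚˣ} (he : X.π e = wmat a) (u : ℚˣ) :
    e * X.w u * e⁻¹ = X.w (a ^ 2 * u⁻¹) := by
  have h : e * X.w u * e⁻¹ = (e * X.x u * e⁻¹) * (e * X.y (-(u : ℚ)⁻¹) * e⁻¹) *
    (e * X.x u * e⁻¹) := by rw [w]; group
  rw [h, X.conj_wmat_x he, X.conj_wmat_y he, w_eq]
  congr 3 <;> simp [mul_comm]

/-- The canonical lift of the diagonal matrix. -/
def h (u : ℚˣ) : E := X.w u * X.w (-1)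

@[simp] lemma π_h (u : ℚˣ) : X.π (X.h u) = diag u := by
  rw [h, map_mul, π_w, π_w, wmat_mul_wmat]; simp

lemma w_eq_h_mul (u : ℚˣ) : X.w u = X.h u * X.w 1 := by
  rw [h, X.w_neg, inv_mul_cancel_right]

@[simp] lemma h_one : X.h 1 = 1 := by rw [h, X.w_neg, mul_inv_cancel]

lemma w_one_conj_h (u : ℚˣ) : X.w 1 * X.h u = X.h u⁻¹ * X.w 1 := by
  rw [← mul_inv_eq_iff_eq_mul]
  have : X.w 1 * X.h u * (X.w 1)⁻¹ = (X.w 1 * X.w u * (X.w 1)⁻¹) *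
    (X.w 1 * X.w (-1) * (X.w 1)⁻¹) := by rw [h]; group
  rw [this, X.conj_wmat_w (X.π_w 1), X.conj_wmat_w (X.π_w 1), h]
  simp

lemma w_one_mul_w_one : X.w 1 * X.w 1 = (X.h (-1))⁻¹ := by
  rw [h, X.w_neg, mul_inv_rev, inv_inv]

lemma h_neg_one_mul_w (u : ℚˣ) : X.h (-1) * X.w u = X.w u * X.h (-1) := by
  rw [← mul_inv_eq_iff_eq_mul, X.conj_diag_w (X.π_h _)]
  simp

lemma h_mul_h_neg_inv (u : ℚˣ) : X.h u * X.h (-u⁻¹) = X.h (-1) := by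
  have h1 := X.conj_wmat_w (X.π_w (-1)) (-u⁻¹)
  rw [mul_inv_eq_iff_eq_mul] at h1
  have h2 : X.h u * X.h (-u⁻¹) = X.w u * (X.w (-1) * X.w (-u⁻¹)) * X.w (-1) := by
    simp only [h, mul_assoc]
  have h3 : (-1 : ℚˣ) ^ 2 * (-u⁻¹)⁻¹ = -u := by simp [inv_neg]
  rw [h2, h1, h3, X.w_neg u, mul_inv_cancel_left, h]

lemma h_conj_h (a u : ℚˣ) : X.h a * X.h u = X.h (a ^ 2 * u) * (X.h (a ^ 2))⁻¹ * X.h a := by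
  rw [← mul_inv_eq_iff_eq_mul]
  have : X.h a * X.h u * (X.h a)⁻¹ = (X.h a * X.w u * (X.h a)⁻¹) *
    (X.h a * X.w (-1) * (X.h a)⁻¹) := by rw [show X.h u = X.w u * X.w (-1) from rfl]; group
  rw [this, X.conj_diag_w (X.π_h a), X.conj_diag_w (X.π_h a), mul_neg_one, X.w_neg, h, h,
    mul_inv_rev]
  group

lemma h_inv_eq (a : ℚˣ) : X.h a⁻¹ = (X.h (a ^ 2))⁻¹ * X.h a := by
  have := X.h_conj_h a a⁻¹
  rw [pow_two, mul_inv_cancel_right, mul_assoc, mul_right_inj, ← pow_two] at this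
  exact this

lemma h_mul_h (v u : ℚˣ) : X.h v * X.h u = X.h (v ^ 2 * u) * X.h v⁻¹ := by
  rw [h_conj_h, h_inv_eq, mul_assoc]

lemma x_eq_y_w_y (s : ℚˣ) : X.x s = X.y (s : ℚ)⁻¹ * X.w s * X.y (s : ℚ)⁻¹ := by
  rw [X.w_eq, X.y_neg]; group

lemma w_mul_w_one_mul_w (s t z : ℚˣ) (hz : (z : ℚ) = s * t - 1) :
    X.w s * X.w 1 * X.w (z * s⁻¹) = X.w (z * t⁻¹) * X.w 1 * X.w t := by
  have hy : ∀ r, X.y r * X.w 1 = X.w 1 * X.x (-r) := by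
    intro r
    have := X.conj_wmat_x (X.π_w 1) (-r)
    rw [mul_inv_eq_iff_eq_mul] at this
    simpa using this.symm
  have h1 : X.x s * X.w 1 * X.x t = X.y ((t : ℚ) / z) * (X.w s * X.w 1 * X.w (z * s⁻¹)) *
      X.y ((s : ℚ) / z) := by
    have e1 : X.x (-(s : ℚ)⁻¹) * X.x t = X.x ((z * s⁻¹ : ℚˣ) : ℚ) := by
      rw [← x_add]; congr 1; push_cast; rw [hz]; field_simp; ring
    have e2 := X.conj_diag_y (e := X.w s * X.w 1) (u := -s)
      (by rw [map_mul, π_w, π_w, wmat_mul_wmat]; simp) ((s : ℚ) / z)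
    rw [mul_inv_eq_iff_eq_mul] at e2
    have e3 : X.y ((t : ℚ) / z) = X.y (s : ℚ)⁻¹ * X.y ((((-s : ℚˣ) : ℚ)⁻¹) ^ 2 * (s / z)) := by
      rw [← y_add]; congr 1; push_cast; rw [← sub_eq_zero]; field_simp; rw [hz]; ring
    calc X.x s * X.w 1 * X.x t
        = X.y (s : ℚ)⁻¹ * X.w s * (X.y (s : ℚ)⁻¹ * X.w 1) * X.x t := by
          nth_rw 1 [X.x_eq_y_w_y s]; group
      _ = X.y (s : ℚ)⁻¹ * X.w s * X.w 1 * (X.x (-(s : ℚ)⁻¹) * X.x t) := by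
          rw [hy]; group
      _ = X.y (s : ℚ)⁻¹ * ((X.w s * X.w 1) * X.y ((s : ℚ) / z)) * X.w (z * s⁻¹) *
            X.y ((s : ℚ) / z) := by
          rw [e1, X.x_eq_y_w_y]; push_cast
          have : ((z : ℚ) * (s : ℚ)⁻¹)⁻¹ = s / z := by field_simp
          rw [this]; group
      _ = _ := by rw [e2, e3]; group
  have h2 : X.x s * X.w 1 * X.x t = X.y ((t : ℚ) / z) * (X.w (z * t⁻¹) * X.w 1 * X.w t) *
      X.y ((s : ℚ) / z) := by
    have e1 : X.x s * X.x (-(t : ℚ)⁻¹) = X.x ((z * t⁻¹ : ℚˣ) : ℚ) := by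
      rw [← x_add]; congr 1; push_cast; rw [hz]; field_simp; ring
    have e2 := X.conj_diag_y (e := X.w 1 * X.w t) (u := -t⁻¹)
      (by rw [map_mul, π_w, π_w, wmat_mul_wmat]; simp) ((t : ℚ)⁻¹ ^ 2 * (t / z))
    have e4 : ((-t⁻¹ : ℚˣ) : ℚ)⁻¹ ^ 2 * ((t : ℚ)⁻¹ ^ 2 * (t / z)) = t / z := by
      push_cast; field_simp
    rw [mul_inv_eq_iff_eq_mul, e4] at e2
    have e3 : X.y ((s : ℚ) / z) = X.y ((t : ℚ)⁻¹ ^ 2 * (t / z)) * X.y (t : ℚ)⁻¹ := by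
      rw [← y_add]; congr 1; rw [← sub_eq_zero]; field_simp; rw [hz]; ring
    calc X.x s * X.w 1 * X.x t
        = X.x s * (X.w 1 * X.y (t : ℚ)⁻¹) * X.w t * X.y (t : ℚ)⁻¹ := by
          nth_rw 1 [X.x_eq_y_w_y t]; group
      _ = X.x s * X.x (-(t : ℚ)⁻¹) * X.w 1 * X.w t * X.y (t : ℚ)⁻¹ := by
          have := X.conj_wmat_y (X.π_w 1) (t : ℚ)⁻¹
          rw [mul_inv_eq_iff_eq_mul] at this
          rw [this]; simp [mul_assoc]
      _ = X.y ((t : ℚ) / z) * X.w (z * t⁻¹) * (X.y ((t : ℚ) / z) * (X.w 1 * X.w t)) *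
            X.y (t : ℚ)⁻¹ := by
          rw [e1, X.x_eq_y_w_y]; push_cast
          have : ((z : ℚ) * (t : ℚ)⁻¹)⁻¹ = t / z := by field_simp
          rw [this]; group
      _ = _ := by rw [← e2, e3]; group
  rw [h1] at h2
  exact mul_left_cancel (mul_right_cancel h2)

lemma h_mul_h_eq (s t z : ℚˣ) (hz : (z : ℚ) = s * t - 1) :
    X.h s * X.h (z * s⁻¹) = X.h (z * t⁻¹) * X.h t := by
  have hw : ∀ u v, X.h u * X.h v = X.w u * X.w 1 * X.w v * X.h (-1) * X.w (-1) := by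
    intro u v
    rw [mul_assoc (X.w u * X.w 1), ← X.h_neg_one_mul_w v]
    simp only [h, X.w_neg 1]
    group
  rw [hw, hw, X.w_mul_w_one_mul_w s t z hz]

lemma exists_h_mul (u v : ℚˣ) : ∃ k, X.h u * X.h v = X.ι k * X.h (u * v) :=
  X.exists_mul (by simp only [map_mul, π_h, diag_mul])

/-- The symbol attached to a central extension. -/
def c (u v : ℚˣ) : K := (X.exists_h_mul u v).choose

lemma h_mul (u v : ℚˣ) : X.h u * X.h v = X.ι (X.c u v) * X.h (u * v) :=
  (X.exists_h_mul u v).choose_spec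

lemma c_eq_of_h_mul {u v u' v' : ℚˣ} (h1 : u * v = u' * v')
    (h2 : X.h u * X.h v = X.h u' * X.h v') : X.c u v = X.c u' v' := by
  rw [X.h_mul, X.h_mul, h1] at h2
  exact X.ι_inj (mul_right_cancel h2)

@[simp] lemma c_one_left (u : ℚˣ) : X.c 1 u = 0 := by
  have := X.h_mul 1 u
  rw [h_one, one_mul, one_mul] at this
  apply X.ι_inj
  rw [X.ι_zero]
  exact (mul_eq_right.mp this.symm)

@[simp] lemma c_one_right (u : ℚˣ) : X.c u 1 = 0 := by
  have := X.h_mul u 1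
  rw [h_one, mul_one, mul_one] at this
  apply X.ι_inj
  rw [X.ι_zero]
  exact (mul_eq_right.mp this.symm)

lemma c_cocycle (a b d : ℚˣ) : X.c a b + X.c (a * b) d = X.c b d + X.c a (b * d) := by
  apply X.ι_inj
  apply mul_right_cancel (b := X.h (a * b * d))
  have h1 : X.h a * X.h b * X.h d = X.ι (X.c a b + X.c (a * b) d) * X.h (a * b * d) := by
    rw [X.h_mul, mul_assoc, X.h_mul, X.ι_add, mul_assoc (X.ι _)]
  have h2 : X.h a * (X.h b * X.h d) = X.ι (X.c b d + X.c a (b * d)) * X.h (a * b * d) := by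
    rw [X.h_mul b, ← mul_assoc, ← X.ι_comm, mul_assoc, X.h_mul, X.ι_add, mul_assoc, mul_assoc a]
  rw [← h1, ← h2, mul_assoc]

lemma c_inv_inv (u v : ℚˣ) : X.c u⁻¹ v⁻¹ = X.c u v := by
  have h1 : X.w 1 * (X.h u * X.h v) = X.h u⁻¹ * X.h v⁻¹ * X.w 1 := by
    rw [← mul_assoc, w_one_conj_h, mul_assoc, w_one_conj_h, mul_assoc]
  rw [X.h_mul, X.h_mul, ← mul_assoc, ← X.ι_comm, mul_assoc, w_one_conj_h, ← mul_assoc,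
    mul_inv] at h1
  exact (X.ι_inj (mul_right_cancel (mul_right_cancel h1))).symm

lemma c_sq (u v : ℚˣ) : X.c v u = X.c (u * v ^ 2) v⁻¹ := by
  apply X.c_eq_of_h_mul
  · apply Units.ext; push_cast; field_simp
  · rw [X.h_mul_h, mul_comm u]

lemma c_neg_inv (u : ℚˣ) : X.c u (-u⁻¹) = 0 := by
  have := X.h_mul u (-u⁻¹)
  rw [h_mul_h_neg_inv, mul_neg, mul_inv_cancel] at this
  apply X.ι_inj
  rw [X.ι_zero]
  exact (mul_eq_right.mp this.symm)

lemma c_cyclic (v u : ℚˣ) : X.c v u = X.c u (-(u * v)⁻¹) := by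
  have := X.c_cocycle v u (-(v * u)⁻¹)
  have h2 : u * -(v * u)⁻¹ = -v⁻¹ := by rw [mul_inv_rev, mul_neg, mul_inv_cancel_left]
  rw [c_neg_inv, h2, c_neg_inv, add_zero, add_zero] at this
  rw [this, mul_comm]

lemma c_right_neg_mul (x y : ℚˣ) : X.c x (-(x * y)) = X.c x y := by
  rw [X.c_sq y x, ← X.c_inv_inv (y * x ^ 2), inv_inv, X.c_cyclic _ x]
  congr 1
  apply Units.ext; push_cast; field_simp

lemma c_left_neg_mul (x y : ℚˣ) : X.c (-(x * y)) y = X.c x y := by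
  have h1 : -(-(y * x)⁻¹ * y)⁻¹ = x := by apply Units.ext; push_cast; field_simp
  have h2 : -(-(y * x)⁻¹ * x) = y⁻¹ := by apply Units.ext; push_cast; field_simp
  rw [X.c_cyclic x y, X.c_cyclic y, h1, ← X.c_right_neg_mul (-(y * x)⁻¹), h2, ← X.c_inv_inv]
  congr 1
  apply Units.ext; push_cast; field_simp

lemma c_left_neg_div (x y : ℚˣ) : X.c (-(x * y⁻¹)) y = X.c x y := by
  rw [← X.c_left_neg_mul]
  simp

lemma c_swap_inv (x y : ℚˣ) : X.c y⁻¹ x = X.c x y := by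
  rw [← X.c_left_neg_div x y, ← X.c_inv_inv (-(x * y⁻¹)), X.c_cyclic (-(x * y⁻¹))⁻¹]
  congr 1
  apply Units.ext; push_cast; field_simp

lemma c_steinberg_left {x z : ℚˣ} (hz : (z : ℚ) = 1 - x) (y : ℚˣ) :
    X.c (y * z) x = X.c y x := by
  have h1 := X.c_eq_of_h_mul (by apply Units.ext; push_cast; field_simp)
    (X.h_mul_h_eq (y * z) y⁻¹ (-x) (by push_cast; rw [hz]; field_simp; ring))
  have e1 : -(y * z * (-x * (y * z)⁻¹)) = x := by apply Units.ext; push_cast; field_simp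
  have e2 : -(-x * y⁻¹⁻¹ * y⁻¹) = x := by apply Units.ext; push_cast; field_simp
  have e3 : -(-x * y⁻¹⁻¹ * x⁻¹) = y := by apply Units.ext; push_cast; field_simp
  rw [← X.c_right_neg_mul, e1, ← X.c_right_neg_mul (-x * y⁻¹⁻¹), e2,
    ← X.c_left_neg_div (-x * y⁻¹⁻¹), e3] at h1
  exact h1

lemma c_steinberg_right {x z : ℚˣ} (hz : (z : ℚ) = 1 - x) (y : ℚˣ) :
    X.c x (z * y) = X.c x y := by
  rw [← X.c_swap_inv, mul_inv_rev, ← X.c_steinberg_left hz, inv_mul_cancel_right, X.c_swap_inv]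

end CentralExt

namespace CentralExt

variable {K E : Type*} [AddCommGroup K] [Group E] (X : CentralExt K E)

lemma mul_ι_mul (e : E) (k : K) (a : E) : e * (X.ι k * a) = X.ι k * (e * a) := by
  rw [← mul_assoc, ← X.ι_comm, mul_assoc]

lemma h_mul_x (v : ℚˣ) (t : ℚ) : X.h v * X.x t = X.x (v ^ 2 * t) * X.h v := by
  rw [← mul_inv_eq_iff_eq_mul, X.conj_diag_x (X.π_h v)]

lemma h_mul_w (v u : ℚˣ) : X.h v * X.w u = X.ι (X.c v u) * X.w (v * u) := by
  rw [w_eq_h_mul, ← mul_assoc, X.h_mul, mul_assoc, ← w_eq_h_mul]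

lemma y_mul_w (t : ℚ) (u : ℚˣ) : X.y t * X.w u = X.w u * X.x (-((u : ℚ) ^ 2 * t)) := by
  rw [eq_comm, ← mul_inv_eq_iff_eq_mul, X.conj_wmat_x (X.π_w u)]
  congr 1
  field_simp

lemma w_one_mul_w (u : ℚˣ) :
    X.w 1 * X.w u = X.ι (-X.c (-u⁻¹) (-1)) * X.h (-u⁻¹) := by
  have h1 := X.h_mul (-u⁻¹) (-1)
  rw [mul_neg_one, neg_neg] at h1
  rw [X.w_eq_h_mul u, ← mul_assoc, w_one_conj_h, mul_assoc, w_one_mul_w_one, X.ι_neg,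
    eq_inv_mul_iff_mul_eq, ← mul_assoc, ← h1, mul_inv_cancel_right]

/-- The subgroup of the kernel generated by all symbols. -/
def symbols : AddSubgroup K := AddSubgroup.closure {k | ∃ u v, k = X.c u v}

lemma c_mem_symbols (u v : ℚˣ) : X.c u v ∈ X.symbols := AddSubgroup.subset_closure ⟨u, v, rfl⟩

/-- Elements in Bruhat normal form up to a product of symbols. -/
def IsNormal (e : E) : Prop :=
  ∃ k ∈ X.symbols, (∃ t u, e = X.ι k * (X.x t * X.h u)) ∨
    ∃ l u r, e = X.ι k * (X.x l * X.w u * X.x r)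

variable {X}

lemma IsNormal.ι_mul {e : E} (he : X.IsNormal e) {k : K} (hk : k ∈ X.symbols) :
    X.IsNormal (X.ι k * e) := by
  obtain ⟨k', hk', ⟨t, u, rfl⟩ | ⟨l, u, r, rfl⟩⟩ := he
  · exact ⟨k + k', add_mem hk hk', Or.inl ⟨t, u, by rw [X.ι_add, mul_assoc]⟩⟩
  · exact ⟨k + k', add_mem hk hk', Or.inr ⟨l, u, r, by rw [X.ι_add, mul_assoc (X.ι k)]⟩⟩

lemma IsNormal.x_mul {e : E} (he : X.IsNormal e) (s : ℚ) : X.IsNormal (X.x s * e) := by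
  obtain ⟨k', hk', ⟨t, u, rfl⟩ | ⟨l, u, r, rfl⟩⟩ := he
  · exact ⟨k', hk', Or.inl ⟨s + t, u, by rw [X.mul_ι_mul, X.x_add, mul_assoc]⟩⟩
  · exact ⟨k', hk', Or.inr ⟨s + l, u, r, by rw [X.mul_ι_mul, X.x_add]; simp only [mul_assoc]⟩⟩

lemma isNormal_xh (t : ℚ) (u : ℚˣ) : X.IsNormal (X.x t * X.h u) :=
  ⟨0, zero_mem _, Or.inl ⟨t, u, by rw [X.ι_zero, one_mul]⟩⟩

lemma isNormal_xwx (l : ℚ) (u : ℚˣ) (r : ℚ) : X.IsNormal (X.x l * X.w u * X.x r) :=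
  ⟨0, zero_mem _, Or.inr ⟨l, u, r, by rw [X.ι_zero, one_mul]⟩⟩

lemma isNormal_wx (u : ℚˣ) (r : ℚ) : X.IsNormal (X.w u * X.x r) := by
  simpa using X.isNormal_xwx 0 u r

lemma IsNormal.h_mul {e : E} (he : X.IsNormal e) (v : ℚˣ) : X.IsNormal (X.h v * e) := by
  obtain ⟨k', hk', ⟨t, u, rfl⟩ | ⟨l, u, r, rfl⟩⟩ := he
  all_goals rw [X.mul_ι_mul]; refine IsNormal.ι_mul ?_ hk'
  · rw [← mul_assoc, X.h_mul_x, mul_assoc, X.h_mul, X.mul_ι_mul]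
    exact (X.isNormal_xh _ _).ι_mul (X.c_mem_symbols _ _)
  · rw [← mul_assoc, ← mul_assoc, X.h_mul_x, mul_assoc (X.x _), X.h_mul_w, X.mul_ι_mul, mul_assoc]
    exact (X.isNormal_xwx _ _ _).ι_mul (X.c_mem_symbols _ _)

lemma IsNormal.w_one_mul {e : E} (he : X.IsNormal e) : X.IsNormal (X.w 1 * e) := by
  obtain ⟨k', hk', ⟨t, u, rfl⟩ | ⟨l, u, r, rfl⟩⟩ := he
  · have h1 : X.x t * X.h u = X.h u * X.x ((u : ℚ)⁻¹ ^ 2 * t) := by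
      rw [h_mul_x]; congr 2; field_simp
    rw [X.mul_ι_mul, h1]
    refine IsNormal.ι_mul ?_ hk'
    rw [← mul_assoc, w_one_conj_h, ← X.w_eq_h_mul]
    exact X.isNormal_wx _ _
  · rw [X.mul_ι_mul]
    refine IsNormal.ι_mul ?_ hk'
    by_cases hl : l = 0
    · have h1 : X.h (-u⁻¹) * X.x r = X.x (((-u⁻¹ : ℚˣ) : ℚ) ^ 2 * r) * X.h (-u⁻¹) := X.h_mul_x _ _
      rw [hl, X.x_zero, one_mul, ← mul_assoc, X.w_one_mul_w, mul_assoc, h1]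
      exact (X.isNormal_xh _ _).ι_mul (neg_mem (X.c_mem_symbols _ _))
    · lift l to ℚˣ using IsUnit.mk0 l hl
      have h1 : X.w 1 * (X.x l * X.w u * X.x r) = X.x (-(l : ℚ)⁻¹) * (X.w 1 * X.w l) *
          (X.w u * X.x (-((u : ℚ) ^ 2 * (l : ℚ)⁻¹) + r)) := by
        have h2 := X.conj_wmat_y (X.π_w 1) (l : ℚ)⁻¹
        rw [mul_inv_eq_iff_eq_mul] at h2
        have h3 : X.x (-(l : ℚ)⁻¹) * X.w 1 = X.w 1 * X.y (l : ℚ)⁻¹ := by rw [h2]; simp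
        rw [X.x_add, ← mul_assoc (X.w u), ← X.y_mul_w, ← mul_assoc (X.x (-(l : ℚ)⁻¹)), h3]
        nth_rw 1 [X.x_eq_y_w_y l]
        simp only [mul_assoc]
      rw [h1, X.w_one_mul_w, mul_assoc, mul_assoc]
      exact ((((X.isNormal_wx _ _).h_mul _).ι_mul (neg_mem (X.c_mem_symbols _ _))).x_mul _)

variable (X)

/-- The subgroup generated by the canonical lifts of elementary matrices. -/
def elem : Subgroup E := Subgroup.closure ({e | ∃ t, e = X.x t} ∪ {X.w 1})

lemma isNormal_of_mem_elem {e : E} (he : e ∈ X.elem) : X.IsNormal e := by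
  induction he using Subgroup.closure_induction_left with
  | one => simpa using X.isNormal_xh 0 1
  | mul_left a ha b _ hb =>
    rcases ha with ⟨t, rfl⟩ | rfl
    · exact hb.x_mul t
    · exact hb.w_one_mul
  | inv_mul_cancel a ha b _ hb =>
    rcases ha with ⟨t, rfl⟩ | rfl
    · rw [← X.x_neg]; exact hb.x_mul _
    · have : (X.w 1)⁻¹ = X.h (-1) * X.w 1 := by
        rw [← inv_inv (X.h (-1)), ← X.w_one_mul_w_one]; group
      rw [this, mul_assoc]
      exact hb.w_one_mul.h_mul _

lemma x_mem_elem (t : ℚ) : X.x t ∈ X.elem := Subgroup.subset_closure (Or.inl ⟨t, rfl⟩)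

lemma w_one_mem_elem : X.w 1 ∈ X.elem := Subgroup.subset_closure (Or.inr rfl)

lemma y_mem_elem (t : ℚ) : X.y t ∈ X.elem := by
  have := X.conj_wmat_x (X.π_w 1) (-t)
  simp only [Units.val_one, inv_one, one_pow, one_mul, neg_neg] at this
  rw [← this]
  exact mul_mem (mul_mem X.w_one_mem_elem (X.x_mem_elem _)) (inv_mem X.w_one_mem_elem)

lemma w_mem_elem (u : ℚˣ) : X.w u ∈ X.elem :=
  mul_mem (mul_mem (X.x_mem_elem _) (X.y_mem_elem _)) (X.x_mem_elem _)

lemma h_mem_elem (u : ℚˣ) : X.h u ∈ X.elem := mul_mem (X.w_mem_elem _) (X.w_mem_elem _)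

lemma exists_eq_ι_mul_elem (e : E) : ∃ k, ∃ b ∈ X.elem, e = X.ι k * b := by
  have hdet := SL2Q.det_eq (X.π e)
  by_cases hc : X.π e 1 0 = 0
  · rw [hc, mul_zero, sub_zero] at hdet
    have ha : X.π e 0 0 ≠ 0 := left_ne_zero_of_mul_eq_one hdet
    have : X.π e = X.π (X.x (X.π e 0 1 * X.π e 0 0) * X.h (Units.mk0 _ ha)) := by
      rw [map_mul, π_x, π_h]
      apply SL2Q.ext_fin <;> simp [SL2Q.mul_entry, hc, ha]
      exact eq_inv_of_mul_eq_one_right hdet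
    obtain ⟨k, hk⟩ := X.exists_mul this
    exact ⟨k, _, mul_mem (X.x_mem_elem _) (X.h_mem_elem _), hk⟩
  · have : X.π e = X.π (X.x (X.π e 0 0 / X.π e 1 0) * X.w (-(Units.mk0 _ hc)⁻¹) *
        X.x (X.π e 1 1 / X.π e 1 0)) := by
      rw [map_mul, map_mul, π_x, π_w, π_x]
      apply SL2Q.ext_fin <;> simp [SL2Q.mul_entry, hc]
      · field_simp
        linear_combination -hdet
      · field_simp
    obtain ⟨k, hk⟩ := X.exists_mul this
    exact ⟨k, _, mul_mem (mul_mem (X.x_mem_elem _) (X.w_mem_elem _)) (X.x_mem_elem _), hk⟩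

lemma commutator_le_elem : commutator E ≤ X.elem := by
  rw [commutator_def, Subgroup.commutator_le]
  intro e _ f _
  obtain ⟨k, b, hb, rfl⟩ := X.exists_eq_ι_mul_elem e
  obtain ⟨l, b', hb', rfl⟩ := X.exists_eq_ι_mul_elem f
  rw [X.commutator_eq (e' := b) (f' := b') (by rw [map_mul, X.π_ι, one_mul])
    (by rw [map_mul, X.π_ι, one_mul])]
  exact mul_mem (mul_mem (mul_mem hb hb') (inv_mem hb)) (inv_mem hb')

/-- The kernel of the commutator subgroup is generated by symbols. -/
lemma exists_symbols_of_mem_commutator {e : E} (he : e ∈ commutator E) (h1 : X.π e = 1) :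
    ∃ k ∈ X.symbols, e = X.ι k := by
  obtain ⟨k, hk, ⟨t, u, rfl⟩ | ⟨l, u, r, rfl⟩⟩ := X.isNormal_of_mem_elem (X.commutator_le_elem he)
  · simp only [map_mul, X.π_ι, one_mul, π_x, π_h] at h1
    have e1 := congrArg (fun g : SL2Q => g 0 0) h1
    have e2 := congrArg (fun g : SL2Q => g 0 1) h1
    simp [SL2Q.mul_entry] at e1 e2
    refine ⟨k, hk, ?_⟩
    rw [e1, e2]
    simp
  · simp only [map_mul, X.π_ι, one_mul, π_x, π_w] at h1
    have e1 := congrArg (fun g : SL2Q => g 1 0) h1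
    simp [SL2Q.mul_entry] at e1

lemma x_mem_commutator (t : ℚ) : X.x t ∈ commutator E :=
  Subgroup.commutator_mem_commutator (Subgroup.mem_top _) (Subgroup.mem_top _)

lemma y_mem_commutator (t : ℚ) : X.y t ∈ commutator E :=
  Subgroup.Normal.conj_mem inferInstance _ (X.x_mem_commutator _) _

lemma w_mem_commutator (u : ℚˣ) : X.w u ∈ commutator E :=
  mul_mem (mul_mem (X.x_mem_commutator _) (X.y_mem_commutator _)) (X.x_mem_commutator _)

lemma h_mem_commutator (u : ℚˣ) : X.h u ∈ commutator E :=
  mul_mem (X.w_mem_commutator _) (X.w_mem_commutator _)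

lemma ι_c_mem_commutator (u v : ℚˣ) : X.ι (X.c u v) ∈ commutator E := by
  rw [← mul_inv_eq_iff_eq_mul.mpr (X.h_mul u v)]
  exact mul_mem (mul_mem (X.h_mem_commutator _) (X.h_mem_commutator _))
    (inv_mem (X.h_mem_commutator _))

/-- Comparison of the two normal forms of an element of the big cell. -/
lemma y_h_x_eq (a c : ℚˣ) (b d : ℚ) (hdet : (a : ℚ) * d - b * c = 1) :
    X.y ((c : ℚ) / a) * X.h a * X.x (b / a) =
      X.ι (X.c c a) * (X.x ((a : ℚ) / c) * X.w (-c⁻¹) * X.x (d / c)) := by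
  have h1 : X.y ((c : ℚ) / a) = X.x ((a : ℚ) / c) * X.w (-(a * c⁻¹)) * X.x ((a : ℚ) / c) := by
    have e1 : ((-(a * c⁻¹) : ℚˣ) : ℚ) = -((a : ℚ) / c) := by push_cast; rw [div_eq_mul_inv]
    have e2 : -(-((a : ℚ) / c))⁻¹ = c / a := by field_simp
    rw [w, e1, e2, X.x_neg]
    group
  have h2 : X.x ((a : ℚ) / c) * X.h a = X.h a * X.x ((a : ℚ) / c / (a : ℚ) ^ 2) := by
    rw [h_mul_x]; congr 2; field_simp
  have h3 : X.w (-(a * c⁻¹)) * X.h a = X.ι (X.c c a) * X.w (-c⁻¹) := by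
    have e1 : -(a * c⁻¹) * a⁻¹ = -c⁻¹ := by apply Units.ext; push_cast; field_simp
    have e2 : (-(a * c⁻¹))⁻¹ = -(c * a⁻¹) := by apply Units.ext; push_cast; field_simp
    rw [w_eq_h_mul, mul_assoc, w_one_conj_h, ← mul_assoc, X.h_mul, mul_assoc, X.w_eq_h_mul (-c⁻¹),
      e1, ← X.c_inv_inv, inv_inv, e2, X.c_left_neg_div]
  have h4 : X.x ((a : ℚ) / c / (a : ℚ) ^ 2) * X.x (b / a) = X.x (d / c) := by
    rw [← x_add]; congr 1; field_simp; linear_combination -hdet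
  calc _ = X.x ((a : ℚ) / c) * X.w (-(a * c⁻¹)) * (X.x ((a : ℚ) / c) * X.h a) * X.x (b / a) := by
        rw [h1]; simp only [mul_assoc]
    _ = X.x ((a : ℚ) / c) * (X.w (-(a * c⁻¹)) * X.h a) *
          (X.x ((a : ℚ) / c / (a : ℚ) ^ 2) * X.x (b / a)) := by rw [h2]; simp only [mul_assoc]
    _ = _ := by rw [h3, h4, X.mul_ι_mul]; simp only [mul_assoc]

end CentralExt

/-- The rational units having trivial valuation at every prime `q ≥ n`. -/
def smooth (n : ℕ) : Subgroup ℚˣ where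
  carrier := {u | ∀ q : ℕ, q.Prime → n ≤ q → padicValRat q u = 0}
  one_mem' := by intro q _ _; simp
  mul_mem' := by
    intro u v hu hv q hq hn
    have := Fact.mk hq
    rw [Units.val_mul, padicValRat.mul u.ne_zero v.ne_zero, hu q hq hn, hv q hq hn, add_zero]
  inv_mem' := by
    intro u hu q hq hn
    have := Fact.mk hq
    rw [Units.val_inv_eq_inv_val, padicValRat.inv, hu q hq hn, neg_zero]

lemma smooth_mono {m n : ℕ} (h : m ≤ n) : smooth m ≤ smooth n :=
  fun _ hu q hq hn => hu q hq (h.trans hn)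

lemma mem_smooth_of_int {n : ℕ} {u : ℚˣ} {a : ℤ} (hu : (u : ℚ) = a) (ha : a.natAbs < n) :
    u ∈ smooth n := by
  intro q hq hn
  have ha0 : a ≠ 0 := by rintro rfl; exact u.ne_zero (by simp [hu])
  rw [hu, padicValRat.of_int, padicValInt.eq_zero_of_not_dvd]
  · rfl
  · intro h
    have := Nat.le_of_dvd (Int.natAbs_pos.mpr ha0) (Int.natCast_dvd.mp h)
    omega

namespace CentralExt

variable {K E : Type*} [AddCommGroup K] [Group E] (X : CentralExt K E)

/-- The subgroup of the kernel generated by symbols in `smooth n`. -/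
def filt (n : ℕ) : AddSubgroup K :=
  AddSubgroup.closure {k | ∃ u ∈ smooth n, ∃ v ∈ smooth n, k = X.c u v}

lemma c_mem_filt_of_smooth {n : ℕ} {u v : ℚˣ} (hu : u ∈ smooth n) (hv : v ∈ smooth n) :
    X.c u v ∈ X.filt n := AddSubgroup.subset_closure ⟨u, hu, v, hv, rfl⟩

lemma filt_mono {m n : ℕ} (h : m ≤ n) : X.filt m ≤ X.filt n := by
  rw [filt, AddSubgroup.closure_le]
  rintro _ ⟨u, hu, v, hv, rfl⟩
  exact X.c_mem_filt_of_smooth (smooth_mono h hu) (smooth_mono h hv)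

section Subgroup

variable {X}
variable {L : Subgroup E} {A : Subring ℚ}

lemma w_mem_of_mem (hx : ∀ t ∈ A, X.x t ∈ L) (hy : ∀ t ∈ A, X.y t ∈ L) {u : ℚˣ}
    (hu : (u : ℚ) ∈ A) (hu' : (u : ℚ)⁻¹ ∈ A) : X.w u ∈ L :=
  mul_mem (mul_mem (hx _ hu) (hy _ (neg_mem hu'))) (hx _ hu)

lemma h_mem_of_mem (hx : ∀ t ∈ A, X.x t ∈ L) (hy : ∀ t ∈ A, X.y t ∈ L) {u : ℚˣ}
    (hu : (u : ℚ) ∈ A) (hu' : (u : ℚ)⁻¹ ∈ A) : X.h u ∈ L :=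
  mul_mem (w_mem_of_mem hx hy hu hu')
    (w_mem_of_mem hx hy (by simp)
      (by simp))

lemma exists_natAbs_sub_mul_lt {a c : ℤ} (hc : c ≠ 0) (h : c.natAbs ≤ a.natAbs) :
    ∃ ε : ℤ, (a - ε * c).natAbs < a.natAbs := by
  rcases le_or_gt 0 (a * c) with hac | hac
  · refine ⟨1, ?_⟩
    rcases le_or_gt 0 a with h1 | h1 <;> rcases lt_or_gt_of_ne hc with h2 | h2
    · have : a = 0 := by nlinarith
      omega
    · omega
    · omega
    · nlinarith
  · refine ⟨-1, ?_⟩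
    rcases le_or_gt 0 a with h1 | h1 <;> rcases lt_or_gt_of_ne hc with h2 | h2
    · omega
    · nlinarith
    · nlinarith
    · omega

lemma euclid_mem (hx : ∀ t ∈ A, X.x t ∈ L) (hy : ∀ t ∈ A, X.y t ∈ L) (p : ℕ) (n : ℕ) :
    ∀ a b c d : ℤ, a.natAbs + c.natAbs ≤ n → a.natAbs < p → c.natAbs < p → a * d - b * c = 1 →
      (∀ u : ℚˣ, (u : ℚ) = a →
        ∃ k ∈ X.filt p, X.ι k * (X.y ((c : ℚ) / a) * X.h u * X.x ((b : ℚ) / a)) ∈ L) ∧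
      (∀ u : ℚˣ, (u : ℚ) = c →
        ∃ k ∈ X.filt p, X.ι k * (X.x ((a : ℚ) / c) * X.w (-u⁻¹) * X.x ((d : ℚ) / c)) ∈ L) := by
  have hZ : ∀ m : ℤ, (m : ℚ) ∈ A := fun m => intCast_mem A m
  induction n using Nat.strong_induction_on with
  | _ n ih =>
  intro a b c d hn ha hc hdet
  by_cases ha0 : a = 0
  · subst ha0
    refine ⟨fun u hu => absurd hu (by simp), fun u hu => ⟨0, zero_mem _, ?_⟩⟩
    have hc1 : IsUnit c := IsUnit.of_mul_eq_one (-b) (by linarith)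
    have hinv : (c : ℚ)⁻¹ = c := by rcases Int.isUnit_iff.mp hc1 with rfl | rfl <;> norm_num
    rw [X.ι_zero, one_mul]
    refine mul_mem (mul_mem (hx _ ?_) (w_mem_of_mem hx hy ?_ ?_)) (hx _ ?_)
    · simp
    · push_cast; rw [hu, hinv]; exact neg_mem (hZ c)
    · push_cast; rw [hu, inv_neg, inv_inv]; exact neg_mem (hZ c)
    · rw [div_eq_mul_inv, hinv]; exact mul_mem (hZ _) (hZ _)
  by_cases hc0 : c = 0
  · subst hc0
    refine ⟨fun u hu => ⟨0, zero_mem _, ?_⟩, fun u hu => absurd hu (by simp)⟩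
    have ha1 : IsUnit a := IsUnit.of_mul_eq_one d (by linarith)
    have hinv : (a : ℚ)⁻¹ = a := by rcases Int.isUnit_iff.mp ha1 with rfl | rfl <;> norm_num
    rw [X.ι_zero, one_mul]
    refine mul_mem (mul_mem (hy _ ?_) (h_mem_of_mem hx hy ?_ ?_)) (hx _ ?_)
    · simp
    · rw [hu]; exact hZ a
    · rw [hu, hinv]; exact hZ a
    · rw [div_eq_mul_inv, hinv]; exact mul_mem (hZ _) (hZ _)
  have haQ : (a : ℚ) ≠ 0 := by exact_mod_cast ha0
  have hcQ : (c : ℚ) ≠ 0 := by exact_mod_cast hc0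
  have hdetQ : (a : ℚ) * d - b * c = 1 := by exact_mod_cast hdet
  have hcmp := X.y_h_x_eq (Units.mk0 _ haQ) (Units.mk0 _ hcQ) b d hdetQ
  simp only [Units.val_mk0] at hcmp
  have hmem : X.c (Units.mk0 _ hcQ) (Units.mk0 _ haQ) ∈ X.filt p :=
    X.c_mem_filt_of_smooth (mem_smooth_of_int (Units.val_mk0 _) hc)
      (mem_smooth_of_int (Units.val_mk0 _) ha)
  have hua : ∀ u : ℚˣ, (u : ℚ) = a → u = Units.mk0 _ haQ := fun u hu => Units.ext hu
  have huc : ∀ u : ℚˣ, (u : ℚ) = c → u = Units.mk0 _ hcQ := fun u hu => Units.ext hu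
  rcases le_or_gt c.natAbs a.natAbs with hle | hlt
  · obtain ⟨ε, hε⟩ := exists_natAbs_sub_mul_lt hc0 hle
    obtain ⟨k, hk, hkL⟩ := (ih ((a - ε * c).natAbs + c.natAbs) (by omega) (a - ε * c) (b - ε * d)
      c d le_rfl (by omega) hc (by linarith)).2 (Units.mk0 _ hcQ) rfl
    have h1 : X.ι k * (X.x ((a : ℚ) / c) * X.w (-(Units.mk0 _ hcQ)⁻¹) * X.x ((d : ℚ) / c)) ∈ L := by
      have : (a : ℚ) / c = ε + ((a - ε * c : ℤ) : ℚ) / c := by push_cast; field_simp; ring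
      rw [this, X.x_add]
      have h2 := mul_mem (hx _ (hZ ε)) hkL
      rw [X.mul_ι_mul] at h2
      simpa only [mul_assoc] using h2
    refine ⟨fun u hu => ⟨k - X.c (Units.mk0 _ hcQ) (Units.mk0 _ haQ), sub_mem hk hmem, ?_⟩,
      fun u hu => ⟨k, hk, ?_⟩⟩
    · rw [hua u hu, hcmp, ← mul_assoc, ← X.ι_add, sub_add_cancel]
      exact h1
    · rw [huc u hu]; exact h1
  · obtain ⟨ε, hε⟩ := exists_natAbs_sub_mul_lt ha0 hlt.le
    obtain ⟨k, hk, hkL⟩ := (ih (a.natAbs + (c - ε * a).natAbs) (by omega) a b (c - ε * a)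
      (d - ε * b) le_rfl ha (by omega) (by linarith)).1 (Units.mk0 _ haQ) rfl
    have h1 : X.ι k * (X.y ((c : ℚ) / a) * X.h (Units.mk0 _ haQ) * X.x ((b : ℚ) / a)) ∈ L := by
      have : (c : ℚ) / a = ε + ((c - ε * a : ℤ) : ℚ) / a := by push_cast; field_simp; ring
      rw [this, X.y_add]
      have h2 := mul_mem (hy _ (hZ ε)) hkL
      rw [X.mul_ι_mul] at h2
      simpa only [mul_assoc] using h2
    refine ⟨fun u hu => ⟨k, hk, ?_⟩, fun u hu =>
      ⟨k + X.c (Units.mk0 _ hcQ) (Units.mk0 _ haQ), add_mem hk hmem, ?_⟩⟩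
    · rw [hua u hu]; exact h1
    · rw [huc u hu, X.ι_add, mul_assoc, ← hcmp]
      exact h1

/-- If a subgroup splitting the extension over `SL₂(A)` contains the elementary lifts, then the
symbols of primes inverted in `A` reduce to symbols of smaller primes. -/
lemma c_mem_filt_of_inv_mem (hL : ∀ e ∈ L, X.π e = 1 → e = 1) (hx : ∀ t ∈ A, X.x t ∈ L)
    (hy : ∀ t ∈ A, X.y t ∈ L) {p : ℕ} (hp : p.Prime) (hpA : (p : ℚ)⁻¹ ∈ A) {a : ℕ} (ha0 : 0 < a)
    (hap : a < p) {u v : ℚˣ} (hu : (u : ℚ) = p) (hv : (v : ℚ) = a) : X.c u v ∈ X.filt p := by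
  have hZ : ∀ m : ℤ, (m : ℚ) ∈ A := fun m => intCast_mem A m
  have hcop : IsCoprime (a : ℤ) (p : ℤ) :=
    Nat.isCoprime_iff_coprime.mpr (Nat.coprime_of_lt_prime ha0.ne' hap hp).symm
  obtain ⟨d, b, hdb⟩ := hcop
  have hdet : (a : ℤ) * d - (-b) * p = 1 := by linarith
  have hdetQ : (v : ℚ) * (d : ℚ) - ((-b : ℤ) : ℚ) * u = 1 := by rw [hu, hv]; exact_mod_cast hdet
  obtain ⟨k, hk, hkL⟩ := (euclid_mem hx hy p _ a (-b) (p - a) (d + b) le_rfl (by omega) (by omega)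
    (by linarith)).1 v hv
  have hcmp := X.y_h_x_eq v u _ _ hdetQ
  have h1 : X.ι k * (X.y ((u : ℚ) / v) * X.h v * X.x (((-b : ℤ) : ℚ) / v)) ∈ L := by
    have : (u : ℚ) / v = (1 : ℤ) + (((p : ℤ) - (a : ℤ) : ℤ) : ℚ) / v := by
      rw [hu]; push_cast; rw [← hv]; field_simp; ring
    rw [this, X.y_add]
    have h2 := mul_mem (hy _ (hZ 1)) hkL
    rw [X.mul_ι_mul, Int.cast_natCast, ← hv] at h2
    simpa only [mul_assoc] using h2
  have h3 : X.x ((v : ℚ) / u) * X.w (-u⁻¹) * X.x (d / u) ∈ L := by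
    refine mul_mem (mul_mem (hx _ ?_) (w_mem_of_mem hx hy ?_ ?_)) (hx _ ?_)
    · rw [hv, hu, div_eq_mul_inv]; exact mul_mem (natCast_mem A a) hpA
    · push_cast; rw [hu]; exact neg_mem hpA
    · push_cast; rw [inv_neg, inv_inv, hu]; exact neg_mem (natCast_mem A p)
    · rw [hu, div_eq_mul_inv]; exact mul_mem (hZ d) hpA
  rw [hcmp, ← mul_assoc, ← X.ι_add] at h1
  have h4 := hL _ ((Subgroup.mul_mem_cancel_right L h3).mp h1) (X.π_ι _)
  rw [← X.ι_zero] at h4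
  rw [eq_neg_of_add_eq_zero_right (X.ι_inj h4)]
  exact neg_mem hk

lemma c_eq_zero_of_mem (hL : ∀ e ∈ L, X.π e = 1 → e = 1) (hx : ∀ t ∈ A, X.x t ∈ L)
    (hy : ∀ t ∈ A, X.y t ∈ L) {u v : ℚˣ} (hu : (u : ℚ) ∈ A) (hu' : (u : ℚ)⁻¹ ∈ A)
    (hv : (v : ℚ) ∈ A) (hv' : (v : ℚ)⁻¹ ∈ A) : X.c u v = 0 := by
  have h1 := X.h_mul u v
  have h2 : X.ι (X.c u v) ∈ L := by
    rw [← mul_inv_eq_iff_eq_mul.mpr h1]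
    refine mul_mem (mul_mem (h_mem_of_mem hx hy hu hu') (h_mem_of_mem hx hy hv hv'))
      (inv_mem (h_mem_of_mem hx hy ?_ ?_))
    · push_cast; exact mul_mem hu hv
    · push_cast; rw [mul_inv]; exact mul_mem hu' hv'
  exact X.ι_inj ((hL _ h2 (X.π_ι _)).trans X.ι_zero.symm)

end Subgroup

end CentralExt

section Residue

variable (p : ℕ) [hp : Fact p.Prime]

lemma den_cast_ne_zero {x : ℚ} (hx : 0 ≤ padicValRat p x) : ((x.den : ℕ) : ZMod p) ≠ 0 := by
  intro h
  rw [ZMod.natCast_eq_zero_iff] at h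
  have hnum : ¬ (p : ℤ) ∣ x.num := by
    intro h2
    have := Nat.dvd_gcd (Int.natCast_dvd.mp h2) h
    rw [x.reduced] at this
    exact hp.out.one_lt.ne' (Nat.dvd_one.mp this)
  have h1 : 1 ≤ padicValNat p x.den := one_le_padicValNat_of_dvd x.den_nz h
  rw [padicValRat.eq_1, padicValInt.eq_zero_of_not_dvd hnum] at hx
  rw [Nat.cast_zero] at hx
  omega

lemma num_cast_ne_zero {x : ℚ} (hx0 : x ≠ 0) (hx : padicValRat p x ≤ 0) :
    ((x.num : ℤ) : ZMod p) ≠ 0 := by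
  intro h
  rw [ZMod.intCast_zmod_eq_zero_iff_dvd] at h
  have hden : ¬ p ∣ x.den := by
    intro h2
    have := Nat.dvd_gcd (Int.natCast_dvd.mp h) h2
    rw [x.reduced] at this
    exact hp.out.one_lt.ne' (Nat.dvd_one.mp this)
  have h1 : 1 ≤ padicValInt p x.num := one_le_padicValNat_of_dvd
    (by simpa using hx0) (Int.natCast_dvd.mp h)
  rw [padicValRat.eq_1, padicValNat.eq_zero_of_not_dvd hden] at hx
  rw [Nat.cast_zero] at hx
  omega

lemma ratCast_ne_zero {x : ℚ} (hx0 : x ≠ 0) (hx : padicValRat p x = 0) : (x : ZMod p) ≠ 0 := by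
  rw [Rat.cast_def]
  exact div_ne_zero (num_cast_ne_zero p hx0 hx.le) (den_cast_ne_zero p hx.ge)

lemma ratCast_eq_zero {x : ℚ} (hx : 0 < padicValRat p x) : (x : ZMod p) = 0 := by
  have : ((x.num : ℤ) : ZMod p) = 0 := by
    rw [ZMod.intCast_zmod_eq_zero_iff_dvd]
    by_contra h
    rw [padicValRat.eq_1, padicValInt.eq_zero_of_not_dvd h] at hx
    rw [Nat.cast_zero] at hx
    omega
  rw [Rat.cast_def, this, zero_div]

lemma ratCast_add {x y : ℚ} (hx : 0 ≤ padicValRat p x) (hy : 0 ≤ padicValRat p y) :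
    ((x + y : ℚ) : ZMod p) = x + y :=
  Rat.cast_add_of_ne_zero (den_cast_ne_zero p hx) (den_cast_ne_zero p hy)

lemma ratCast_mul {x y : ℚ} (hx : 0 ≤ padicValRat p x) (hy : 0 ≤ padicValRat p y) :
    ((x * y : ℚ) : ZMod p) = x * y :=
  Rat.cast_mul_of_ne_zero (den_cast_ne_zero p hx) (den_cast_ne_zero p hy)

/-- The prime `p` as a unit of `ℚ`. -/
def primeUnit : ℚˣ := Units.mk0 (p : ℚ) (by exact_mod_cast hp.out.ne_zero)

@[simp] lemma val_primeUnit : (primeUnit p : ℚ) = p := rfl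

lemma padicValRat_primeUnit : padicValRat p (primeUnit p) = 1 := by
  rw [val_primeUnit, padicValRat.self hp.out.one_lt]

lemma padicValRat_mul_zpow (u : ℚˣ) (n : ℤ) :
    padicValRat p ((u * primeUnit p ^ n : ℚˣ) : ℚ) = padicValRat p u + n := by
  rw [Units.val_mul, padicValRat.mul u.ne_zero (Units.ne_zero _), Units.val_zpow_eq_zpow_val,
    padicValRat.zpow, padicValRat_primeUnit, mul_one]

/-- The residue of the unit part of a nonzero rational number at `p`. -/
def res : ℚˣ →* (ZMod p)ˣ :=
  MonoidHom.toHomUnits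
    { toFun := fun u => (((u * primeUnit p ^ (-padicValRat p u) : ℚˣ) : ℚ) : ZMod p)
      map_one' := by simp
      map_mul' := by
        intro u v
        rw [← ratCast_mul]
        · congr 1
          rw [← Units.val_mul, Units.val_mul u v, padicValRat.mul u.ne_zero v.ne_zero, neg_add,
            zpow_add]
          congr 1
          exact mul_mul_mul_comm _ _ _ _
        · rw [padicValRat_mul_zpow, add_neg_cancel]
        · rw [padicValRat_mul_zpow, add_neg_cancel] }

lemma val_res (u : ℚˣ) : (res p u : ZMod p) =
    (((u * primeUnit p ^ (-padicValRat p u) : ℚˣ) : ℚ) : ZMod p) := rfl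

variable {p}

lemma val_res_of_val_eq_zero {u : ℚˣ} (hu : padicValRat p u = 0) :
    (res p u : ZMod p) = ((u : ℚ) : ZMod p) := by
  rw [val_res, hu, neg_zero, zpow_zero, mul_one]

lemma res_neg_one : res p (-1) = -1 := by
  apply Units.ext
  rw [val_res_of_val_eq_zero (by simp)]
  simp

lemma res_neg (u : ℚˣ) : res p (-u) = -res p u := by
  rw [neg_eq_neg_one_mul, map_mul, res_neg_one, neg_one_mul]

lemma padicValRat_int_eq_zero {a : ℤ} (h : (a : ZMod p) ≠ 0) : padicValRat p (a : ℚ) = 0 := by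
  rw [padicValRat.of_int, padicValInt.eq_zero_of_not_dvd]
  · rfl
  · rwa [Ne, ZMod.intCast_zmod_eq_zero_iff_dvd] at h

lemma val_res_of_int {u : ℚˣ} {a : ℤ} (hu : (u : ℚ) = a) (h : (a : ZMod p) ≠ 0) :
    (res p u : ZMod p) = a := by
  rw [val_res_of_val_eq_zero, hu, Rat.cast_intCast]
  rw [hu]
  exact padicValRat_int_eq_zero h

lemma int_cast_ne_zero_of_natAbs_lt {a : ℤ} (h0 : a ≠ 0) (h : a.natAbs < p) :
    (a : ZMod p) ≠ 0 := by
  rw [Ne, ZMod.intCast_zmod_eq_zero_iff_dvd]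
  intro h2
  have := Nat.le_of_dvd (Int.natAbs_pos.mpr h0) (Int.natCast_dvd.mp h2)
  omega

lemma padicValRat_primeUnit_of_ne {q : ℕ} [Fact q.Prime] (h : p ≠ q) :
    padicValRat p (primeUnit q) = 0 := by
  rw [val_primeUnit, padicValRat.of_nat, padicValNat_primes h]
  rfl

end Residue

/-- The subgroup `smooth n` is generated by `-1` and the primes below `n`. -/
lemma smooth_le {n : ℕ} {H : Subgroup ℚˣ} (h1 : -1 ∈ H)
    (hq : ∀ q : ℕ, q.Prime → q < n → ∀ u : ℚˣ, (u : ℚ) = q → u ∈ H) : smooth n ≤ H := by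
  have hnat : ∀ m : ℕ, (∀ q : ℕ, q.Prime → q ∣ m → q < n) → ∀ u : ℚˣ, (u : ℚ) = m → u ∈ H := by
    intro m
    induction m using Nat.strong_induction_on with
    | _ m ih =>
    intro hm u hu
    rcases eq_or_ne m 1 with rfl | hm1
    · have : u = 1 := Units.ext (by simpa using hu)
      rw [this]; exact one_mem H
    have hm0 : m ≠ 0 := by rintro rfl; exact u.ne_zero (by simp [hu])
    have hpr := Nat.minFac_prime hm1
    obtain ⟨k, hk⟩ := Nat.minFac_dvd m
    have hk0 : k ≠ 0 := by rintro rfl; exact hm0 (by simpa using hk)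
    have hlt : k < m := by
      rw [hk]
      exact lt_mul_of_one_lt_left (Nat.pos_of_ne_zero hk0) hpr.one_lt
    have hkQ : (k : ℚ) ≠ 0 := by exact_mod_cast hk0
    have hmQ : (m.minFac : ℚ) ≠ 0 := by exact_mod_cast hpr.ne_zero
    have : u = Units.mk0 _ hmQ * Units.mk0 _ hkQ := Units.ext (by
      rw [hu]; push_cast; rw [Units.val_mk0, Units.val_mk0]; exact_mod_cast hk)
    rw [this]
    exact mul_mem (hq _ hpr (hm _ hpr (Nat.minFac_dvd m)) _ rfl)
      (ih k hlt (fun q hqp hqk => hm q hqp (hqk.trans ⟨_, hk.trans (mul_comm _ _)⟩)) _ rfl)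
  intro u hu
  have hsm : ∀ q : ℕ, q.Prime → n ≤ q → ¬ q ∣ (u : ℚ).num.natAbs ∧ ¬ q ∣ (u : ℚ).den := by
    intro q hqp hqn
    have := Fact.mk hqp
    have h2 := hu q hqp hqn
    constructor
    · intro h
      exact num_cast_ne_zero q u.ne_zero h2.le
        ((ZMod.intCast_zmod_eq_zero_iff_dvd _ _).mpr (Int.natCast_dvd.mpr h))
    · intro h
      exact den_cast_ne_zero q h2.ge ((ZMod.natCast_eq_zero_iff _ _).mpr h)
  have hnum : (u : ℚ).num ≠ 0 := by simp
  have hnQ : (((u : ℚ).num.natAbs : ℕ) : ℚ) ≠ 0 := by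
    exact_mod_cast Int.natAbs_ne_zero.mpr hnum
  have hdQ : (((u : ℚ).den : ℕ) : ℚ) ≠ 0 := by exact_mod_cast (u : ℚ).den_nz
  have hN := hnat _ (fun q hqp hd => not_le.mp fun h => (hsm q hqp h).1 hd) (Units.mk0 _ hnQ) rfl
  have hD := hnat _ (fun q hqp hd => not_le.mp fun h => (hsm q hqp h).2 hd) (Units.mk0 _ hdQ) rfl
  have hND : Units.mk0 _ hnQ * (Units.mk0 _ hdQ)⁻¹ ∈ H := mul_mem hN (inv_mem hD)
  rcases Int.natAbs_eq (u : ℚ).num with h | h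
  · have : u = Units.mk0 _ hnQ * (Units.mk0 _ hdQ)⁻¹ := Units.ext (by
      push_cast [Units.val_mk0]
      rw [← div_eq_mul_inv]
      nth_rw 1 [← Rat.num_div_den (u : ℚ), h]
      simp)
    rw [this]; exact hND
  · have : u = -1 * (Units.mk0 _ hnQ * (Units.mk0 _ hdQ)⁻¹) := Units.ext (by
      push_cast [Units.val_mk0]
      rw [← div_eq_mul_inv]
      nth_rw 1 [← Rat.num_div_den (u : ℚ), h]
      simp [neg_div])
    rw [this]; exact mul_mem h1 hND

section FiniteField

variable {p : ℕ} [hp : Fact p.Prime]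

/-- For odd `p` there are two non-squares modulo `p` with sum `1`. -/
lemma exists_nonsquares_add_eq_one (hp2 : p ≠ 2) :
    ∃ x z : (ZMod p)ˣ, (x : ZMod p) + z = 1 ∧ ¬ IsSquare x ∧ ¬ IsSquare z := by
  classical
  have hunit : ∀ u : (ZMod p)ˣ, IsSquare (u : ZMod p) → IsSquare u := by
    rintro u ⟨r, hr⟩
    have hr0 : r ≠ 0 := by rintro rfl; exact u.ne_zero (by simp at hr)
    exact ⟨Units.mk0 r hr0, Units.ext hr⟩
  have hex : ∃ n : ℕ, ¬ IsSquare (n : ZMod p) := by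
    obtain ⟨a, ha⟩ := FiniteField.exists_nonsquare (F := ZMod p) (by rwa [ZMod.ringChar_zmod_n])
    exact ⟨a.val, by rwa [ZMod.natCast_zmod_val]⟩
  have hn := Nat.find_spec hex
  have hmin := fun m => Nat.find_min hex (m := m)
  set n := Nat.find hex
  have hn0 : n ≠ 0 := fun h => hn ⟨0, by simp [h]⟩
  have hn1 : n ≠ 1 := fun h => hn ⟨1, by simp [h]⟩
  obtain ⟨m, hm⟩ : ∃ m, n = m + 1 := Nat.exists_eq_succ_of_ne_zero hn0
  have hms : IsSquare (m : ZMod p) := not_not.mp (hmin m (by omega))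
  have hnp : n < p := by
    by_contra h
    have h1 := hmin (n - p) (by have := hp.out.pos; omega)
    rw [not_not, Nat.cast_sub (not_lt.mp h), ZMod.natCast_self, sub_zero] at h1
    exact hn h1
  have hnz : (n : ZMod p) ≠ 0 := by
    rw [Ne, ZMod.natCast_eq_zero_iff]
    exact fun h => absurd (Nat.le_of_dvd (by omega) h) (by omega)
  have hmz : (m : ZMod p) ≠ 0 := by
    rw [Ne, ZMod.natCast_eq_zero_iff]
    exact fun h => absurd (Nat.le_of_dvd (by omega) h) (by omega)
  have hnu : ¬ IsSquare (Units.mk0 (n : ZMod p) hnz) := fun h => hn (h.map (Units.coeHom _))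
  refine ⟨(Units.mk0 _ hnz)⁻¹, Units.mk0 _ hmz * (Units.mk0 _ hnz)⁻¹, ?_, ?_, ?_⟩
  · rw [Units.val_mul, Units.val_inv_eq_inv_val, Units.val_mk0, Units.val_mk0]
    field_simp
    rw [hm]; push_cast; ring
  · rwa [isSquare_inv]
  · intro h
    have h2 := (hunit _ (by rwa [Units.val_mk0]) : IsSquare (Units.mk0 _ hmz))
    exact hnu (isSquare_inv.mp (by simpa using h2.inv.mul h))

/-- The product of two non-squares modulo a prime is a square. -/
lemma isSquare_mul_inv_of_nonsquare {x z : (ZMod p)ˣ} (hx : ¬ IsSquare x) (hz : ¬ IsSquare z) :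
    IsSquare (x * z⁻¹) := by
  obtain ⟨ζ, hζ⟩ := IsCyclic.exists_generator (α := (ZMod p)ˣ)
  obtain ⟨i, rfl⟩ := Subgroup.mem_zpowers_iff.mp (hζ x)
  obtain ⟨j, rfl⟩ := Subgroup.mem_zpowers_iff.mp (hζ z)
  have hi : Odd i := Int.not_even_iff_odd.mp fun ⟨k, hk⟩ => hx ⟨ζ ^ k, by rw [hk, zpow_add]⟩
  have hj : Odd j := Int.not_even_iff_odd.mp fun ⟨k, hk⟩ => hz ⟨ζ ^ k, by rw [hk, zpow_add]⟩
  obtain ⟨k, hk⟩ := hi.sub_odd hj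
  exact ⟨ζ ^ k, by rw [← zpow_sub, hk, zpow_add]⟩

/-- A function on `(ZMod p)ˣ` satisfying the relations coming from a Steinberg cocycle is a
homomorphism. -/
theorem map_mul_of_symbol_relations (hp2 : p ≠ 2) {M : Type*} [AddCommGroup M]
    {F : (ZMod p)ˣ → M} (h1 : F 1 = 0)
    (hR1 : ∀ x y, F (x * y) - F y = F (-(x * (x * y))) - F (-(x * y)))
    (hR2 : ∀ x z y : (ZMod p)ˣ, (x : ZMod p) + z = 1 →
      F (x * (z * y)) - F (z * y) = F (x * y) - F y) (x y : (ZMod p)ˣ) :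
    F (x * y) = F x + F y := by
  have hA : ∀ x y, F (x * (x * x * y)) - F (x * x * y) = F (x * y) - F y := by
    intro x y
    rw [hR1 x y, ← mul_neg x (x * y), hR1 x (-(x * y))]
    simp only [mul_neg, neg_neg, mul_assoc]
  obtain ⟨ζ, hζ⟩ := IsCyclic.exists_generator (α := (ZMod p)ˣ)
  have hpow : ∀ t, ∃ n : ℕ, ζ ^ n = t := fun t =>
    mem_powers_iff_mem_zpowers.mpr (hζ t)
  have hB : ∀ x y, F (x * (ζ * ζ * y)) - F (ζ * ζ * y) = F (x * y) - F y := by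
    intro x
    obtain ⟨n, rfl⟩ := hpow x
    induction n with
    | zero => intro y; simp
    | succ n ih =>
      intro y
      have e1 : ζ ^ n * (ζ * ζ * y) = ζ * ζ * (ζ ^ n * y) := mul_left_comm _ _ _
      rw [pow_succ', mul_assoc ζ (ζ ^ n), mul_assoc ζ (ζ ^ n), e1,
        ← sub_add_sub_cancel _ (F (ζ * ζ * (ζ ^ n * y))), hA ζ, ← e1, ih, sub_add_sub_cancel]
  have hC : ∀ t x y, F (x * (t * t * y)) - F (t * t * y) = F (x * y) - F y := by
    intro t x
    obtain ⟨n, rfl⟩ := hpow t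
    induction n with
    | zero => intro y; simp
    | succ n ih =>
      intro y
      rw [pow_succ', mul_mul_mul_comm ζ, mul_assoc (ζ * ζ), hB, ih]
  obtain ⟨a, b, hab, ha, hb⟩ := exists_nonsquares_add_eq_one hp2
  let H : Submonoid (ZMod p)ˣ :=
    { carrier := {x | ∀ y, F (x * y) = F x + F y}
      one_mem' := by intro y; rw [one_mul, h1, zero_add]
      mul_mem' := by
        intro x x' hx hx' y
        rw [mul_assoc, hx, hx', hx, add_assoc] }
  have hsq : ∀ t, t * t ∈ H := by
    intro t y
    have := hC t y 1
    rw [mul_one, mul_one, h1, sub_zero] at this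
    rw [mul_comm, ← this]; abel
  have haH : a ∈ H := by
    intro y
    have key : F (a * y) - F y = F a := by
      by_cases hy : IsSquare y
      · obtain ⟨t, rfl⟩ := hy
        have := hC t a 1
        rwa [mul_one, mul_one, h1, sub_zero] at this
      · obtain ⟨t, ht⟩ := isSquare_mul_inv_of_nonsquare hy hb
        have hyt : y = t * t * b := by rw [← ht, inv_mul_cancel_right]
        have h2 := hR2 a b 1 hab
        rw [mul_one, mul_one, h1, sub_zero] at h2
        rw [hyt, hC, h2]
    rw [← key]; abel
  have hx : x ∈ H := by
    by_cases hx : IsSquare x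
    · obtain ⟨t, rfl⟩ := hx
      exact hsq t
    · obtain ⟨t, ht⟩ := isSquare_mul_inv_of_nonsquare hx ha
      rw [← inv_mul_cancel_right x a, ht]
      exact mul_mem (hsq t) haH
  exact hx y

end FiniteField

/-- The formal properties of the symbols of a central extension of `SL₂(ℚ)`. -/
structure IsSymbol {M : Type*} [AddCommGroup M] (s : ℚˣ → ℚˣ → M) : Prop where
  one_left : ∀ v, s 1 v = 0
  cocycle : ∀ a b d, s a b + s (a * b) d = s b d + s a (b * d)
  right_neg_mul : ∀ x y, s x (-(x * y)) = s x y
  swap_inv : ∀ x y, s y⁻¹ x = s x y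
  steinberg : ∀ x z y : ℚˣ, (z : ℚ) = 1 - x → s x (z * y) = s x y

lemma CentralExt.isSymbol_c {K E : Type*} [AddCommGroup K] [Group E] (X : CentralExt K E)
    {M : Type*} [AddCommGroup M] (φ : K →+ M) : IsSymbol fun u v => φ (X.c u v) where
  one_left v := by simp
  cocycle a b d := by rw [← map_add, ← map_add, X.c_cocycle]
  right_neg_mul x y := by rw [X.c_right_neg_mul]
  swap_inv x y := by rw [X.c_swap_inv]
  steinberg x z y hz := by rw [X.c_steinberg_right hz]

lemma primeUnit_mem_smooth (p : ℕ) [hp : Fact p.Prime] : primeUnit p ∈ smooth (p + 1) := by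
  intro q hq hn
  have := Fact.mk hq
  exact padicValRat_primeUnit_of_ne (by omega)

lemma mul_zpow_mem_smooth {p : ℕ} [hp : Fact p.Prime] {u : ℚˣ} (hu : u ∈ smooth (p + 1)) :
    u * primeUnit p ^ (-padicValRat p u) ∈ smooth p := by
  intro q hq hn
  rcases hn.eq_or_lt with rfl | h
  · rw [padicValRat_mul_zpow, add_neg_cancel]
  · exact mul_mem hu (zpow_mem (primeUnit_mem_smooth p) _) q hq h

lemma neg_one_mem_smooth (n : ℕ) : -1 ∈ smooth n := by
  intro q _ _
  simp

lemma neg_mem_smooth {n : ℕ} {u : ℚˣ} (hu : u ∈ smooth n) : -u ∈ smooth n := by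
  rw [← neg_one_mul]
  exact mul_mem (neg_one_mem_smooth n) hu

/-- A natural number prime to `p`, as a unit of `ℚ`. -/
def liftUnit {p : ℕ} [hp : Fact p.Prime] (r : (ZMod p)ˣ) : ℚˣ :=
  Units.mk0 ((r : ZMod p).val : ℚ) (by
    rw [Nat.cast_ne_zero, Ne, ZMod.val_eq_zero]
    exact r.ne_zero)

section Lift

variable {p : ℕ} [hp : Fact p.Prime]

lemma val_liftUnit (r : (ZMod p)ˣ) : (liftUnit r : ℚ) = ((r : ZMod p).val : ℤ) := by
  simp [liftUnit]

lemma val_val_pos (r : (ZMod p)ˣ) : 0 < (r : ZMod p).val :=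
  Nat.pos_of_ne_zero (by rw [Ne, ZMod.val_eq_zero]; exact r.ne_zero)

lemma liftUnit_mem_smooth (r : (ZMod p)ˣ) : liftUnit r ∈ smooth p :=
  mem_smooth_of_int (val_liftUnit r) (by
    rw [Int.natAbs_natCast]; exact ZMod.val_lt _)

lemma res_liftUnit (r : (ZMod p)ˣ) : res p (liftUnit r) = r := by
  apply Units.ext
  rw [val_res_of_int (val_liftUnit r)] <;> simp

lemma liftUnit_one : liftUnit (1 : (ZMod p)ˣ) = 1 := by
  have := Fact.mk hp.out.one_lt
  apply Units.ext
  rw [val_liftUnit, Units.val_one, ZMod.val_one]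
  simp

end Lift

namespace IsSymbol

variable {M : Type*} [AddCommGroup M] {s : ℚˣ → ℚˣ → M} (hs : IsSymbol s)

include hs

variable {p : ℕ} [hp : Fact p.Prime] (h0 : ∀ u ∈ smooth p, ∀ v ∈ smooth p, s u v = 0)

include h0

lemma apply_mul_primeUnit {a b : ℚˣ} (ha : a ∈ smooth p) (hb : b ∈ smooth p) :
    s a (b * primeUnit p) = s (a * b) (primeUnit p) - s b (primeUnit p) := by
  rw [eq_sub_iff_add_eq, add_comm, ← hs.cocycle, h0 a ha b hb, zero_add]

lemma apply_mul_of_one_sub {x k : ℚˣ} (hx : x ∈ smooth p) (hk : k ∈ smooth p)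
    (h : (x : ℚ) = 1 - k * p) {y : ℚˣ} (hy : y ∈ smooth p) :
    s (x * y) (primeUnit p) = s y (primeUnit p) := by
  have h1 := hs.steinberg x (k * primeUnit p) (k⁻¹ * y) (by
    rw [Units.val_mul, val_primeUnit, h]; ring)
  have e : k * primeUnit p * (k⁻¹ * y) = y * primeUnit p := by
    rw [mul_mul_mul_comm, mul_inv_cancel, one_mul, mul_comm]
  rw [h0 x hx _ (mul_mem (inv_mem hk) hy), e, hs.apply_mul_primeUnit h0 hx hy, sub_eq_zero] at h1
  exact h1

/-- The value `s a p` depends only on the residue of `a` modulo `p`, for `a ∈ smooth p`. -/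
lemma apply_mul_of_res_eq_one {a : ℚˣ} (ha : a ∈ smooth p) (hr : res p a = 1)
    {y : ℚˣ} (hy : y ∈ smooth p) : s (a * y) (primeUnit p) = s y (primeUnit p) := by
  let U : Subgroup ℚˣ :=
    { carrier := {x | x ∈ smooth p ∧ res p x = 1 ∧
        ∀ y ∈ smooth p, s (x * y) (primeUnit p) = s y (primeUnit p)}
      one_mem' := ⟨one_mem _, map_one _, fun y _ => by rw [one_mul]⟩
      mul_mem' := by
        rintro a b ⟨ha, ha1, ha'⟩ ⟨hb, hb1, hb'⟩
        exact ⟨mul_mem ha hb, by rw [map_mul, ha1, hb1, one_mul], fun y hy => by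
          rw [mul_assoc, ha' _ (mul_mem hb hy), hb' _ hy]⟩
      inv_mem' := by
        rintro a ⟨ha, ha1, ha'⟩
        exact ⟨inv_mem ha, by rw [map_inv, ha1, inv_one], fun y hy => by
          rw [← ha' _ (mul_mem (inv_mem ha) hy), mul_inv_cancel_left]⟩ }
  have hU : ∀ x k : ℚˣ, x ∈ smooth p → k ∈ smooth p → (x : ℚ) = 1 - k * p → x ∈ U :=
    fun x k hx hk h => ⟨hx, by
      apply Units.ext
      have hkp := hk p hp.out le_rfl
      have hkp' : 0 < padicValRat p (k * p : ℚ) := by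
        rw [← val_primeUnit p, padicValRat.mul k.ne_zero (primeUnit p).ne_zero, hkp,
          padicValRat_primeUnit]
        norm_num
      rw [val_res_of_val_eq_zero (hx p hp.out le_rfl), h, sub_eq_add_neg,
        ratCast_add p (by simp) (by rw [padicValRat.neg]; exact hkp'.le),
        ratCast_eq_zero p (x := -(k * p : ℚ)) (by rwa [padicValRat.neg])]
      simp, fun y hy => hs.apply_mul_of_one_sub h0 hx hk h hy⟩
  have hmul : ∀ r t : (ZMod p)ˣ, liftUnit r * liftUnit t * (liftUnit (r * t))⁻¹ ∈ U := by
    intro r t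
    rw [← inv_inv (liftUnit r * _ * _)]
    apply inv_mem
    have hmod : (r * t : ZMod p).val = (r : ZMod p).val * (t : ZMod p).val % p := ZMod.val_mul _ _
    have hdm := Nat.div_add_mod ((r : ZMod p).val * (t : ZMod p).val) p
    rw [← hmod] at hdm
    set q := (r : ZMod p).val * (t : ZMod p).val / p with hq
    have hdmQ : (p : ℚ) * q + (r * t : ZMod p).val = (r : ZMod p).val * (t : ZMod p).val := by
      exact_mod_cast hdm
    have v1 : (liftUnit r : ℚ) = (r : ZMod p).val := rfl
    have v2 : (liftUnit t : ℚ) = (t : ZMod p).val := rfl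
    have v3 : (liftUnit (r * t) : ℚ) = (r * t : ZMod p).val := rfl
    rw [← v1, ← v2, ← v3] at hdmQ
    rcases Nat.eq_zero_or_pos q with h | h
    · have : liftUnit r * liftUnit t = liftUnit (r * t) := by
        apply Units.ext
        rw [Units.val_mul, ← hdmQ, h]
        simp
      rw [this, mul_inv_cancel, inv_one]
      exact one_mem _
    · have hqp : q < p := by
        rw [hq]
        exact Nat.div_lt_of_lt_mul (Nat.mul_lt_mul'' (ZMod.val_lt _) (ZMod.val_lt _))
      have hq0 : (q : ℚ) ≠ 0 := by exact_mod_cast h.ne'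
      refine hU _ (Units.mk0 (q : ℚ) hq0 * (liftUnit r * liftUnit t)⁻¹) ?_ ?_ ?_
      · exact inv_mem (mul_mem (mul_mem (liftUnit_mem_smooth _) (liftUnit_mem_smooth _))
          (inv_mem (liftUnit_mem_smooth _)))
      · exact mul_mem (mem_smooth_of_int (a := q) rfl (by simpa using hqp))
          (inv_mem (mul_mem (liftUnit_mem_smooth _) (liftUnit_mem_smooth _)))
      · have := (liftUnit r).ne_zero
        have := (liftUnit t).ne_zero
        have := (liftUnit (r * t)).ne_zero
        push_cast [Units.val_mk0]
        field_simp
        linear_combination hdmQ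
  let good : Subgroup ℚˣ :=
    { carrier := {a | ∃ r : (ZMod p)ˣ, a * (liftUnit r)⁻¹ ∈ U}
      one_mem' := ⟨1, by rw [liftUnit_one, inv_one, mul_one]; exact one_mem _⟩
      mul_mem' := by
        rintro a b ⟨r, hr⟩ ⟨t, ht⟩
        refine ⟨r * t, ?_⟩
        have := mul_mem (mul_mem hr ht) (hmul r t)
        rwa [show a * (liftUnit r)⁻¹ * (b * (liftUnit t)⁻¹) *
          (liftUnit r * liftUnit t * (liftUnit (r * t))⁻¹) = a * b * (liftUnit (r * t))⁻¹ by
            rw [mul_mul_mul_comm a, ← mul_inv, ← mul_assoc, inv_mul_cancel_right]] at this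
      inv_mem' := by
        rintro a ⟨r, hr⟩
        refine ⟨r⁻¹, ?_⟩
        have := mul_mem (inv_mem hr) (inv_mem (hmul r r⁻¹))
        rwa [mul_inv_cancel, liftUnit_one, inv_one, mul_one, ← mul_inv, ← mul_assoc,
          inv_mul_cancel_right, mul_inv] at this }
  have hp1 := hp.out.two_le
  have hgood : smooth p ≤ good := by
    apply smooth_le
    · refine ⟨-1, ?_⟩
      have hc : ((-1 : (ZMod p)ˣ) : ZMod p) = ((p - 1 : ℕ) : ZMod p) := by
        rw [Nat.cast_sub (by omega), ZMod.natCast_self]; simp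
      have hv : (liftUnit (-1 : (ZMod p)ˣ) : ℚ) = p - 1 := by
        rw [val_liftUnit, hc, ZMod.val_natCast_of_lt (by omega), Nat.cast_sub (by omega)]
        simp
      rw [← inv_inv (-1 * _)]
      apply inv_mem
      refine hU _ 1 (inv_mem (mul_mem (neg_one_mem_smooth _) (inv_mem (liftUnit_mem_smooth _))))
        (one_mem _) ?_
      push_cast
      rw [hv]; simp
    · intro q hq hqp u hu
      have hqz : (q : ZMod p) ≠ 0 := by
        have := int_cast_ne_zero_of_natAbs_lt (p := p) (a := q) (by exact_mod_cast hq.ne_zero)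
          (by simpa using hqp)
        simpa using this
      refine ⟨Units.mk0 _ hqz, ?_⟩
      have : u = liftUnit (Units.mk0 (q : ZMod p) hqz) := by
        apply Units.ext
        rw [hu, val_liftUnit, Units.val_mk0, ZMod.val_natCast_of_lt hqp]
        simp
      rw [this, mul_inv_cancel]
      exact one_mem _
  obtain ⟨r, hr'⟩ := hgood ha
  have : r = 1 := by
    have := hr'.2.1
    rwa [map_mul, hr, map_inv, res_liftUnit, one_mul, inv_eq_one] at this
  rw [this, liftUnit_one, inv_one, mul_one] at hr'
  exact hr'.2.2 y hy

/-- `s a p` as a function of a residue modulo `p`. -/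
lemma apply_liftUnit_res {a : ℚˣ} (ha : a ∈ smooth p) :
    s (liftUnit (res p a)) (primeUnit p) = s a (primeUnit p) := by
  rw [← hs.apply_mul_of_res_eq_one h0 (a := a * (liftUnit (res p a))⁻¹)
    (mul_mem ha (inv_mem (liftUnit_mem_smooth _)))
    (by rw [map_mul, map_inv, res_liftUnit, mul_inv_cancel]) (liftUnit_mem_smooth _),
    inv_mul_cancel_right]

lemma apply_liftUnit_mul (hp2 : p ≠ 2) (x y : (ZMod p)ˣ) :
    s (liftUnit (x * y)) (primeUnit p) =
      s (liftUnit x) (primeUnit p) + s (liftUnit y) (primeUnit p) := by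
  have hF : ∀ {a : ℚˣ}, a ∈ smooth p → ∀ {r : (ZMod p)ˣ}, res p a = r →
      s (liftUnit r) (primeUnit p) = s a (primeUnit p) := by
    rintro a ha _ rfl
    exact hs.apply_liftUnit_res h0 ha
  refine map_mul_of_symbol_relations (F := fun r => s (liftUnit r) (primeUnit p)) hp2 ?_ ?_ ?_ x y
  · simp only [liftUnit_one, hs.one_left]
  · intro x y
    have hx := liftUnit_mem_smooth x
    have hy := liftUnit_mem_smooth y
    have h := hs.right_neg_mul (liftUnit x) (liftUnit y * primeUnit p)
    rw [← mul_assoc, ← neg_mul, hs.apply_mul_primeUnit h0 hx hy,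
      hs.apply_mul_primeUnit h0 hx (neg_mem_smooth (mul_mem hx hy))] at h
    rw [hF (mul_mem hx hy) (r := x * y) (by simp only [map_mul, res_liftUnit]),
      hF (neg_mem_smooth (mul_mem hx hy)) (r := -(x * y)) (by simp only [res_neg, map_mul, res_liftUnit]),
      hF (mul_mem hx (neg_mem_smooth (mul_mem hx hy))) (r := -(x * (x * y)))
        (by simp only [res_neg, map_mul, res_liftUnit, mul_neg]), h]
  · intro x z y hxz
    have hx := liftUnit_mem_smooth x
    have hy := liftUnit_mem_smooth y
    have hxv : (liftUnit x : ℚ) = (x : ZMod p).val := rfl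
    have hlt := ZMod.val_lt (x : ZMod p)
    have hcast : (((1 - (x : ZMod p).val : ℤ)) : ZMod p) = z := by
      push_cast
      rw [ZMod.natCast_zmod_val, ← hxz, add_sub_cancel_left]
    have hne : ((1 - (x : ZMod p).val : ℤ) : ℚ) ≠ 0 := by
      intro h
      rw [Int.cast_eq_zero.mp h, Int.cast_zero] at hcast
      exact z.ne_zero hcast.symm
    have hz : Units.mk0 _ hne ∈ smooth p := mem_smooth_of_int rfl (by
      have := val_val_pos x
      omega)
    have hzr : res p (Units.mk0 _ hne) = z := by
      apply Units.ext
      rw [val_res_of_int rfl] <;> rw [hcast]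
      exact z.ne_zero
    have h := hs.steinberg (liftUnit x) (Units.mk0 _ hne) (liftUnit y * primeUnit p)
      (by rw [Units.val_mk0, hxv]; push_cast; ring)
    rw [← mul_assoc, hs.apply_mul_primeUnit h0 hx hy,
      hs.apply_mul_primeUnit h0 hx (mul_mem hz hy)] at h
    rw [hF (mul_mem hx (mul_mem hz hy)) (r := x * (z * y)) (by simp only [map_mul, res_liftUnit, hzr]),
      hF (mul_mem hz hy) (r := z * y) (by simp only [map_mul, res_liftUnit, hzr]),
      hF (mul_mem hx hy) (r := x * y) (by simp only [map_mul, res_liftUnit]), h]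

/-- If all symbols of elements of `smooth p` vanish, then the symbols of elements of
`smooth (p + 1)` are of the form `s p a` with `0 < a < p`, and these form a subgroup. -/
lemma exists_eq_of_mem_closure (hp2 : p ≠ 2) {z : M} (hz : z ∈ AddSubgroup.closure
    {k | ∃ u ∈ smooth (p + 1), ∃ v ∈ smooth (p + 1), k = s u v}) :
    ∃ r : (ZMod p)ˣ, z = s (primeUnit p) (liftUnit r) := by
  let R : AddSubgroup M :=
    { carrier := {z | ∃ r : (ZMod p)ˣ, z = s (liftUnit r) (primeUnit p)}
      zero_mem' := ⟨1, by rw [liftUnit_one, hs.one_left]⟩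
      add_mem' := by
        rintro _ _ ⟨r, rfl⟩ ⟨t, rfl⟩
        exact ⟨r * t, (hs.apply_liftUnit_mul h0 hp2 r t).symm⟩
      neg_mem' := by
        rintro _ ⟨r, rfl⟩
        refine ⟨r⁻¹, ?_⟩
        rw [neg_eq_iff_add_eq_zero, ← hs.apply_liftUnit_mul h0 hp2, mul_inv_cancel, liftUnit_one,
          hs.one_left] }
  have hRa : ∀ {a}, a ∈ smooth p → s a (primeUnit p) ∈ R := fun {a} ha =>
    ⟨res p a, (hs.apply_liftUnit_res h0 ha).symm⟩
  have hstep : ∀ y, s (primeUnit p) (primeUnit p * y) = s (primeUnit p) (-y) := by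
    intro y
    rw [← hs.right_neg_mul _ (-y), mul_neg, neg_neg]
  have hpow : ∀ (m : ℕ) {y}, y ∈ smooth p → s (primeUnit p) (primeUnit p ^ m * y) ∈ R ∧
      s (primeUnit p) ((primeUnit p ^ m)⁻¹ * y) ∈ R := by
    intro m
    induction m with
    | zero =>
      intro y hy
      simp only [pow_zero, inv_one, one_mul, and_self]
      rw [← hs.swap_inv]
      exact hRa (inv_mem hy)
    | succ m ih =>
      intro y hy
      constructor
      · rw [pow_succ', mul_assoc, hstep, ← mul_neg]
        exact (ih (neg_mem_smooth hy)).1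
      · have := hstep (-((primeUnit p ^ (m + 1))⁻¹ * y))
        rw [neg_neg] at this
        rw [← this, pow_succ', mul_inv, mul_neg, mul_assoc, mul_inv_cancel_left, ← mul_neg]
        exact (ih (neg_mem_smooth hy)).2
  have hprime : ∀ {v}, v ∈ smooth (p + 1) → s (primeUnit p) v ∈ R := by
    intro v hv
    have h1 := mul_zpow_mem_smooth hv
    have h2 : v = primeUnit p ^ (padicValRat p v) *
        (v * primeUnit p ^ (-padicValRat p v)) := by
      rw [zpow_neg, mul_comm v, mul_inv_cancel_left]
    rw [h2]
    rcases Int.eq_nat_or_neg (padicValRat p v) with ⟨n, hn | hn⟩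
    · rw [hn, zpow_natCast, ← hn]
      exact (hpow n h1).1
    · have : primeUnit p ^ padicValRat p v = (primeUnit p ^ n)⁻¹ := by
        rw [hn, zpow_neg, zpow_natCast]
      rw [this]
      exact (hpow n h1).2
  have hmulp : ∀ {b v}, b ∈ smooth (p + 1) → v ∈ smooth (p + 1) →
      (s (primeUnit p * b) v ∈ R ↔ s b v ∈ R) := by
    intro b v hb hv
    have h := hs.cocycle (primeUnit p) b v
    have h1 := hprime hb
    have h2 := hprime (mul_mem hb hv)
    rw [← R.add_mem_cancel_left h1, h, R.add_mem_cancel_right h2]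
  have hpowmul : ∀ (m : ℕ) {b v}, b ∈ smooth (p + 1) → v ∈ smooth (p + 1) →
      (s (primeUnit p ^ m * b) v ∈ R ↔ s b v ∈ R) := by
    intro m b v hb hv
    induction m with
    | zero => rw [pow_zero, one_mul]
    | succ m ih =>
      rw [pow_succ', mul_assoc, hmulp (mul_mem (pow_mem (primeUnit_mem_smooth p) _) hb) hv, ih]
  have hred : ∀ {u v}, u ∈ smooth (p + 1) → v ∈ smooth (p + 1) →
      (s u v ∈ R ↔ s (u * primeUnit p ^ (-padicValRat p u)) v ∈ R) := by
    intro u v hu hv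
    rcases Int.eq_nat_or_neg (padicValRat p u) with ⟨n, hn | hn⟩
    · rw [← hpowmul n (mul_mem hu (zpow_mem (primeUnit_mem_smooth p) _)) hv, hn, zpow_neg,
        zpow_natCast, mul_comm u, mul_inv_cancel_left]
    · rw [hn, neg_neg, zpow_natCast, mul_comm u, hpowmul n hu hv]
  have hall : ∀ {u v}, u ∈ smooth (p + 1) → v ∈ smooth (p + 1) → s u v ∈ R := by
    intro u v hu hv
    have h1 := smooth_mono (Nat.le_succ p) (mul_zpow_mem_smooth hu)
    rw [hred hu hv, ← inv_inv (u * _), hs.swap_inv, hred hv (inv_mem h1),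
      h0 _ (mul_zpow_mem_smooth hv) _ (inv_mem (mul_zpow_mem_smooth hu))]
    exact zero_mem R
  have hzR : z ∈ R := by
    refine (AddSubgroup.closure_le R).mpr ?_ hz
    rintro _ ⟨u, hu, v, hv, rfl⟩
    exact hall hu hv
  obtain ⟨r, rfl⟩ := hzR
  refine ⟨r⁻¹, ?_⟩
  rw [← hs.swap_inv (primeUnit p), ← hs.apply_liftUnit_res h0
    (inv_mem (liftUnit_mem_smooth _)), map_inv, res_liftUnit, inv_inv]

end IsSymbol

namespace CentralExt

variable {K E : Type*} [AddCommGroup K] [Group E] (X : CentralExt K E)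

lemma filt_succ_of_not_prime {n : ℕ} (hn : ¬ n.Prime) : X.filt (n + 1) ≤ X.filt n := by
  have h : smooth (n + 1) ≤ smooth n := by
    intro u hu q hq hnq
    exact hu q hq (Nat.succ_le_of_lt (lt_of_le_of_ne hnq (by rintro rfl; exact hn hq)))
  rw [filt, AddSubgroup.closure_le]
  rintro _ ⟨u, hu, v, hv, rfl⟩
  exact X.c_mem_filt_of_smooth (h hu) (h hv)

/-- An element of `filt (p + 1)` is a symbol `c p a` with `0 < a < p`, up to `filt p`. -/
lemma exists_sub_mem_filt {p : ℕ} [hp : Fact p.Prime] (hp2 : p ≠ 2) {z : K}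
    (hz : z ∈ X.filt (p + 1)) :
    ∃ r : (ZMod p)ˣ, z - X.c (primeUnit p) (liftUnit r) ∈ X.filt p := by
  let φ := QuotientAddGroup.mk' (X.filt p)
  have h0 : ∀ u ∈ smooth p, ∀ v ∈ smooth p, φ (X.c u v) = 0 := fun u hu v hv =>
    (QuotientAddGroup.eq_zero_iff _).mpr (X.c_mem_filt_of_smooth hu hv)
  obtain ⟨r, hr⟩ := (X.isSymbol_c φ).exists_eq_of_mem_closure h0 hp2 (z := φ z) (by
    have := AddSubgroup.mem_map_of_mem φ hz
    change φ z ∈ AddSubgroup.map φ (AddSubgroup.closure _) at this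
    rw [AddMonoidHom.map_closure] at this
    refine AddSubgroup.closure_mono ?_ this
    rintro _ ⟨_, ⟨u, hu, v, hv, rfl⟩, rfl⟩
    exact ⟨u, hu, v, hv, rfl⟩)
  refine ⟨r, (QuotientAddGroup.eq_zero_iff _).mp ?_⟩
  exact (map_sub φ _ _).trans (sub_eq_zero.mpr hr)

end CentralExt

/-- A Steinberg symbol on `ℚ`: a bimultiplicative map with `b x (1 - x) = 0` and
`b x (-x) = 0`. -/
structure IsBilinearSymbol {M : Type*} [AddCommGroup M] (b : ℚˣ → ℚˣ → M) : Prop where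
  mul_left : ∀ x y z, b (x * y) z = b x z + b y z
  mul_right : ∀ x y z, b x (y * z) = b x y + b x z
  apply_neg_self : ∀ x, b x (-x) = 0
  steinberg : ∀ x z : ℚˣ, (x : ℚ) + z = 1 → b x z = 0

namespace IsBilinearSymbol

variable {M : Type*} [AddCommGroup M] {b : ℚˣ → ℚˣ → M} (hb : IsBilinearSymbol b)

include hb

lemma one_left (x : ℚˣ) : b 1 x = 0 := by
  have := hb.mul_left 1 1 x
  rwa [one_mul, left_eq_add] at this

lemma one_right (x : ℚˣ) : b x 1 = 0 := by
  have := hb.mul_right x 1 1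
  rwa [one_mul, left_eq_add] at this

lemma inv_left (x z : ℚˣ) : b x⁻¹ z = -b x z := by
  rw [eq_neg_iff_add_eq_zero, ← hb.mul_left, inv_mul_cancel, hb.one_left]

lemma inv_right (x z : ℚˣ) : b x z⁻¹ = -b x z := by
  rw [eq_neg_iff_add_eq_zero, ← hb.mul_right, inv_mul_cancel, hb.one_right]

lemma div_left (x y z : ℚˣ) : b (x / y) z = b x z - b y z := by
  rw [div_eq_mul_inv, hb.mul_left, hb.inv_left, sub_eq_add_neg]

lemma div_right (x y z : ℚˣ) : b x (y / z) = b x y - b x z := by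
  rw [div_eq_mul_inv, hb.mul_right, hb.inv_right, sub_eq_add_neg]

lemma neg_right (x z : ℚˣ) : b x (-z) = b x (-1) + b x z := by
  rw [← neg_one_mul, hb.mul_right]

lemma apply_self (x : ℚˣ) : b x x = -b x (-1) := by
  rw [eq_neg_iff_add_eq_zero, add_comm, ← hb.neg_right, hb.apply_neg_self]

lemma skew (x y : ℚˣ) : b x y = -b y x := by
  have h := hb.apply_neg_self (x * y)
  rw [hb.neg_right, hb.mul_left, hb.mul_left x y (x * y), hb.mul_right, hb.mul_right,
    hb.apply_self x, hb.apply_self y] at h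
  rw [eq_neg_iff_add_eq_zero, ← h]
  abel

lemma neg_one_right (x : ℚˣ) : b x (-1) = b (-1) x := by
  have h1 := hb.mul_left (-1) (-1) x
  rw [neg_one_mul, neg_neg, hb.one_left] at h1
  rw [hb.skew, eq_comm, eq_neg_iff_add_eq_zero, ← h1]

lemma two_neg_one (x : ℚˣ) : b (-1) x + b (-1) x = 0 := by
  rw [← hb.mul_left, neg_one_mul, neg_neg, hb.one_left]

lemma apply_self' (x : ℚˣ) : b x x = b (-1) x := by
  rw [hb.apply_self, hb.neg_one_right, neg_eq_iff_add_eq_zero, hb.two_neg_one]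

end IsBilinearSymbol

/-- `d` is the determinant of `v` and `w` if they are independent, and the ratio `v / w` if they
are parallel. -/
def IsRel (v w : ℚ × ℚ) (d : ℚˣ) : Prop :=
  v.1 * w.2 - v.2 * w.1 = d ∨ (v.1 = d * w.1 ∧ v.2 = d * w.2)

section Rel

variable {v w u : ℚ × ℚ}

lemma exists_isRel (hv : v ≠ 0) (hw : w ≠ 0) : ∃ d, IsRel v w d := by
  by_cases h : v.1 * w.2 - v.2 * w.1 = 0
  · by_cases h1 : w.1 = 0
    · have h2 : w.2 ≠ 0 := fun h2 => hw (Prod.ext h1 h2)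
      have h3 : v.1 = 0 := by
        rw [h1, mul_zero, sub_zero] at h
        exact (mul_eq_zero.mp h).resolve_right h2
      have h4 : v.2 ≠ 0 := fun h4 => hv (Prod.ext h3 h4)
      refine ⟨Units.mk0 (v.2 / w.2) (div_ne_zero h4 h2), Or.inr ⟨by simp [h1, h3], ?_⟩⟩
      rw [Units.val_mk0, div_mul_cancel₀ _ h2]
    · have h3 : v.1 ≠ 0 := by
        intro h3
        rw [h3, zero_mul, zero_sub, neg_eq_zero] at h
        exact hv (Prod.ext h3 ((mul_eq_zero.mp h).resolve_right h1))
      refine ⟨Units.mk0 (v.1 / w.1) (div_ne_zero h3 h1), Or.inr ⟨?_, ?_⟩⟩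
      · rw [Units.val_mk0, div_mul_cancel₀ _ h1]
      · rw [Units.val_mk0]
        field_simp
        linear_combination -h
  · exact ⟨Units.mk0 _ h, Or.inl rfl⟩

lemma IsRel.unique (hw : w ≠ 0) {d e : ℚˣ} (hd : IsRel v w d) (he : IsRel v w e) : d = e := by
  apply Units.ext
  rcases hd with hd | ⟨h1, h2⟩ <;> rcases he with he | ⟨h3, h4⟩
  · rw [← hd, he]
  · exact absurd (by rw [← hd, h3, h4]; ring) d.ne_zero
  · exact absurd (by rw [← he, h1, h2]; ring) e.ne_zero
  · by_cases h : w.1 = 0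
    · have h5 : w.2 ≠ 0 := fun h2 => hw (Prod.ext h h2)
      exact mul_right_cancel₀ h5 (h2.symm.trans h4)
    · exact mul_right_cancel₀ h (h1.symm.trans h3)

/-- The choice of a `d` with `IsRel v w d`. -/
def rel (v w : ℚ × ℚ) : ℚˣ :=
  open Classical in if h : ∃ d, IsRel v w d then h.choose else 1

lemma isRel_rel (hv : v ≠ 0) (hw : w ≠ 0) : IsRel v w (rel v w) := by
  rw [rel, dif_pos (exists_isRel hv hw)]
  exact (exists_isRel hv hw).choose_spec

lemma rel_eq (hv : v ≠ 0) (hw : w ≠ 0) {d : ℚˣ} (hd : IsRel v w d) : rel v w = d :=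
  (isRel_rel hv hw).unique hw hd

lemma rel_of_par_left (hv : v ≠ 0) (hw : w ≠ 0) (hu : u ≠ 0)
    (h : v.1 = rel v w * w.1 ∧ v.2 = rel v w * w.2) : rel v u = rel v w * rel w u := by
  apply rel_eq hv hu
  rcases isRel_rel hw hu with h1 | ⟨h1, h2⟩
  · left; rw [h.1, h.2, Units.val_mul, ← h1]; ring
  · right; rw [Units.val_mul, mul_assoc, mul_assoc, ← h1, ← h2]; exact h

lemma rel_of_par_right (hv : v ≠ 0) (hw : w ≠ 0) (hu : u ≠ 0)
    (h : w.1 = rel w u * u.1 ∧ w.2 = rel w u * u.2)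
    (h' : v.1 * w.2 - v.2 * w.1 = rel v w) : rel v w = rel w u * rel v u := by
  apply rel_eq hv hw
  rcases isRel_rel hv hu with h1 | ⟨h1, h2⟩
  · left; rw [h.1, h.2, Units.val_mul, ← h1]; ring
  · exact absurd (by rw [← h', h1, h2, h.1, h.2]; ring) (rel v w).ne_zero

lemma rel_of_par_outer (hv : v ≠ 0) (hw : w ≠ 0)
    (h : v.1 = rel v u * u.1 ∧ v.2 = rel v u * u.2)
    (h' : w.1 * u.2 - w.2 * u.1 = rel w u) : rel v w = -1 * (rel v u * rel w u) := by
  apply rel_eq hv hw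
  left; rw [h.1, h.2, neg_one_mul, Units.val_neg, Units.val_mul, ← h']; ring

lemma rel_eq_rel {v w v' w' : ℚ × ℚ} (hv : v ≠ 0) (hw : w ≠ 0) (hv' : v' ≠ 0) (hw' : w' ≠ 0)
    (h : ∀ d, IsRel v w d → IsRel v' w' d) : rel v' w' = rel v w :=
  rel_eq hv' hw' (h _ (isRel_rel hv hw))

end Rel

section Kubota

variable {M : Type*} [AddCommGroup M] {b : ℚˣ → ℚˣ → M} (hb : IsBilinearSymbol b)

/-- The homogeneous form of Kubota's cocycle attached to a symbol. -/
def kubota (b : ℚˣ → ℚˣ → M) (v₀ v₁ v₂ : ℚ × ℚ) : M :=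
  b (rel v₀ v₂ / rel v₀ v₁) (rel v₀ v₂ / rel v₁ v₂)

include hb

lemma kubota_cocycle {v₀ v₁ v₂ v₃ : ℚ × ℚ} (h0 : v₀ ≠ 0) (h1 : v₁ ≠ 0) (h2 : v₂ ≠ 0)
    (h3 : v₃ ≠ 0) :
    kubota b v₁ v₂ v₃ + kubota b v₀ v₁ v₃ = kubota b v₀ v₂ v₃ + kubota b v₀ v₁ v₂ := by
  have hs := hb.skew
  have hm := hb.neg_one_right
  have hm2 := hb.two_neg_one
  have hss := hb.apply_self'
  unfold kubota
  rcases isRel_rel h0 h1 with d01 | p01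
  swap
  · rw [rel_of_par_left h0 h1 h2 p01, rel_of_par_left h0 h1 h3 p01]
    simp only [hb.div_left, hb.div_right, hb.mul_left, hb.mul_right]
    abel
  rcases isRel_rel h2 h3 with d23 | p23
  swap
  · rcases isRel_rel h1 h2 with d12 | p12
    · rcases isRel_rel h0 h2 with d02 | p02
      · rw [rel_of_par_right h1 h2 h3 p23 d12, rel_of_par_right h0 h2 h3 p23 d02]
        simp only [hb.div_left, hb.div_right, hb.mul_left, hb.mul_right]
        grind
      · rw [rel_of_par_outer h0 h1 p02 d12, rel_of_par_left h0 h2 h3 p02,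
          rel_of_par_right h1 h2 h3 p23 d12]
        simp only [hb.div_left, hb.div_right, hb.mul_left, hb.mul_right]
        grind
    · have e := rel_of_par_left h1 h2 h3 p12
      have p13 : v₁.1 = rel v₁ v₃ * v₃.1 ∧ v₁.2 = rel v₁ v₃ * v₃.2 := by
        rw [e, Units.val_mul, mul_assoc, mul_assoc, ← p23.1, ← p23.2]
        exact p12
      have d02 : v₀.1 * v₂.2 - v₀.2 * v₂.1 = rel v₀ v₂ := by
        rcases isRel_rel h0 h2 with d02 | p02
        · exact d02
        · exact absurd (by rw [← d01, p02.1, p02.2, p12.1, p12.2]; ring) (rel v₀ v₁).ne_zero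
      rw [rel_of_par_right h0 h1 h3 p13 d01, rel_of_par_right h0 h2 h3 p23 d02, e]
      simp only [hb.div_left, hb.div_right, hb.mul_left, hb.mul_right]
      grind
  rcases isRel_rel h1 h2 with d12 | p12
  swap
  · rw [rel_of_par_left h1 h2 h3 p12, rel_of_par_right h0 h1 h2 p12 d01]
    simp only [hb.div_left, hb.div_right, hb.mul_left, hb.mul_right]
    grind
  rcases isRel_rel h0 h2 with d02 | p02
  swap
  · rw [rel_of_par_left h0 h2 h3 p02, rel_of_par_outer h0 h1 p02 d12]
    simp only [hb.div_left, hb.div_right, hb.mul_left, hb.mul_right]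
    linear_combination (norm := module) hss (rel v₁ v₃) + hm2 (rel v₁ v₃) - hs (rel v₁ v₃) (rel v₂ v₃)
      + hss (rel v₂ v₃) - hss (rel v₁ v₂) - hm2 (rel v₁ v₂)
  rcases isRel_rel h1 h3 with d13 | p13
  swap
  · rw [rel_of_par_right h0 h1 h3 p13 d01, rel_of_par_outer h1 h2 p13 d23]
    simp only [hb.div_left, hb.div_right, hb.mul_left, hb.mul_right]
    generalize rel v₀ v₂ = b', rel v₀ v₃ = c, rel v₁ v₃ = e, rel v₂ v₃ = f
    linear_combination (norm := module) hss f + hm2 f - hs e f + hs b' c - hs c e + hs b' e - hm e - hm2 e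
      - hss c - hm c - hm2 c - hss b' + hm b'
  rcases isRel_rel h0 h3 with d03 | p03
  swap
  · rw [rel_of_par_outer h0 h1 p03 d13, rel_of_par_outer h0 h2 p03 d23]
    simp only [hb.div_left, hb.div_right, hb.mul_left, hb.mul_right]
    generalize rel v₀ v₃ = c, rel v₁ v₂ = d, rel v₁ v₃ = e, rel v₂ v₃ = f
    linear_combination (norm := module) (2 : ℤ) • hss e + hm e + (2 : ℤ) • hm2 e - (2 : ℤ) • hss f - hm f
      - (2 : ℤ) • hm2 f - hs d e + hs d f
  have hst := hb.steinberg (rel v₀ v₁ * rel v₂ v₃ / (rel v₀ v₂ * rel v₁ v₃))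
    (rel v₀ v₃ * rel v₁ v₂ / (rel v₀ v₂ * rel v₁ v₃)) (by
      have := (rel v₀ v₂).ne_zero
      have := (rel v₁ v₃).ne_zero
      push_cast
      field_simp
      rw [← d01, ← d23, ← d03, ← d12, ← d02, ← d13]
      ring)
  simp only [hb.div_left, hb.div_right, hb.mul_left, hb.mul_right] at hst ⊢
  generalize rel v₀ v₁ = a, rel v₀ v₂ = b', rel v₀ v₃ = c, rel v₁ v₂ = d, rel v₁ v₃ = e,
    rel v₂ v₃ = f at hst ⊢
  linear_combination (norm := module) hs c f + hs d f - hs e f - hs d e - hs c e + hs b' e - hs b' f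
    + (2 : ℤ) • hss e + hm2 e - hst

end Kubota

/-- The first column of a matrix. -/
def col (g : SL2Q) : ℚ × ℚ := (g 0 0, g 1 0)

lemma col_ne_zero (g : SL2Q) : col g ≠ 0 := by
  intro h
  have h1 : g 0 0 = 0 := congrArg Prod.fst h
  have h2 : g 1 0 = 0 := congrArg Prod.snd h
  have := SL2Q.det_eq g
  rw [h1, h2] at this
  norm_num at this

lemma rel_col_mul (g h k : SL2Q) :
    rel (col (g * h)) (col (g * k)) = rel (col h) (col k) := by
  refine rel_eq_rel (col_ne_zero _) (col_ne_zero _) (col_ne_zero _) (col_ne_zero _) ?_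
  intro d hd
  have hdet := SL2Q.det_eq g
  simp only [IsRel, col, SL2Q.mul_entry] at hd ⊢
  rcases hd with hd | ⟨h1, h2⟩
  · left
    rw [← hd]
    linear_combination (h 0 0 * k 1 0 - h 1 0 * k 0 0) * hdet
  · right
    rw [h1, h2]
    constructor <;> ring

lemma rel_col_eq {g h : SL2Q} {d : ℚˣ} (hd : IsRel (col g) (col h) d) : rel (col g) (col h) = d :=
  rel_eq (col_ne_zero _) (col_ne_zero _) hd

/-- Kubota's 2-cocycle on `SL₂(ℚ)` attached to a symbol. -/
def kubotaCocycle {M : Type*} [AddCommGroup M] (b : ℚˣ → ℚˣ → M) (g h : SL2Q) : M :=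
  kubota b (col 1) (col g) (col (g * h))

section KubotaCocycle

variable {M : Type*} [AddCommGroup M] {b : ℚˣ → ℚˣ → M} (hb : IsBilinearSymbol b)

include hb

lemma isCocycle_kubotaCocycle : IsCocycle (kubotaCocycle b) := by
  intro g h k
  have h1 := kubota_cocycle hb (col_ne_zero 1) (col_ne_zero g) (col_ne_zero (g * h))
    (col_ne_zero (g * h * k))
  have h2 : kubota b (col 1) (col h) (col (h * k)) =
      kubota b (col g) (col (g * h)) (col (g * h * k)) := by
    have e1 := rel_col_mul g h (h * k)
    have e2 := rel_col_mul g 1 h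
    have e3 := rel_col_mul g 1 (h * k)
    rw [mul_one] at e2 e3
    rw [kubota, kubota, mul_assoc g h k, e1, e2, e3]
  rw [kubotaCocycle, kubotaCocycle, kubotaCocycle, kubotaCocycle, h2, ← mul_assoc]
  linear_combination (norm := module) h1

lemma kubotaCocycle_u12_right (g : SL2Q) (t : ℚ) : kubotaCocycle b g (u12 t) = 0 := by
  have h : col (g * u12 t) = col g := by simp [col, SL2Q.mul_entry]
  rw [kubotaCocycle, kubota, h, div_self', hb.one_left]

lemma kubotaCocycle_u12_left (g : SL2Q) (t : ℚ) : kubotaCocycle b (u12 t) g = 0 := by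
  have h : col (u12 t) = col 1 := by simp [col]
  rw [kubotaCocycle, kubota, h, div_self', hb.one_right]

lemma kubotaCocycle_diag (u v : ℚˣ) : kubotaCocycle b (diag u) (diag v) = b v u := by
  have h1 : rel (col 1) (col (diag u)) = u⁻¹ := rel_col_eq (Or.inr (by simp [col]))
  have h2 : rel (col 1) (col (diag u * diag v)) = (u * v)⁻¹ := by
    rw [← diag_mul]
    exact rel_col_eq (Or.inr (by
      rw [Units.val_inv_eq_inv_val]
      exact ⟨by simp only [col, diag_00]; field_simp; rfl, by simp [col]⟩))
  have h3 : rel (col (diag u)) (col (diag u * diag v)) = v⁻¹ := by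
    have := rel_col_mul (diag u) 1 (diag v)
    rw [mul_one] at this
    rw [this]
    exact rel_col_eq (Or.inr (by simp [col]))
  rw [kubotaCocycle, kubota, h1, h2, h3, mul_inv, mul_div_cancel_left, mul_div_cancel_right,
    hb.inv_left, hb.inv_right, neg_neg]

lemma kubotaCocycle_wmat (u : ℚˣ) : kubotaCocycle b (wmat u) (wmat (-1)) = b (-1) u := by
  have h1 : rel (col 1) (col (wmat u)) = -u⁻¹ := rel_col_eq (Or.inl (by simp [col]))
  have h2 : rel (col 1) (col (wmat u * wmat (-1))) = u⁻¹ :=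
    rel_col_eq (Or.inr (by simp [col, SL2Q.mul_entry]))
  have h3 : rel (col (wmat u)) (col (wmat u * wmat (-1))) = 1 :=
    rel_col_eq (Or.inl (by simp [col, SL2Q.mul_entry]))
  rw [kubotaCocycle, kubota, h1, h2, h3, div_one, div_neg, div_self', hb.inv_right,
    neg_eq_iff_add_eq_zero, hb.two_neg_one]

lemma kubotaCocycle_wmat_u12 (u : ℚˣ) :
    kubotaCocycle b (wmat u * u12 (-u)) (wmat 1) = 0 := by
  have h1 : rel (col 1) (col (wmat u * u12 (-u))) = -u⁻¹ :=
    rel_col_eq (Or.inl (by simp [col, SL2Q.mul_entry]))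
  have h2 : rel (col 1) (col (wmat u * u12 (-u) * wmat 1)) = -1 :=
    rel_col_eq (Or.inl (by simp [col, SL2Q.mul_entry]))
  have h3 : rel (col (wmat u * u12 (-u))) (col (wmat u * u12 (-u) * wmat 1)) = -1 :=
    rel_col_eq (Or.inl (by simp [col, SL2Q.mul_entry]))
  rw [kubotaCocycle, kubota, h1, h2, h3, div_self', hb.one_right]

/-- The central extension of `SL₂(ℚ)` attached to a symbol. -/
abbrev kubotaExt : CentralExt M (CocExt _ (isCocycle_kubotaCocycle hb)) :=
  CocExt.centralExt (isCocycle_kubotaCocycle hb)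

lemma kubotaExt_mk_mul_u12 (g : SL2Q) (m : M) (t : ℚ) :
    (⟨m, g⟩ * ⟨0, u12 t⟩ : CocExt _ (isCocycle_kubotaCocycle hb)) = ⟨m, g * u12 t⟩ := by
  ext1
  · simp [kubotaCocycle_u12_right hb]
  · rfl

lemma kubotaExt_u12_mul_mk (g : SL2Q) (m : M) (t : ℚ) :
    (⟨0, u12 t⟩ * ⟨m, g⟩ : CocExt _ (isCocycle_kubotaCocycle hb)) = ⟨m, u12 t * g⟩ := by
  ext1
  · simp [kubotaCocycle_u12_left hb]
  · rfl

lemma kubotaExt_x (t : ℚ) : (kubotaExt hb).x t = ⟨0, u12 t⟩ := by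
  rw [(kubotaExt hb).x_eq (e := ⟨0, diag CentralExt.two⟩) (f := ⟨0, u12 (t / 3)⟩) rfl rfl,
    commutatorElement_def, mul_inv_eq_iff_eq_mul, mul_inv_eq_iff_eq_mul,
    kubotaExt_mk_mul_u12 hb, kubotaExt_u12_mul_mk hb, ← u12_add, kubotaExt_u12_mul_mk hb,
    diag_mul_u12]
  congr 3
  rw [CentralExt.two, Units.val_mk0]
  ring

lemma kubotaExt_w (u : ℚˣ) : (kubotaExt hb).w u = ⟨0, wmat u⟩ := by
  have hy := (kubotaExt hb).conj_wmat_x (e := ⟨0, wmat 1⟩) (u := 1) rfl ((u : ℚ)⁻¹)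
  have hw : (kubotaExt hb).w u * (kubotaExt hb).x (-u) =
      (kubotaExt hb).x u * (kubotaExt hb).y (-(u : ℚ)⁻¹) := by
    rw [CentralExt.w, (kubotaExt hb).x_neg, mul_inv_cancel_right]
  rw [Units.val_one, inv_one, one_pow, one_mul] at hy
  have h1 : (⟨0, u12 u⟩ * ⟨0, wmat 1⟩ * ⟨0, u12 (u : ℚ)⁻¹⟩ :
      CocExt _ (isCocycle_kubotaCocycle hb)) = ⟨0, u12 u * wmat 1 * u12 (u : ℚ)⁻¹⟩ := by
    rw [kubotaExt_u12_mul_mk hb, kubotaExt_mk_mul_u12 hb]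
  rw [← hy, ← mul_assoc, ← mul_assoc, eq_mul_inv_iff_mul_eq, kubotaExt_x, kubotaExt_x, kubotaExt_x,
    h1] at hw
  have h2 : (⟨0, wmat u⟩ * ⟨0, u12 (-u)⟩ * ⟨0, wmat 1⟩ :
      CocExt _ (isCocycle_kubotaCocycle hb)) = ⟨0, u12 u * wmat 1 * u12 (u : ℚ)⁻¹⟩ := by
    rw [kubotaExt_mk_mul_u12 hb]
    ext1
    · simp [kubotaCocycle_wmat_u12 hb]
    · apply SL2Q.ext_fin <;> simp [SL2Q.mul_entry]
  rw [← h2] at hw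
  exact mul_right_cancel (mul_right_cancel hw)

lemma kubotaExt_h (u : ℚˣ) : (kubotaExt hb).h u = ⟨b (-1) u, diag u⟩ := by
  rw [CentralExt.h, kubotaExt_w, kubotaExt_w]
  ext1
  · simp [kubotaCocycle_wmat hb]
  · rw [CocExt.mul_base, wmat_mul_wmat]
    simp

/-- The symbols of the central extension attached to `b` are the values of `b`. -/
lemma kubotaExt_c (u v : ℚˣ) : (kubotaExt hb).c u v = b v u := by
  have h := (kubotaExt hb).h_mul u v
  rw [kubotaExt_h, kubotaExt_h, kubotaExt_h] at h
  have h2 := congrArg CocExt.fib h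
  have h3 : (CocExt.incl ((kubotaExt hb).c u v) * ⟨b (-1) (u * v), diag (u * v)⟩ :
      CocExt _ (isCocycle_kubotaCocycle hb)).fib = (kubotaExt hb).c u v + b (-1) (u * v) := by
    rw [CocExt.mul_fib, CocExt.incl_fib, CocExt.incl_base,
      CocExt.cocycle_one_left (isCocycle_kubotaCocycle hb) (diag (u * v))]
    abel
  rw [CocExt.mul_fib, kubotaCocycle_diag hb, hb.mul_right] at h2
  rw [hb.mul_right] at h3
  rw [eq_comm, ← add_right_inj, h2]
  exact h3.trans (add_comm _ _)

end KubotaCocycle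

section Tame

variable (p : ℕ) [hp : Fact p.Prime]

/-- The tame symbol at `p`. -/
def tame (x y : ℚˣ) : Additive (ZMod p)ˣ :=
  (padicValRat p x * padicValRat p y) • Additive.ofMul (-1 : (ZMod p)ˣ) +
    padicValRat p y • Additive.ofMul (res p x) - padicValRat p x • Additive.ofMul (res p y)

variable {p}

lemma padicValRat_mul_units (x y : ℚˣ) :
    padicValRat p ((x * y : ℚˣ) : ℚ) = padicValRat p x + padicValRat p y := by
  rw [Units.val_mul, padicValRat.mul x.ne_zero y.ne_zero]

lemma padicValRat_div_units (x y : ℚˣ) :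
    padicValRat p ((x / y : ℚˣ) : ℚ) = padicValRat p x - padicValRat p y := by
  rw [eq_sub_iff_add_eq, ← padicValRat_mul_units, div_mul_cancel]

lemma two_smul_ofMul_neg_one : (2 : ℤ) • Additive.ofMul (-1 : (ZMod p)ˣ) = 0 := by
  rw [← ofMul_zpow, zpow_ofNat, neg_one_sq, ofMul_one]

lemma mul_self_sub_smul_ofMul_neg_one (k : ℤ) :
    (k * k - k) • Additive.ofMul (-1 : (ZMod p)ˣ) = 0 := by
  obtain ⟨j, hj⟩ := (Int.even_mul_succ_self (k - 1))
  have : k * k - k = j * 2 := by linear_combination hj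
  rw [this, mul_smul, two_smul_ofMul_neg_one, smul_zero]

lemma res_eq_one_of_add_eq_one {x z : ℚˣ} (h : (x : ℚ) + z = 1) (hx : 0 < padicValRat p x) :
    padicValRat p z = 0 ∧ res p z = 1 := by
  have hz : (z : ℚ) = 1 + -x := by rw [← h]; ring
  have h1 : padicValRat p z = 0 := by
    rw [hz, padicValRat.add_eq_of_lt (by rw [← hz]; exact z.ne_zero) one_ne_zero
      (neg_ne_zero.mpr x.ne_zero) (by rwa [padicValRat.one, padicValRat.neg]), padicValRat.one]
  refine ⟨h1, Units.ext ?_⟩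
  rw [val_res_of_val_eq_zero h1, Units.val_one]
  have h2 := ratCast_add p hx.le h1.ge
  rw [h, ratCast_eq_zero p hx, zero_add, Rat.cast_one] at h2
  exact h2.symm

variable (p) in
lemma isBilinearSymbol_tame : IsBilinearSymbol (tame p) := by
  have mul_left : ∀ x y z, tame p (x * y) z = tame p x z + tame p y z := by
    intro x y z
    rw [tame, tame, tame, padicValRat_mul_units, map_mul, ofMul_mul]
    module
  have mul_right : ∀ x y z, tame p x (y * z) = tame p x y + tame p x z := by
    intro x y z
    rw [tame, tame, tame, padicValRat_mul_units, map_mul, ofMul_mul]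
    module
  have apply_neg_self : ∀ x, tame p x (-x) = 0 := by
    intro x
    rw [tame, res_neg, ← neg_one_mul (res p x), ofMul_mul, Units.val_neg, padicValRat.neg]
    linear_combination (norm := module) mul_self_sub_smul_ofMul_neg_one (p := p) (padicValRat p x)
  have hpos : ∀ x z : ℚˣ, (x : ℚ) + z = 1 → 0 < padicValRat p x → tame p x z = 0 := by
    intro x z h hx
    obtain ⟨h1, h2⟩ := res_eq_one_of_add_eq_one h hx
    rw [tame, h1, h2]
    simp
  refine ⟨mul_left, mul_right, apply_neg_self, fun x z h => ?_⟩
  rcases lt_trichotomy (padicValRat p x) 0 with hx | hx | hx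
  · have h1 : (x⁻¹ : ℚˣ) + ((-(x⁻¹ * z) : ℚˣ) : ℚ) = 1 := by
      push_cast
      have := x.ne_zero
      field_simp
      linear_combination -h
    have hz : z = -x * -(x⁻¹ * z) := by simp
    have h3 := hpos _ _ h1 (by rw [Units.val_inv_eq_inv_val, padicValRat.inv]; omega)
    have h4 := mul_left x x⁻¹ (-(x⁻¹ * z))
    rw [h3, add_zero, mul_inv_cancel] at h4
    rw [hz, mul_right, apply_neg_self, zero_add, ← h4, tame]
    simp
  · rcases lt_trichotomy (padicValRat p z) 0 with hz | hz | hz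
    · exfalso
      have hx' : (x : ℚ) = 1 + -z := by rw [← h]; ring
      have := padicValRat.add_eq_of_lt (p := p) (q := -(z : ℚ)) (r := 1)
        (by rw [add_comm, ← hx']; exact x.ne_zero) (neg_ne_zero.mpr z.ne_zero) one_ne_zero
        (by rwa [padicValRat.one, padicValRat.neg])
      rw [add_comm, ← hx', padicValRat.neg] at this
      omega
    · rw [tame, hx, hz]; simp
    · obtain ⟨h1, h2⟩ := res_eq_one_of_add_eq_one (by rwa [add_comm]) hz
      rw [tame, h1, h2]
      simp
  · exact hpos x z h hx

lemma tame_primeUnit {u : ℚˣ} (hu : padicValRat p u = 0) :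
    tame p u (primeUnit p) = Additive.ofMul (res p u) := by
  rw [tame, hu, padicValRat_primeUnit]
  simp

lemma tame_eq_zero {u v : ℚˣ} (hu : padicValRat p u = 0) (hv : padicValRat p v = 0) :
    tame p u v = 0 := by
  rw [tame, hu, hv]
  simp

/-- `v` is a primitive vector over the localization of `ℤ` at `p`. -/
structure IsPrim (p : ℕ) [Fact p.Prime] (v : ℚ × ℚ) : Prop where
  fst_nonneg : 0 ≤ padicValRat p v.1
  snd_nonneg : 0 ≤ padicValRat p v.2
  ne_zero : ¬ ((v.1 : ZMod p) = 0 ∧ (v.2 : ZMod p) = 0)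

/-- The reductions modulo `p` of `v` and `w` are parallel with ratio `l`. -/
def ResPar (v w : ℚ × ℚ) (l : (ZMod p)ˣ) : Prop :=
  (v.1 : ZMod p) = l * (w.1 : ZMod p) ∧ (v.2 : ZMod p) = l * (w.2 : ZMod p)

variable {v w u : ℚ × ℚ}

lemma IsPrim.ne (hv : IsPrim p v) : v ≠ 0 := by
  rintro rfl
  exact hv.ne_zero (by simp)

lemma ResPar.unique (hw : IsPrim p w) {l m : (ZMod p)ˣ} (hl : ResPar v w l) (hm : ResPar v w m) :
    l = m := by
  apply Units.ext
  by_cases h : (w.1 : ZMod p) = 0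
  · have h2 : (w.2 : ZMod p) ≠ 0 := fun h2 => hw.ne_zero ⟨h, h2⟩
    exact mul_right_cancel₀ h2 (hl.2.symm.trans hm.2)
  · exact mul_right_cancel₀ h (hl.1.symm.trans hm.1)

lemma ResPar.mul {l m : (ZMod p)ˣ} (hl : ResPar v w l) (hm : ResPar w u m) :
    ResPar v u (l * m) := by
  constructor
  · rw [hl.1, hm.1, Units.val_mul, mul_assoc]
  · rw [hl.2, hm.2, Units.val_mul, mul_assoc]

lemma exists_resPar_of_det_eq_zero (hv : IsPrim p v) (hw : IsPrim p w)
    (h : (v.1 : ZMod p) * w.2 - v.2 * w.1 = 0) : ∃ l : (ZMod p)ˣ, ResPar v w l := by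
  by_cases h1 : (w.1 : ZMod p) = 0
  · have h2 : (w.2 : ZMod p) ≠ 0 := fun h2 => hw.ne_zero ⟨h1, h2⟩
    have h3 : (v.1 : ZMod p) = 0 := by
      rw [h1, mul_zero, sub_zero] at h
      exact (mul_eq_zero.mp h).resolve_right h2
    have h4 : (v.2 : ZMod p) ≠ 0 := fun h4 => hv.ne_zero ⟨h3, h4⟩
    refine ⟨Units.mk0 _ (div_ne_zero h4 h2), ?_, ?_⟩
    · rw [h1, h3, mul_zero]
    · rw [Units.val_mk0, div_mul_cancel₀ _ h2]
  · have h3 : (v.1 : ZMod p) ≠ 0 := by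
      intro h3
      rw [h3, zero_mul, zero_sub, neg_eq_zero] at h
      exact hv.ne_zero ⟨h3, (mul_eq_zero.mp h).resolve_right h1⟩
    refine ⟨Units.mk0 _ (div_ne_zero h3 h1), ?_, ?_⟩
    · rw [Units.val_mk0, div_mul_cancel₀ _ h1]
    · rw [Units.val_mk0]
      field_simp
      linear_combination -h

lemma padicValRat_add_nonneg {x y : ℚ} (hx : 0 ≤ padicValRat p x) (hy : 0 ≤ padicValRat p y) :
    0 ≤ padicValRat p (x + y) := by
  by_cases h : x + y = 0
  · rw [h, padicValRat.zero]
  · exact (le_min hx hy).trans (padicValRat.min_le_padicValRat_add h)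

lemma padicValRat_mul_nonneg {x y : ℚ} (hx : 0 ≤ padicValRat p x) (hy : 0 ≤ padicValRat p y) :
    0 ≤ padicValRat p (x * y) := by
  by_cases h : x = 0
  · rw [h, zero_mul, padicValRat.zero]
  by_cases h' : y = 0
  · rw [h', mul_zero, padicValRat.zero]
  rw [padicValRat.mul h h']
  exact add_nonneg hx hy

lemma IsPrim.det_nonneg (hv : IsPrim p v) (hw : IsPrim p w) :
    0 ≤ padicValRat p (v.1 * w.2 - v.2 * w.1) := by
  rw [sub_eq_add_neg]
  refine padicValRat_add_nonneg (padicValRat_mul_nonneg hv.1 hw.2) ?_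
  rw [padicValRat.neg]
  exact padicValRat_mul_nonneg hv.2 hw.1

lemma IsPrim.cast_det (hv : IsPrim p v) (hw : IsPrim p w) :
    ((v.1 * w.2 - v.2 * w.1 : ℚ) : ZMod p) = (v.1 : ZMod p) * w.2 - v.2 * w.1 := by
  rw [sub_eq_add_neg, ratCast_add p (padicValRat_mul_nonneg hv.1 hw.2), Rat.cast_neg,
    ratCast_mul p hv.1 hw.2, ratCast_mul p hv.2 hw.1, ← sub_eq_add_neg]
  rw [padicValRat.neg]
  exact padicValRat_mul_nonneg hv.2 hw.1

lemma IsPrim.nonneg_of_par (hv : IsPrim p v) (hw : IsPrim p w) {d : ℚˣ}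
    (h : v.1 = d * w.1 ∧ v.2 = d * w.2) : 0 ≤ padicValRat p d := by
  by_contra hd
  have hd' : 0 < padicValRat p ((d : ℚ)⁻¹) := by rw [padicValRat.inv]; omega
  apply hw.ne_zero
  have h1 : w.1 = (d : ℚ)⁻¹ * v.1 := by rw [h.1]; field_simp
  have h2 : w.2 = (d : ℚ)⁻¹ * v.2 := by rw [h.2]; field_simp
  rw [h1, h2, ratCast_mul p hd'.le hv.1, ratCast_mul p hd'.le hv.2, ratCast_eq_zero p hd']
  simp

lemma IsPrim.par (hv : IsPrim p v) (hw : IsPrim p w) {d : ℚˣ}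
    (h : v.1 = d * w.1 ∧ v.2 = d * w.2) : padicValRat p d = 0 ∧ ResPar v w (res p d) := by
  have h' : w.1 = (d⁻¹ : ℚˣ) * v.1 ∧ w.2 = (d⁻¹ : ℚˣ) * v.2 := by
    rw [h.1, h.2, Units.inv_mul_cancel_left, Units.inv_mul_cancel_left]; exact ⟨rfl, rfl⟩
  have h1 := hv.nonneg_of_par hw h
  have h2 := hw.nonneg_of_par hv h'
  rw [Units.val_inv_eq_inv_val, padicValRat.inv] at h2
  have h3 : padicValRat p d = 0 := by omega
  refine ⟨h3, ?_, ?_⟩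
  · rw [val_res_of_val_eq_zero h3, ← ratCast_mul p h1 hw.1, h.1]
  · rw [val_res_of_val_eq_zero h3, ← ratCast_mul p h1 hw.2, h.2]

lemma IsPrim.rel_nonneg (hv : IsPrim p v) (hw : IsPrim p w) : 0 ≤ padicValRat p (rel v w) := by
  rcases isRel_rel hv.ne hw.ne with h | h
  · rw [← h]
    exact hv.det_nonneg hw
  · exact hv.nonneg_of_par hw h

lemma IsPrim.exists_resPar (hv : IsPrim p v) (hw : IsPrim p w) (h : 0 < padicValRat p (rel v w)) :
    ∃ l : (ZMod p)ˣ, ResPar v w l := by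
  rcases isRel_rel hv.ne hw.ne with h1 | h1
  · apply exists_resPar_of_det_eq_zero hv hw
    rw [← hv.cast_det hw, h1, ratCast_eq_zero p h]
  · exact ⟨_, (hv.par hw h1).2⟩

variable (p) in
/-- The ratio of the reductions of `v` and `w`, if they are parallel. -/
def resRatio (v w : ℚ × ℚ) : (ZMod p)ˣ :=
  open Classical in if h : ∃ l : (ZMod p)ˣ, ResPar v w l then h.choose else 1

lemma resRatio_eq (hw : IsPrim p w) {l : (ZMod p)ˣ} (h : ResPar v w l) : resRatio p v w = l := by
  have h' : ∃ l : (ZMod p)ˣ, ResPar v w l := ⟨l, h⟩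
  rw [resRatio, dif_pos h']
  exact ResPar.unique hw h'.choose_spec h

variable (p) in
/-- A cochain whose coboundary is the Kubota cocycle of the tame symbol on primitive vectors. -/
def tameSplit (v w : ℚ × ℚ) : Additive (ZMod p)ˣ :=
  padicValRat p (rel v w) • Additive.ofMul (resRatio p v w)

lemma tameSplit_eq_zero (h : padicValRat p (rel v w) = 0) : tameSplit p v w = 0 := by
  rw [tameSplit, h, zero_smul]

lemma tameSplit_eq (hw : IsPrim p w) {l : (ZMod p)ˣ} (h : ResPar v w l) :
    tameSplit p v w = padicValRat p (rel v w) • Additive.ofMul l := by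
  rw [tameSplit, resRatio_eq hw h]

lemma kubota_tame (v₀ v₁ v₂ : ℚ × ℚ) : kubota (tame p) v₀ v₁ v₂ =
    ((padicValRat p (rel v₀ v₂) - padicValRat p (rel v₀ v₁)) *
      (padicValRat p (rel v₀ v₂) - padicValRat p (rel v₁ v₂))) • Additive.ofMul (-1) +
    (padicValRat p (rel v₀ v₂) - padicValRat p (rel v₁ v₂)) •
      (Additive.ofMul (res p (rel v₀ v₂)) - Additive.ofMul (res p (rel v₀ v₁))) -
    (padicValRat p (rel v₀ v₂) - padicValRat p (rel v₀ v₁)) •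
      (Additive.ofMul (res p (rel v₀ v₂)) - Additive.ofMul (res p (rel v₁ v₂))) := by
  rw [kubota, tame, padicValRat_div_units, padicValRat_div_units, map_div (res p),
    map_div (res p), ofMul_div, ofMul_div]

/-- A linear relation between primitive vectors in which one coefficient has larger valuation. -/
lemma resPar_of_relation (hw : IsPrim p w) (hu : IsPrim p u) {a b c : ℚˣ}
    (h1 : a * v.1 + b * w.1 + c * u.1 = 0) (h2 : a * v.2 + b * w.2 + c * u.2 = 0)
    (hab : padicValRat p a = padicValRat p b) (hac : padicValRat p a < padicValRat p c) :
    ResPar v w (res p (-(b / a))) := by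
  have hba : padicValRat p ((-(b / a) : ℚˣ) : ℚ) = 0 := by
    rw [Units.val_neg, padicValRat.neg, padicValRat_div_units, hab, sub_self]
  have hca : 0 < padicValRat p ((-(c / a) : ℚˣ) : ℚ) := by
    rw [Units.val_neg, padicValRat.neg, padicValRat_div_units]; omega
  have key : ∀ x y z : ℚ, 0 ≤ padicValRat p y → 0 ≤ padicValRat p z →
      a * x + b * y + c * z = 0 → (x : ZMod p) = res p (-(b / a)) * (y : ZMod p) := by
    intro x y z hy hz h
    have hx : x = ((-(b / a) : ℚˣ) : ℚ) * y + ((-(c / a) : ℚˣ) : ℚ) * z := by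
      push_cast
      have := a.ne_zero
      field_simp
      linear_combination h
    rw [hx, ratCast_add p (padicValRat_mul_nonneg hba.ge hy) (padicValRat_mul_nonneg hca.le hz),
      ratCast_mul p hba.ge hy, ratCast_mul p hca.le hz, ratCast_eq_zero p hca, zero_mul, add_zero,
      val_res_of_val_eq_zero hba]
  exact ⟨key _ _ _ hw.1 hu.1 h1, key _ _ _ hw.2 hu.2 h2⟩

lemma not_lt_of_relation (hv : IsPrim p v) (hw : IsPrim p w) (hu : IsPrim p u) {a b c : ℚˣ}
    (h1 : a * v.1 + b * w.1 + c * u.1 = 0) (h2 : a * v.2 + b * w.2 + c * u.2 = 0)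
    (hab : padicValRat p a < padicValRat p b) : padicValRat p c ≤ padicValRat p a := by
  by_contra hac
  have hba : 0 < padicValRat p ((-(b / a) : ℚˣ) : ℚ) := by
    rw [Units.val_neg, padicValRat.neg, padicValRat_div_units]; omega
  have hca : 0 < padicValRat p ((-(c / a) : ℚˣ) : ℚ) := by
    rw [Units.val_neg, padicValRat.neg, padicValRat_div_units]; omega
  have key : ∀ x y z : ℚ, 0 ≤ padicValRat p y → 0 ≤ padicValRat p z →
      a * x + b * y + c * z = 0 → (x : ZMod p) = 0 := by
    intro x y z hy hz h
    have hx : x = ((-(b / a) : ℚˣ) : ℚ) * y + ((-(c / a) : ℚˣ) : ℚ) * z := by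
      push_cast
      have := a.ne_zero
      field_simp
      linear_combination h
    rw [hx, ratCast_add p (padicValRat_mul_nonneg hba.le hy) (padicValRat_mul_nonneg hca.le hz),
      ratCast_mul p hba.le hy, ratCast_mul p hca.le hz, ratCast_eq_zero p hca,
      ratCast_eq_zero p hba, zero_mul, zero_mul, add_zero]
  exact hv.ne_zero ⟨key _ _ _ hw.1 hu.1 h1, key _ _ _ hw.2 hu.2 h2⟩

end Tame

section TameSplit

variable {p : ℕ} [hp : Fact p.Prime] {v₀ v₁ v₂ : ℚ × ℚ}

lemma kubota_tame_of_par_left (h₀ : IsPrim p v₀) (h₁ : IsPrim p v₁) (h₂ : IsPrim p v₂)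
    (h : v₀.1 = rel v₀ v₁ * v₁.1 ∧ v₀.2 = rel v₀ v₁ * v₁.2) :
    kubota (tame p) v₀ v₁ v₂ = tameSplit p v₀ v₁ + tameSplit p v₁ v₂ - tameSplit p v₀ v₂ := by
  have hrel := rel_of_par_left h₀.ne h₁.ne h₂.ne h
  obtain ⟨hn, hl⟩ := h₀.par h₁ h
  have hn2 : padicValRat p (rel v₀ v₂) = padicValRat p (rel v₁ v₂) := by
    rw [hrel, padicValRat_mul_units, hn, zero_add]
  have hres : Additive.ofMul (res p (rel v₀ v₂)) =
      Additive.ofMul (res p (rel v₀ v₁)) + Additive.ofMul (res p (rel v₁ v₂)) := by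
    rw [hrel, map_mul, ofMul_mul]
  rw [kubota_tame, hn2, hn, hres, tameSplit_eq_zero hn]
  rcases (h₁.rel_nonneg h₂).eq_or_lt with h0 | hpos
  · rw [tameSplit_eq_zero h0.symm, tameSplit_eq_zero (hn2.trans h0.symm), ← h0]
    module
  · obtain ⟨l, hl2⟩ := h₁.exists_resPar h₂ hpos
    rw [tameSplit_eq h₂ hl2, tameSplit_eq h₂ (hl.mul hl2), hn2, ofMul_mul]
    module

lemma kubota_tame_of_par_right (h₀ : IsPrim p v₀) (h₁ : IsPrim p v₁) (h₂ : IsPrim p v₂)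
    (h : v₁.1 = rel v₁ v₂ * v₂.1 ∧ v₁.2 = rel v₁ v₂ * v₂.2)
    (h' : v₀.1 * v₁.2 - v₀.2 * v₁.1 = rel v₀ v₁) :
    kubota (tame p) v₀ v₁ v₂ = tameSplit p v₀ v₁ + tameSplit p v₁ v₂ - tameSplit p v₀ v₂ := by
  have hrel := rel_of_par_right h₀.ne h₁.ne h₂.ne h h'
  obtain ⟨hn, hl⟩ := h₁.par h₂ h
  have hn2 : padicValRat p (rel v₀ v₁) = padicValRat p (rel v₀ v₂) := by
    rw [hrel, padicValRat_mul_units, hn, zero_add]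
  have hres : Additive.ofMul (res p (rel v₀ v₁)) =
      Additive.ofMul (res p (rel v₁ v₂)) + Additive.ofMul (res p (rel v₀ v₂)) := by
    rw [hrel, map_mul, ofMul_mul]
  rw [kubota_tame, hn2, hn, hres, tameSplit_eq_zero hn]
  rcases (h₀.rel_nonneg h₂).eq_or_lt with h0 | hpos
  · rw [tameSplit_eq_zero h0.symm, tameSplit_eq_zero (hn2.trans h0.symm), ← h0]
    module
  · obtain ⟨l, hl2⟩ := h₀.exists_resPar h₁ (hn2 ▸ hpos)
    rw [tameSplit_eq h₁ hl2, tameSplit_eq h₂ (hl2.mul hl), hn2, ofMul_mul]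
    module

lemma kubota_tame_of_par_outer (h₀ : IsPrim p v₀) (h₁ : IsPrim p v₁) (h₂ : IsPrim p v₂)
    (h : v₀.1 = rel v₀ v₂ * v₂.1 ∧ v₀.2 = rel v₀ v₂ * v₂.2)
    (h' : v₁.1 * v₂.2 - v₁.2 * v₂.1 = rel v₁ v₂) :
    kubota (tame p) v₀ v₁ v₂ = tameSplit p v₀ v₁ + tameSplit p v₁ v₂ - tameSplit p v₀ v₂ := by
  have hrel := rel_of_par_outer h₀.ne h₁.ne h h'
  obtain ⟨hn, hl⟩ := h₀.par h₂ h
  have hn2 : padicValRat p (rel v₀ v₁) = padicValRat p (rel v₁ v₂) := by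
    rw [hrel, padicValRat_mul_units, padicValRat_mul_units, hn]
    simp
  have hres : Additive.ofMul (res p (rel v₀ v₁)) = Additive.ofMul (-1 : (ZMod p)ˣ) +
      (Additive.ofMul (res p (rel v₀ v₂)) + Additive.ofMul (res p (rel v₁ v₂))) := by
    rw [hrel, map_mul (res p), map_mul (res p), res_neg_one, ofMul_mul, ofMul_mul]
  have heven := mul_self_sub_smul_ofMul_neg_one (p := p) (padicValRat p (rel v₁ v₂))
  have htwo := two_smul_ofMul_neg_one (p := p)
  rw [kubota_tame, hn2, hn, hres, tameSplit_eq_zero hn]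
  rcases (h₁.rel_nonneg h₂).eq_or_lt with h0 | hpos
  · rw [tameSplit_eq_zero h0.symm, tameSplit_eq_zero (hn2.trans h0.symm), ← h0]
    module
  · obtain ⟨l, hl1⟩ := h₀.exists_resPar h₁ (hn2 ▸ hpos)
    obtain ⟨m, hl2⟩ := h₁.exists_resPar h₂ hpos
    have hlm := congrArg Additive.ofMul ((hl1.mul hl2).unique h₂ hl)
    rw [ofMul_mul] at hlm
    rw [tameSplit_eq h₁ hl1, tameSplit_eq h₂ hl2, hn2]
    linear_combination (norm := module) heven + padicValRat p (rel v₁ v₂) • htwo -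
      padicValRat p (rel v₁ v₂) • hlm

lemma smul_resRatio_add (h₀ : IsPrim p v₀) (h₁ : IsPrim p v₁) (h₂ : IsPrim p v₂) {m : ℤ}
    (h01 : m ≤ padicValRat p (rel v₀ v₁)) (h12 : m ≤ padicValRat p (rel v₁ v₂)) (hm : 0 ≤ m) :
    m • (Additive.ofMul (resRatio p v₀ v₁) + Additive.ofMul (resRatio p v₁ v₂) -
      Additive.ofMul (resRatio p v₀ v₂)) = 0 := by
  rcases hm.eq_or_lt with h0 | hpos
  · rw [← h0, zero_smul]
  · obtain ⟨l, hl1⟩ := h₀.exists_resPar h₁ (hpos.trans_le h01)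
    obtain ⟨k, hl2⟩ := h₁.exists_resPar h₂ (hpos.trans_le h12)
    rw [resRatio_eq h₁ hl1, resRatio_eq h₂ hl2, resRatio_eq h₂ (hl1.mul hl2), ofMul_mul, sub_self,
      smul_zero]

lemma kubota_tame_of_independent (h₀ : IsPrim p v₀) (h₁ : IsPrim p v₁) (h₂ : IsPrim p v₂)
    (h01 : v₀.1 * v₁.2 - v₀.2 * v₁.1 = rel v₀ v₁) (h12 : v₁.1 * v₂.2 - v₁.2 * v₂.1 = rel v₁ v₂)
    (h02 : v₀.1 * v₂.2 - v₀.2 * v₂.1 = rel v₀ v₂) :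
    kubota (tame p) v₀ v₁ v₂ = tameSplit p v₀ v₁ + tameSplit p v₁ v₂ - tameSplit p v₀ v₂ := by
  have hneg : padicValRat p ((-rel v₀ v₂ : ℚˣ) : ℚ) = padicValRat p (rel v₀ v₂) := by
    rw [Units.val_neg, padicValRat.neg]
  have n01 := h₀.rel_nonneg h₁
  have n02 := h₀.rel_nonneg h₂
  have n12 := h₁.rel_nonneg h₂
  have htwo := two_smul_ofMul_neg_one (p := p)
  rw [kubota_tame, tameSplit, tameSplit, tameSplit]
  have e1 : rel v₁ v₂ * v₀.1 + ((-rel v₀ v₂ : ℚˣ) : ℚ) * v₁.1 + rel v₀ v₁ * v₂.1 = 0 := by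
    rw [Units.val_neg, ← h01, ← h12, ← h02]; ring
  have e2 : rel v₁ v₂ * v₀.2 + ((-rel v₀ v₂ : ℚˣ) : ℚ) * v₁.2 + rel v₀ v₁ * v₂.2 = 0 := by
    rw [Units.val_neg, ← h01, ← h12, ← h02]; ring
  have f1 : ((-rel v₀ v₂ : ℚˣ) : ℚ) * v₁.1 + rel v₀ v₁ * v₂.1 + rel v₁ v₂ * v₀.1 = 0 := by
    rw [← e1]; ring
  have f2 : ((-rel v₀ v₂ : ℚˣ) : ℚ) * v₁.2 + rel v₀ v₁ * v₂.2 + rel v₁ v₂ * v₀.2 = 0 := by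
    rw [← e2]; ring
  have g1 : rel v₁ v₂ * v₀.1 + rel v₀ v₁ * v₂.1 + ((-rel v₀ v₂ : ℚˣ) : ℚ) * v₁.1 = 0 := by
    rw [← e1]; ring
  have g2 : rel v₁ v₂ * v₀.2 + rel v₀ v₁ * v₂.2 + ((-rel v₀ v₂ : ℚˣ) : ℚ) * v₁.2 = 0 := by
    rw [← e2]; ring
  have i1 : rel v₀ v₁ * v₂.1 + rel v₁ v₂ * v₀.1 + ((-rel v₀ v₂ : ℚˣ) : ℚ) * v₁.1 = 0 := by
    rw [← e1]; ring
  have i2 : rel v₀ v₁ * v₂.2 + rel v₁ v₂ * v₀.2 + ((-rel v₀ v₂ : ℚˣ) : ℚ) * v₁.2 = 0 := by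
    rw [← e2]; ring
  by_cases c1 : padicValRat p (rel v₁ v₂) < padicValRat p (rel v₀ v₂)
  · have a1 := not_lt_of_relation h₀ h₁ h₂ e1 e2 (by rwa [hneg])
    have a2 : padicValRat p (rel v₀ v₁) = padicValRat p (rel v₁ v₂) := by
      refine a1.antisymm (not_lt.mp fun h => ?_)
      have := not_lt_of_relation h₂ h₀ h₁ i1 i2 h
      omega
    have hl := resPar_of_relation h₂ h₁ g1 g2 a2.symm (by rwa [hneg])
    have := smul_resRatio_add h₀ h₁ h₂ a2.ge le_rfl n12
    rw [resRatio_eq h₂ hl, res_neg, ← neg_one_mul (res p _), map_div, ofMul_mul, ofMul_div] at *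
    rw [a2]
    linear_combination (norm := module) -this + mul_self_sub_smul_ofMul_neg_one (p := p)
      (padicValRat p (rel v₀ v₂) - padicValRat p (rel v₁ v₂)) +
      (padicValRat p (rel v₀ v₂) - padicValRat p (rel v₁ v₂)) • htwo
  by_cases c2 : padicValRat p (rel v₀ v₂) < padicValRat p (rel v₁ v₂)
  · have a1 := not_lt_of_relation h₁ h₂ h₀ f1 f2
    rw [hneg] at a1
    have a2 : padicValRat p (rel v₀ v₁) = padicValRat p (rel v₀ v₂) := by
      refine le_antisymm (not_lt.mp fun h => ?_) (not_lt.mp fun h => ?_)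
      · have := a1 h
        omega
      · have := not_lt_of_relation h₂ h₀ h₁ i1 i2 (by omega)
        omega
    have hl := resPar_of_relation h₂ h₀ f1 f2 (by rw [hneg, a2]) (by rwa [hneg])
    rw [div_neg, neg_neg] at hl
    have := smul_resRatio_add h₀ h₁ h₂ a2.ge c2.le n02
    rw [resRatio_eq h₂ hl, map_div, ofMul_div] at *
    rw [a2]
    linear_combination (norm := module) -this
  · have c3 : padicValRat p (rel v₁ v₂) = padicValRat p (rel v₀ v₂) := by omega
    have a1 : padicValRat p (rel v₁ v₂) ≤ padicValRat p (rel v₀ v₁) := by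
      refine not_lt.mp fun h => ?_
      have := not_lt_of_relation h₂ h₀ h₁ i1 i2 h
      omega
    have := smul_resRatio_add h₀ h₁ h₂ a1 le_rfl n12
    rw [← c3]
    rcases a1.eq_or_lt with a2 | a2
    · rw [← a2]
      linear_combination (norm := module) -this
    · have hl := resPar_of_relation h₁ h₂ e1 e2 (by rw [hneg, c3]) a2
      rw [neg_div, neg_neg] at hl
      rw [resRatio_eq h₁ hl, map_div, ofMul_div] at *
      linear_combination (norm := module) -this

/-- On primitive vectors the Kubota cocycle of the tame symbol is a coboundary. -/
lemma kubota_tame_eq (h₀ : IsPrim p v₀) (h₁ : IsPrim p v₁) (h₂ : IsPrim p v₂) :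
    kubota (tame p) v₀ v₁ v₂ = tameSplit p v₀ v₁ + tameSplit p v₁ v₂ - tameSplit p v₀ v₂ := by
  rcases isRel_rel h₀.ne h₁.ne with h01 | h01
  · rcases isRel_rel h₁.ne h₂.ne with h12 | h12
    · rcases isRel_rel h₀.ne h₂.ne with h02 | h02
      · exact kubota_tame_of_independent h₀ h₁ h₂ h01 h12 h02
      · exact kubota_tame_of_par_outer h₀ h₁ h₂ h02 h12
    · exact kubota_tame_of_par_right h₀ h₁ h₂ h12 h01
  · exact kubota_tame_of_par_left h₀ h₁ h₂ h01

lemma isPrim_col {g : SL2Q} (hg : ∀ i j, 0 ≤ padicValRat p (g i j)) : IsPrim p (col g) := by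
  refine ⟨hg 0 0, hg 1 0, fun h => ?_⟩
  have hdet := SL2Q.det_eq g
  have h1 : ((g 0 0 : ℚ) : ZMod p) = 0 := h.1
  have h2 : ((g 1 0 : ℚ) : ZMod p) = 0 := h.2
  have h3 : 0 ≤ padicValRat p (-(g 0 1 * g 1 0)) := by
    rw [padicValRat.neg]
    exact padicValRat_mul_nonneg (hg 0 1) (hg 1 0)
  have := congrArg (fun x : ℚ => (x : ZMod p)) hdet
  simp only [sub_eq_add_neg] at this
  rw [ratCast_add p (padicValRat_mul_nonneg (hg 0 0) (hg 1 1)) h3, Rat.cast_neg,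
    ratCast_mul p (hg 0 0) (hg 1 1), ratCast_mul p (hg 0 1) (hg 1 0), h1, h2] at this
  simp at this

/-- On `SL₂` of a ring of `p`-integral numbers the tame cocycle is a coboundary. -/
lemma kubotaCocycle_tame_eq {g h : SL2Q} (hg : ∀ i j, 0 ≤ padicValRat p (g i j))
    (hh : ∀ i j, 0 ≤ padicValRat p (h i j)) :
    kubotaCocycle (tame p) g h = tameSplit p (col 1) (col g) + tameSplit p (col 1) (col h) -
      tameSplit p (col 1) (col (g * h)) := by
  have hgh : ∀ i j, 0 ≤ padicValRat p ((g * h) i j) := by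
    intro i j
    rw [SL2Q.mul_entry]
    exact padicValRat_add_nonneg (padicValRat_mul_nonneg (hg _ _) (hh _ _))
      (padicValRat_mul_nonneg (hg _ _) (hh _ _))
  have h1 : ∀ i j, 0 ≤ padicValRat p ((1 : SL2Q) i j) := by
    intro i j
    fin_cases i <;> fin_cases j <;> simp
  have hsplit : tameSplit p (col g) (col (g * h)) = tameSplit p (col 1) (col h) := by
    have hrel := rel_col_mul g 1 h
    rw [mul_one] at hrel
    rcases ((isPrim_col h1).rel_nonneg (isPrim_col hh)).eq_or_lt with h0 | hpos
    · rw [tameSplit_eq_zero (by rw [hrel, ← h0]), tameSplit_eq_zero h0.symm]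
    · obtain ⟨l, hl⟩ := (isPrim_col h1).exists_resPar (isPrim_col hh) hpos
      have hl1 : (1 : ZMod p) = l * ((h 0 0 : ℚ) : ZMod p) := by simpa [col] using hl.1
      have hl2 : (0 : ZMod p) = l * ((h 1 0 : ℚ) : ZMod p) := by simpa [col] using hl.2
      have key : ∀ i, ((g i 0 : ℚ) : ZMod p) = l * (((g * h) i 0 : ℚ) : ZMod p) := by
        intro i
        rw [SL2Q.mul_entry, ratCast_add p (padicValRat_mul_nonneg (hg _ _) (hh _ _))
          (padicValRat_mul_nonneg (hg _ _) (hh _ _)), ratCast_mul p (hg _ _) (hh _ _),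
          ratCast_mul p (hg _ _) (hh _ _)]
        linear_combination ((g i 0 : ℚ) : ZMod p) * hl1 + ((g i 1 : ℚ) : ZMod p) * hl2
      rw [tameSplit_eq (isPrim_col hh) hl, tameSplit_eq (isPrim_col hgh) ⟨key 0, key 1⟩, hrel]
  rw [kubotaCocycle, kubota_tame_eq (isPrim_col h1) (isPrim_col hg) (isPrim_col hgh), hsplit]

end TameSplit

/-- The linear map on 2-chains attached to a function of two variables. -/
def cochainMap {α M : Type*} [AddCommGroup M] (β : α → α → M) : ((α × α) →₀ ℤ) →ₗ[ℤ] M :=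
  Finsupp.lsum ℤ fun p => LinearMap.toSpanSingleton ℤ _ (β p.1 p.2)

lemma cochainMap_single {α M : Type*} [AddCommGroup M] (β : α → α → M) (p : α × α) (n : ℤ) :
    cochainMap β (single p n) = n • β p.1 p.2 := by
  simp [cochainMap]

section Cokernel

variable {Γ Λ : Type*} [Group Γ] [Group Λ] (f : Λ →* Γ)

/-- Boundaries together with the images of the cycles of the source of `f`. -/
def relBoundaries : Submodule ℤ ((Γ × Γ) →₀ ℤ) :=
  LinearMap.range (barD3 Γ) ⊔ (LinearMap.ker (barD2 Λ)).map (mapC2 f)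

lemma range_barD3_le_relBoundaries : LinearMap.range (barD3 Γ) ≤ relBoundaries f := le_sup_left

lemma range_barD3_le_ker : LinearMap.range (barD3 Γ) ≤ LinearMap.ker (barD2 Γ) := by
  rintro _ ⟨z, rfl⟩
  exact barD2_barD3 z

lemma mapC2_mem_relBoundaries {z : (Λ × Λ) →₀ ℤ} (hz : z ∈ LinearMap.ker (barD2 Λ)) :
    mapC2 f z ∈ relBoundaries f :=
  le_sup_right (a := LinearMap.range (barD3 Γ)) (Submodule.mem_map_of_mem hz)

lemma relBoundaries_le_ker : relBoundaries f ≤ LinearMap.ker (barD2 Γ) := by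
  refine sup_le range_barD3_le_ker ?_
  rintro _ ⟨z, hz, rfl⟩
  have := LinearMap.congr_fun (barD2_comm f) z
  simp only [LinearMap.comp_apply] at this
  rw [LinearMap.mem_ker, this, LinearMap.mem_ker.mp hz, map_zero]

/-- A linear map on 2-chains whose kernel on cycles consists of the relative boundaries identifies
the cokernel of `mapH2 f` with its image. -/
lemma nonempty_coker_equiv {N : Type*} [AddCommGroup N] (T : ((Γ × Γ) →₀ ℤ) →ₗ[ℤ] N)
    (hT : relBoundaries f ≤ LinearMap.ker T)
    (hT' : ∀ z ∈ LinearMap.ker (barD2 Γ), T z = 0 → z ∈ relBoundaries f) :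
    Nonempty ((H2 Γ ⧸ LinearMap.range (mapH2 f)) ≃ₗ[ℤ] (LinearMap.ker (barD2 Γ)).map T) := by
  let Ψ : H2 Γ →ₗ[ℤ] N := Submodule.liftQ _ (T.comp (LinearMap.ker (barD2 Γ)).subtype) (by
    rintro z hz
    exact hT (range_barD3_le_relBoundaries f hz))
  have hker : LinearMap.range (mapH2 f) = LinearMap.ker Ψ := by
    ext x
    obtain ⟨⟨z, hz⟩, rfl⟩ := Submodule.mkQ_surjective _ x
    constructor
    · rintro ⟨y, hy⟩
      obtain ⟨⟨y, hy'⟩, rfl⟩ := Submodule.mkQ_surjective _ y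
      rw [← hy]
      exact hT (mapC2_mem_relBoundaries f hy')
    · intro h
      obtain ⟨a, ⟨w, rfl⟩, b, ⟨y, hy, rfl⟩, hab⟩ := Submodule.mem_sup.mp (hT' z hz h)
      refine ⟨Submodule.mkQ _ ⟨y, hy⟩, ?_⟩
      rw [← sub_eq_zero, ← neg_eq_zero, neg_sub]
      change Submodule.mkQ _ _ - Submodule.mkQ _ _ = 0
      rw [← map_sub, Submodule.mkQ_apply, Submodule.Quotient.mk_eq_zero]
      exact ⟨w, eq_sub_of_add_eq hab⟩
  have hrange : LinearMap.range Ψ = (LinearMap.ker (barD2 Γ)).map T :=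
    (Submodule.range_liftQ _ _ _).trans (by rw [LinearMap.range_comp, Submodule.range_subtype])
  exact ⟨(Submodule.quotEquivOfEq _ _ hker).trans
    (Ψ.quotKerEquivRange.trans (LinearEquiv.ofEq _ _ hrange))⟩

lemma range_barD3_le_ker_cochainMap {M : Type*} [AddCommGroup M] {β : Γ → Γ → M}
    (hβ : IsCocycle β) : LinearMap.range (barD3 Γ) ≤ LinearMap.ker (cochainMap β) := by
  rw [LinearMap.range_le_ker_iff]
  apply Finsupp.lhom_ext
  intro t n
  simp only [LinearMap.comp_apply, barD3_single, map_smul, map_sub, map_add, cochainMap_single,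
    one_smul, LinearMap.zero_apply]
  rw [hβ t.1 t.2.1 t.2.2, smul_zero]

/-- A cocycle that becomes a coboundary on the source of `f` kills the relative boundaries. -/
lemma relBoundaries_le_ker_cochainMap {M : Type*} [AddCommGroup M] {β : Γ → Γ → M}
    (hβ : IsCocycle β) {σ : Λ → M} (hσ : ∀ g h, β (f g) (f h) = σ g + σ h - σ (g * h)) :
    relBoundaries f ≤ LinearMap.ker (cochainMap β) := by
  refine sup_le (range_barD3_le_ker_cochainMap hβ) ?_
  let τ : (Λ →₀ ℤ) →ₗ[ℤ] M := Finsupp.lsum ℤ fun g => LinearMap.toSpanSingleton ℤ _ (σ g)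
  have hτ : ∀ g, τ (single g 1) = σ g := by
    intro g; simp [τ]
  have key : (cochainMap β).comp (mapC2 f) = τ.comp (barD2 Λ) := by
    apply Finsupp.lhom_ext
    intro p n
    simp only [LinearMap.comp_apply, mapC2_single, cochainMap_single, barD2_single, map_smul,
      map_add, map_sub, hτ, hσ]
    congr 1
    abel
  rintro _ ⟨z, hz, rfl⟩
  have := LinearMap.congr_fun key z
  simp only [LinearMap.comp_apply] at this
  rw [LinearMap.mem_ker, this, LinearMap.mem_ker.mp hz, map_zero]

end Cokernel

namespace CentralExt

variable {K E K' E' : Type*} [AddCommGroup K] [Group E] [AddCommGroup K'] [Group E']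
  (X : CentralExt K E) (X' : CentralExt K' E') (φ : E →* E') (hφ : ∀ e, X'.π (φ e) = X.π e)

include hφ

lemma map_x (t : ℚ) : φ (X.x t) = X'.x t := by
  rw [x, map_commutatorElement]
  exact (X'.x_eq (by rw [hφ, π_lift]) (by rw [hφ, π_lift])).symm

lemma map_y (t : ℚ) : φ (X.y t) = X'.y t := by
  rw [y, map_mul, map_mul, map_inv, X.map_x X' φ hφ, y]
  exact X'.conj_eq (by rw [hφ, π_lift, π_lift]) _

lemma map_h (u : ℚˣ) : φ (X.h u) = X'.h u := by
  simp only [h, w, map_mul, X.map_x X' φ hφ, X.map_y X' φ hφ]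

/-- Morphisms of central extensions preserve symbols. -/
lemma map_c {T : K → K'} (hT : ∀ k, φ (X.ι k) = X'.ι (T k)) (u v : ℚˣ) :
    T (X.c u v) = X'.c u v := by
  apply X'.ι_inj
  have h1 := congrArg φ (X.h_mul u v)
  rw [map_mul, map_mul, hT, X.map_h X' φ hφ, X.map_h X' φ hφ, X.map_h X' φ hφ, X'.h_mul] at h1
  exact (mul_right_cancel h1).symm

end CentralExt

/-- The central extension of `SL₂(ℚ)` attached to a submodule of 2-chains. -/
abbrev barExt {R : Submodule ℤ ((SL2Q × SL2Q) →₀ ℤ)} (hR : LinearMap.range (barD3 SL2Q) ≤ R) :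
    CentralExt (((SL2Q × SL2Q) →₀ ℤ) ⧸ R) (CocExt (barCocycle R) (isCocycle_barCocycle hR)) :=
  CocExt.centralExt (isCocycle_barCocycle hR)

lemma liftQ_barExt_c {R : Submodule ℤ ((SL2Q × SL2Q) →₀ ℤ)}
    (hR : LinearMap.range (barD3 SL2Q) ≤ R) {M : Type*} [AddCommGroup M] {β : SL2Q → SL2Q → M}
    (hβ : IsCocycle β) (h : R ≤ LinearMap.ker (cochainMap β)) (u v : ℚˣ) :
    R.liftQ (cochainMap β) h ((barExt hR).c u v) = (CocExt.centralExt hβ).c u v := by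
  have hb : ∀ a b, R.liftQ (cochainMap β) h (barCocycle R a b) = β a b := by
    intro a b
    simp [barCocycle, cochainMap_single]
  refine (barExt hR).map_c (CocExt.centralExt hβ) (T := R.liftQ (cochainMap β) h)
    (MonoidHom.mk' (fun e => ⟨R.liftQ (cochainMap β) h e.fib, e.base⟩) fun a b => ?_)
    (fun e => rfl) (fun k => ?_) u v
  · ext1
    · simp only [CocExt.mul_fib, map_add, hb]
    · rfl
  · apply CocExt.ext
    · change R.liftQ (cochainMap β) h (k - barCocycle R 1 1) = R.liftQ (cochainMap β) h k - β 1 1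
      rw [map_sub, hb]
    · rfl

lemma mkQ_mem_symbols {R : Submodule ℤ ((SL2Q × SL2Q) →₀ ℤ)}
    (hR : LinearMap.range (barD3 SL2Q) ≤ R) {z : (SL2Q × SL2Q) →₀ ℤ}
    (hz : z ∈ LinearMap.ker (barD2 SL2Q)) : R.mkQ z ∈ (barExt hR).symbols := by
  obtain ⟨k, hk, h⟩ := (barExt hR).exists_symbols_of_mem_commutator (incl_mem_commutator hR hz) rfl
  rwa [(barExt hR).ι_inj h]

lemma exists_mkQ_eq_c {R : Submodule ℤ ((SL2Q × SL2Q) →₀ ℤ)}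
    (hR : LinearMap.range (barD3 SL2Q) ≤ R) (hR' : R ≤ LinearMap.ker (barD2 SL2Q)) (u v : ℚˣ) :
    ∃ z ∈ LinearMap.ker (barD2 SL2Q), R.mkQ z = (barExt hR).c u v := by
  obtain ⟨z, hz, h⟩ := mkQ_eq_of_mem_commutator hR hR' ((barExt hR).ι_c_mem_commutator u v)
    ((barExt hR).π_ι ((barExt hR).c u v))
  exact ⟨z, hz, ((barExt hR).ι_inj h).symm⟩

lemma exists_mkQ_eq_of_mem_symbols {R : Submodule ℤ ((SL2Q × SL2Q) →₀ ℤ)}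
    (hR : LinearMap.range (barD3 SL2Q) ≤ R) (hR' : R ≤ LinearMap.ker (barD2 SL2Q)) {k}
    (hk : k ∈ (barExt hR).symbols) : ∃ z ∈ LinearMap.ker (barD2 SL2Q), R.mkQ z = k := by
  refine AddSubgroup.closure_le (((LinearMap.ker (barD2 SL2Q)).map R.mkQ).toAddSubgroup) |>.mpr
    ?_ hk
  rintro _ ⟨u, v, rfl⟩
  exact exists_mkQ_eq_c hR hR' u v

section Lift

variable {Γ Λ : Type*} [Group Γ] [Group Λ] (f : Λ →* Γ)

/-- The morphism from the universal extension of the source of `f`. -/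
def barLift : CocExt (barCocycle (LinearMap.range (barD3 Λ))) (isCocycle_barCocycle le_rfl) →*
    CocExt (barCocycle (relBoundaries f))
      (isCocycle_barCocycle (range_barD3_le_relBoundaries f)) :=
  MonoidHom.mk' (fun e => ⟨Submodule.mapQ _ _ (mapC2 f) (by
      rintro _ ⟨z, rfl⟩
      exact mapC2_mem_relBoundaries f (barD2_barD3 z)) e.fib, f e.base⟩) fun a b => by
    ext1
    · simp [barCocycle, mapC2_single]
    · exact map_mul f _ _

@[simp] lemma barLift_base (e) : (barLift f e).base = f e.base := rfl

lemma barLift_eq_one (hf : Function.Injective f) {e}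
    (he : e ∈ (commutator (CocExt (barCocycle (LinearMap.range (barD3 Λ)))
      (isCocycle_barCocycle le_rfl))).map (barLift f)) (h1 : e.base = 1) : e = 1 := by
  obtain ⟨e, he, rfl⟩ := he
  rw [barLift_base, map_eq_one_iff f hf] at h1
  obtain ⟨z, hz, rfl⟩ := mkQ_eq_of_mem_commutator le_rfl range_barD3_le_ker he h1
  have h2 : (relBoundaries f).mkQ (mapC2 f z) = 0 := by
    rw [Submodule.mkQ_apply, Submodule.Quotient.mk_eq_zero]
    exact mapC2_mem_relBoundaries f hz
  apply CocExt.ext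
  · change Submodule.mapQ _ _ (mapC2 f) _ (Submodule.mkQ _ z - Submodule.mkQ _ (single (1, 1) 1)) =
      -(relBoundaries f).mkQ (single (1, 1) 1)
    rw [map_sub, Submodule.mkQ_apply, Submodule.mkQ_apply, Submodule.mapQ_apply,
      Submodule.mapQ_apply, ← Submodule.mkQ_apply, h2, mapC2_single, map_one, zero_sub]
    rfl
  · exact map_one f

end Lift

section SubringLift

variable (A : Subring ℚ)

/-- The inclusion of `SL₂(A)` into `SL₂(ℚ)`. -/
abbrev slIncl : SpecialLinearGroup (Fin 2) A →* SL2Q :=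
  SpecialLinearGroup.map (n := Fin 2) A.subtype

lemma slIncl_apply (g : SpecialLinearGroup (Fin 2) A) (i j : Fin 2) :
    slIncl A g i j = (g i j : ℚ) := rfl

lemma slIncl_injective : Function.Injective (slIncl A) := by
  intro g h hgh
  ext i j
  rw [← slIncl_apply, hgh, slIncl_apply]

variable {A}

lemma exists_slIncl_eq {g : SL2Q} (hg : ∀ i j, g i j ∈ A) : ∃ g', slIncl A g' = g := by
  refine ⟨⟨Matrix.of fun i j => ⟨g i j, hg i j⟩, ?_⟩, ?_⟩
  · apply Subtype.ext
    have := SL2Q.det_eq g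
    rw [Matrix.det_fin_two]
    exact this
  · ext i j
    rfl

variable (A) in
/-- The canonical central extension of `SL₂(ℚ)` relative to `SL₂(A)`. -/
abbrev relExt := barExt (range_barD3_le_relBoundaries (slIncl A))

variable (A) in
/-- The image of the derived subgroup of the universal extension of `SL₂(A)`. -/
def relSplit : Subgroup (CocExt (barCocycle (relBoundaries (slIncl A)))
    (isCocycle_barCocycle (range_barD3_le_relBoundaries (slIncl A)))) :=
  (commutator _).map (barLift (slIncl A))

lemma eq_one_of_mem_relSplit {e} (he : e ∈ relSplit A) (h : (relExt A).π e = 1) : e = 1 :=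
  barLift_eq_one _ (slIncl_injective A) he h

lemma exists_barLift {g : SL2Q} (hg : ∀ i j, g i j ∈ A) :
    ∃ e, (relExt A).π (barLift (slIncl A) e) = g := by
  obtain ⟨g', rfl⟩ := exists_slIncl_eq hg
  exact ⟨⟨0, g'⟩, rfl⟩

lemma x_mem_relSplit (h2 : (2 : ℚ)⁻¹ ∈ A) (h3 : (3 : ℚ)⁻¹ ∈ A) {t : ℚ} (ht : t ∈ A) :
    (relExt A).x t ∈ relSplit A := by
  obtain ⟨e, he⟩ := exists_barLift (A := A) (g := diag CentralExt.two) (by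
    intro i j
    fin_cases i <;> fin_cases j
    · exact ofNat_mem A 2
    · exact zero_mem A
    · exact zero_mem A
    · exact h2)
  obtain ⟨e', he'⟩ := exists_barLift (A := A) (g := u12 (t / 3)) (by
    intro i j
    fin_cases i <;> fin_cases j
    · exact one_mem A
    · exact mul_mem ht h3
    · exact zero_mem A
    · exact one_mem A)
  rw [(relExt A).x_eq he he', ← map_commutatorElement]
  exact Subgroup.mem_map_of_mem _
    (Subgroup.commutator_mem_commutator (Subgroup.mem_top _) (Subgroup.mem_top _))

lemma y_mem_relSplit (h2 : (2 : ℚ)⁻¹ ∈ A) (h3 : (3 : ℚ)⁻¹ ∈ A) {t : ℚ} (ht : t ∈ A) :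
    (relExt A).y t ∈ relSplit A := by
  obtain ⟨e, he⟩ := exists_barLift (A := A) (g := wmat 1) (by
    intro i j
    fin_cases i <;> fin_cases j
    · exact zero_mem A
    · exact one_mem A
    · exact neg_mem (by simp)
    · exact zero_mem A)
  have h := (relExt A).conj_wmat_x he (-t)
  simp only [Units.val_one, inv_one, one_pow, one_mul, neg_neg] at h
  obtain ⟨a, ha, ha'⟩ := x_mem_relSplit h2 h3 (neg_mem ht)
  rw [← h, ← ha', ← map_inv, ← map_mul, ← map_mul]
  exact Subgroup.mem_map_of_mem _ (Subgroup.Normal.conj_mem inferInstance _ ha _)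

end SubringLift

section Filtration

variable {S : Set ℕ}

variable (S) in
/-- The primes outside `S`. -/
abbrev OutsidePrime := {q : ℕ // q.Prime ∧ q ∉ S}

lemma OutsidePrime.fact_prime (q : OutsidePrime S) : Fact (q : ℕ).Prime := ⟨q.2.1⟩

attribute [local instance] OutsidePrime.fact_prime

lemma exists_mem_smooth (u : ℚˣ) : ∃ n, u ∈ smooth n := by
  refine ⟨(u : ℚ).num.natAbs + (u : ℚ).den + 1, fun q hq hn => ?_⟩
  have h0 : 0 < (u : ℚ).num.natAbs := Int.natAbs_pos.mpr (Rat.num_ne_zero.mpr u.ne_zero)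
  rw [padicValRat_def, padicValInt, padicValNat.eq_zero_of_not_dvd, padicValNat.eq_zero_of_not_dvd]
  · simp
  · intro h
    have := Nat.le_of_dvd (u : ℚ).den_pos h
    omega
  · intro h
    have := Nat.le_of_dvd h0 h
    omega

namespace CentralExt

variable {K E : Type*} [AddCommGroup K] [Group E] {X : CentralExt K E}

lemma exists_mem_filt {z : K} (hz : z ∈ X.symbols) : ∃ n, z ∈ X.filt n := by
  induction hz using AddSubgroup.closure_induction with
  | mem z hz =>
    obtain ⟨u, v, rfl⟩ := hz
    obtain ⟨m, hm⟩ := exists_mem_smooth u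
    obtain ⟨n, hn⟩ := exists_mem_smooth v
    exact ⟨max m n, X.c_mem_filt_of_smooth (smooth_mono (le_max_left _ _) hm)
      (smooth_mono (le_max_right _ _) hn)⟩
  | zero => exact ⟨0, zero_mem _⟩
  | add a b _ _ ha hb =>
    obtain ⟨m, hm⟩ := ha
    obtain ⟨n, hn⟩ := hb
    exact ⟨max m n, add_mem (X.filt_mono (le_max_left _ _) hm)
      (X.filt_mono (le_max_right _ _) hn)⟩
  | neg a _ ha =>
    obtain ⟨n, hn⟩ := ha
    exact ⟨n, neg_mem hn⟩

lemma apply_eq_zero_of_mem_filt {q : ℕ} [hq : Fact q.Prime] {τ : K →+ Additive (ZMod q)ˣ}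
    (hτ : ∀ u v, τ (X.c u v) = tame q v u) {n : ℕ} (hn : n ≤ q) {z : K} (hz : z ∈ X.filt n) :
    τ z = 0 := by
  induction hz using AddSubgroup.closure_induction with
  | mem z hz =>
    obtain ⟨u, hu, v, hv, rfl⟩ := hz
    rw [hτ, tame_eq_zero (hv q hq.out hn) (hu q hq.out hn)]
  | zero => exact map_zero τ
  | add a b _ _ ha hb => rw [map_add, ha, hb, add_zero]
  | neg a _ ha => rw [map_neg, ha, neg_zero]

lemma apply_c_primeUnit_liftUnit {q : ℕ} [hq : Fact q.Prime] {τ : K →+ Additive (ZMod q)ˣ}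
    (hτ : ∀ u v, τ (X.c u v) = tame q v u) (r : (ZMod q)ˣ) :
    τ (X.c (primeUnit q) (liftUnit r)) = Additive.ofMul r := by
  rw [hτ, tame_primeUnit (liftUnit_mem_smooth r q hq.out le_rfl), res_liftUnit]

variable {τ : ∀ q : OutsidePrime S, K →+ Additive (ZMod (q : ℕ))ˣ}
  (hτ : ∀ q u v, τ q (X.c u v) = tame (q : ℕ) v u)

include hτ

/-- The tame symbols at the primes outside `S` separate symbols, provided that the symbols of the
primes in `S` reduce to smaller primes. -/
lemma eq_zero_of_mem_symbols {n₀ : ℕ} (hn₀ : 2 < n₀) (h0 : X.filt n₀ = ⊥)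
    (hS : ∀ p ∈ S, ∀ [Fact p.Prime] (r : (ZMod p)ˣ),
      X.c (primeUnit p) (liftUnit r) ∈ X.filt p)
    {z : K} (hz : z ∈ X.symbols) (h : ∀ q, τ q z = 0) : z = 0 := by
  have main : ∀ k, z ∈ X.filt (n₀ + k) → z = 0 := by
    intro k
    induction k with
    | zero =>
      intro hk
      rwa [add_zero, h0, AddSubgroup.mem_bot] at hk
    | succ k ih =>
      intro hk
      apply ih
      by_cases hp : (n₀ + k).Prime
      · have := Fact.mk hp
        obtain ⟨r, hr⟩ := X.exists_sub_mem_filt (p := n₀ + k) (by omega) hk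
        by_cases hpS : n₀ + k ∈ S
        · have h1 := add_mem hr (hS _ hpS r)
          rwa [sub_add_cancel] at h1
        · let q : OutsidePrime S := ⟨n₀ + k, hp, hpS⟩
          have h1 := apply_eq_zero_of_mem_filt (hτ q) le_rfl hr
          rw [map_sub, h q, zero_sub, neg_eq_zero] at h1
          have h2 : r = 1 := (apply_c_primeUnit_liftUnit (hτ q) r).symm.trans h1
          rwa [h2, liftUnit_one, c_one_right, sub_zero] at hr
      · exact X.filt_succ_of_not_prime hp hk
  obtain ⟨n, hn⟩ := exists_mem_filt hz
  exact main n (X.filt_mono (by omega) hn)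

lemma exists_directSum_of_mem_filt {n : ℕ} {z : K} (hz : z ∈ X.filt n) :
    ∃ d : DirectSum (OutsidePrime S) (fun q => Additive (ZMod (q : ℕ))ˣ),
      ∀ q, d q = τ q z := by
  have hfin : {q : OutsidePrime S | (q : ℕ) < n}.Finite :=
    (Set.finite_Iio n).preimage Subtype.val_injective.injOn
  refine ⟨DFinsupp.mk hfin.toFinset fun q => τ q z, fun q => ?_⟩
  refine DFinsupp.mk_apply.trans ?_
  split_ifs with h
  · rfl
  · rw [Set.Finite.mem_toFinset, Set.mem_ofPred_eq, not_lt] at h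
    exact (apply_eq_zero_of_mem_filt (hτ q) h hz).symm

lemma exists_mem_symbols_of_directSum
    (d : DirectSum (OutsidePrime S) (fun q => Additive (ZMod (q : ℕ))ˣ)) :
    ∃ z ∈ X.symbols, ∀ q, τ q z = d q := by
  have main : ∀ n : ℕ, ∀ d : DirectSum (OutsidePrime S)
      (fun q => Additive (ZMod (q : ℕ))ˣ), (∀ q : OutsidePrime S, n ≤ (q : ℕ) → d q = 0) →
      ∃ z ∈ X.symbols, ∀ q, τ q z = d q := by
    intro n
    induction n with
    | zero => exact fun d hd => ⟨0, zero_mem _, fun q => by rw [map_zero, hd q (Nat.zero_le _)]⟩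
    | succ n ih =>
      intro d hd
      by_cases hn : n.Prime ∧ n ∉ S
      · obtain ⟨q₀, rfl⟩ : ∃ q₀ : OutsidePrime S, (q₀ : ℕ) = n := ⟨⟨n, hn⟩, rfl⟩
        let z₀ := X.c (primeUnit (q₀ : ℕ)) (liftUnit (d q₀).toMul)
        have hz₀ : z₀ ∈ X.filt (q₀ + 1) := X.c_mem_filt_of_smooth (primeUnit_mem_smooth (q₀ : ℕ))
          (smooth_mono (Nat.le_succ _) (liftUnit_mem_smooth (p := (q₀ : ℕ)) _))
        obtain ⟨d₀, hd₀⟩ := exists_directSum_of_mem_filt hτ hz₀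
        obtain ⟨z, hz, h⟩ := ih (d - d₀) fun q hq => by
          rw [DirectSum.sub_apply, hd₀, sub_eq_zero]
          rcases hq.eq_or_lt with h1 | h1
          · obtain rfl : q₀ = q := Subtype.ext h1
            rw [apply_c_primeUnit_liftUnit (hτ q₀)]
            rfl
          · rw [hd q h1, apply_eq_zero_of_mem_filt (hτ q) h1 hz₀]
        refine ⟨z + z₀, add_mem hz (X.c_mem_symbols _ _), fun q => ?_⟩
        rw [map_add, h, ← hd₀, DirectSum.sub_apply, sub_add_cancel]
      · refine ih d fun q hq => hd q (Nat.succ_le_of_lt (lt_of_le_of_ne hq ?_))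
        rintro rfl
        exact hn q.2
  have hbound : ∃ n : ℕ, ∀ q : OutsidePrime S, n ≤ (q : ℕ) → d q = 0 := by
    induction d using DirectSum.induction_on with
    | zero => exact ⟨0, fun q _ => rfl⟩
    | of q r =>
      refine ⟨q + 1, fun q' h => DirectSum.of_eq_of_ne _ _ _ ?_⟩
      rintro rfl
      omega
    | add a b ha hb =>
      obtain ⟨m, hm⟩ := ha
      obtain ⟨n, hn⟩ := hb
      refine ⟨max m n, fun q hq => ?_⟩
      rw [DirectSum.add_apply, hm q (le_of_max_le_left hq), hn q (le_of_max_le_right hq), add_zero]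
  obtain ⟨n, hn⟩ := hbound
  exact main n d hn

end CentralExt

end Filtration

section Localization

variable {S : Set ℕ}

lemma inv_mem_ZS {p : ℕ} (hp : p ∈ S) : (p : ℚ)⁻¹ ∈ ZS S := Subring.subset_closure ⟨p, hp, rfl⟩

lemma padicValRat_nonneg_of_mem_ZS (hSprime : ∀ p ∈ S, Nat.Prime p) {q : ℕ} [hq : Fact q.Prime]
    (hqS : q ∉ S) {t : ℚ} (ht : t ∈ ZS S) : 0 ≤ padicValRat q t := by
  induction ht using Subring.closure_induction with
  | mem t ht =>
    obtain ⟨p, hp, rfl⟩ := ht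
    have := Fact.mk (hSprime p hp)
    have hne : q ≠ p := by rintro rfl; exact hqS hp
    dsimp only
    rw [padicValRat.inv, padicValRat.of_nat, padicValNat_primes hne]
    simp
  | zero => simp
  | one => simp
  | add x y _ _ hx hy => exact padicValRat_add_nonneg hx hy
  | neg x _ hx => rwa [padicValRat.neg]
  | mul x y _ _ hx hy => exact padicValRat_mul_nonneg hx hy

lemma padicValRat_eq_zero_of_isUnit (hSprime : ∀ p ∈ S, Nat.Prime p) {q : ℕ} [hq : Fact q.Prime]
    (hqS : q ∉ S) {u : ZS S} (hu : IsUnit u) : padicValRat q (u : ℚ) = 0 := by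
  obtain ⟨v, hv⟩ := hu.exists_right_inv
  have hv' : (u : ℚ) * v = 1 := by exact_mod_cast congrArg Subtype.val hv
  have h := congrArg (padicValRat q) hv'
  rw [padicValRat.mul (left_ne_zero_of_mul_eq_one hv') (right_ne_zero_of_mul_eq_one hv'),
    padicValRat.one] at h
  have h1 := padicValRat_nonneg_of_mem_ZS hSprime hqS u.2
  have h2 := padicValRat_nonneg_of_mem_ZS hSprime hqS v.2
  omega

lemma mem_of_isUnit_sq_sub_one (hSprime : ∀ p ∈ S, Nat.Prime p)
    (hlam : ∃ lam : (ZS S)ˣ, IsUnit ((lam : ZS S) ^ 2 - 1)) {q : ℕ} [hq : Fact q.Prime]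
    (h : ∀ x : ZMod q, x ≠ 0 → x * x = 1) : q ∈ S := by
  by_contra hqS
  obtain ⟨lam, hl⟩ := hlam
  have h1 := padicValRat_eq_zero_of_isUnit hSprime hqS lam.isUnit
  have h2 := padicValRat_eq_zero_of_isUnit hSprime hqS hl
  have h0 : ((lam : ZS S) : ℚ) ≠ 0 := by
    have := lam.ne_zero
    exact_mod_cast this
  have h3 : (((lam : ZS S) ^ 2 - 1 : ZS S) : ℚ) ≠ 0 := by
    have := hl.ne_zero
    exact_mod_cast this
  have h4 := ratCast_ne_zero q h3 h2
  have h5 : (((lam : ZS S) ^ 2 - 1 : ZS S) : ℚ) =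
      ((lam : ZS S) : ℚ) * ((lam : ZS S) : ℚ) + (-1 : ℚ) := by
    push_cast
    ring
  rw [h5, ratCast_add q (padicValRat_mul_nonneg h1.ge h1.ge) (by simp), ratCast_mul q h1.ge h1.ge,
    h _ (ratCast_ne_zero q h0 h1)] at h4
  simp at h4

lemma smooth_five_le (h2 : 2 ∈ S) (h3 : 3 ∈ S) {u : ℚˣ} (hu : u ∈ smooth 5) :
    (u : ℚ) ∈ ZS S ∧ (u : ℚ)⁻¹ ∈ ZS S := by
  let H : Subgroup ℚˣ :=
    { carrier := {u | (u : ℚ) ∈ ZS S ∧ (u : ℚ)⁻¹ ∈ ZS S}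
      one_mem' := by simp [one_mem]
      mul_mem' := by
        rintro a b ⟨ha, ha'⟩ ⟨hb, hb'⟩
        refine ⟨?_, ?_⟩
        · rw [Units.val_mul]; exact mul_mem ha hb
        · rw [Units.val_mul, mul_inv]; exact mul_mem ha' hb'
      inv_mem' := by
        rintro a ⟨ha, ha'⟩
        refine ⟨?_, ?_⟩
        · rwa [Units.val_inv_eq_inv_val]
        · rwa [Units.val_inv_eq_inv_val, inv_inv] }
  refine smooth_le (H := H) ⟨?_, ?_⟩ (fun q hq hq5 u hu => ?_) hu
  · simp
  · simp
  · have hqS : q ∈ S := by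
      have := hq.two_le
      interval_cases q
      · exact h2
      · exact h3
      · exact absurd hq (by norm_num)
    exact ⟨by rw [hu]; exact natCast_mem _ q, by rw [hu]; exact inv_mem_ZS hqS⟩

/-- The tame symbol cocycle on `SL₂(ℚ)` kills the boundaries relative to `SL₂(ℤ_S)`. -/
lemma relBoundaries_le_ker_tame (hSprime : ∀ p ∈ S, Nat.Prime p) {q : ℕ} [hq : Fact q.Prime]
    (hqS : q ∉ S) :
    relBoundaries (slIncl (ZS S)) ≤ LinearMap.ker (cochainMap (kubotaCocycle (tame q))) := by
  refine relBoundaries_le_ker_cochainMap _ (isCocycle_kubotaCocycle (isBilinearSymbol_tame q))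
    (σ := fun g => tameSplit q (col 1) (col (slIncl (ZS S) g))) fun g h => ?_
  have hg : ∀ (g : SpecialLinearGroup (Fin 2) (ZS S)) i j,
      0 ≤ padicValRat q (slIncl (ZS S) g i j) :=
    fun g i j => padicValRat_nonneg_of_mem_ZS hSprime hqS (g i j).2
  rw [kubotaCocycle_tame_eq (hg g) (hg h), map_mul]

end Localization

section Cokernel

variable {S : Set ℕ}

attribute [local instance] OutsidePrime.fact_prime

/-- The tame symbol at a prime outside `S` on the kernel of the extension relative to
`SL₂(ℤ_S)`. -/
def relTame (hSprime : ∀ p ∈ S, Nat.Prime p) (q : OutsidePrime S) :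
    (((SL2Q × SL2Q) →₀ ℤ) ⧸ relBoundaries (slIncl (ZS S))) →+ Additive (ZMod (q : ℕ))ˣ :=
  ((relBoundaries (slIncl (ZS S))).liftQ (cochainMap (kubotaCocycle (tame (q : ℕ))))
    (relBoundaries_le_ker_tame hSprime q.2.2)).toAddMonoidHom

lemma relTame_c (hSprime : ∀ p ∈ S, Nat.Prime p) (q : OutsidePrime S) (u v : ℚˣ) :
    relTame hSprime q ((relExt (ZS S)).c u v) = tame (q : ℕ) v u :=
  (liftQ_barExt_c _ (isCocycle_kubotaCocycle (isBilinearSymbol_tame (q : ℕ)))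
    (relBoundaries_le_ker_tame hSprime q.2.2) u v).trans
    (kubotaExt_c (isBilinearSymbol_tame (q : ℕ)) u v)

lemma eq_zero_of_relTame (hSprime : ∀ p ∈ S, Nat.Prime p) (h2 : 2 ∈ S) (h3 : 3 ∈ S) {z}
    (hz : z ∈ (relExt (ZS S)).symbols) (h : ∀ q, relTame hSprime q z = 0) : z = 0 := by
  have h2' : (2 : ℚ)⁻¹ ∈ ZS S := by exact_mod_cast inv_mem_ZS h2
  have h3' : (3 : ℚ)⁻¹ ∈ ZS S := by exact_mod_cast inv_mem_ZS h3
  have hL : ∀ e ∈ relSplit (ZS S), (relExt (ZS S)).π e = 1 → e = 1 :=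
    fun e he => eq_one_of_mem_relSplit he
  have hx : ∀ t ∈ ZS S, (relExt (ZS S)).x t ∈ relSplit (ZS S) :=
    fun t ht => x_mem_relSplit h2' h3' ht
  have hy : ∀ t ∈ ZS S, (relExt (ZS S)).y t ∈ relSplit (ZS S) :=
    fun t ht => y_mem_relSplit h2' h3' ht
  refine CentralExt.eq_zero_of_mem_symbols (relTame_c hSprime) (n₀ := 5) (by norm_num) ?_ ?_ hz h
  · rw [eq_bot_iff, CentralExt.filt, AddSubgroup.closure_le]
    rintro _ ⟨u, hu, v, hv, rfl⟩
    obtain ⟨hu, hu'⟩ := smooth_five_le h2 h3 hu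
    obtain ⟨hv, hv'⟩ := smooth_five_le h2 h3 hv
    exact CentralExt.c_eq_zero_of_mem hL hx hy hu hu' hv hv'
  · intro p hp _ r
    exact CentralExt.c_mem_filt_of_inv_mem hL hx hy (hSprime p hp) (inv_mem_ZS hp) (val_val_pos r)
      (ZMod.val_lt _) (val_primeUnit p) (by rw [val_liftUnit, Int.cast_natCast])

lemma nonempty_coker_addEquiv (hSprime : ∀ p ∈ S, Nat.Prime p) (h2 : 2 ∈ S) (h3 : 3 ∈ S) :
    Nonempty ((H2 SL2Q ⧸ LinearMap.range (mapH2 (slIncl (ZS S)))) ≃+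
      (DirectSum (OutsidePrime S) (fun q => Additive (ZMod (q : ℕ))ˣ))) := by
  let T : ((SL2Q × SL2Q) →₀ ℤ) →ₗ[ℤ] ∀ q : OutsidePrime S, Additive (ZMod (q : ℕ))ˣ :=
    LinearMap.pi fun q : OutsidePrime S => cochainMap (kubotaCocycle (tame (q : ℕ)))
  have hR := range_barD3_le_relBoundaries (slIncl (ZS S))
  obtain ⟨e⟩ := nonempty_coker_equiv (slIncl (ZS S)) T
    (fun z hz => funext fun q => relBoundaries_le_ker_tame hSprime q.2.2 hz) fun z hz hT => by
      rw [← Submodule.Quotient.mk_eq_zero, ← Submodule.mkQ_apply]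
      exact eq_zero_of_relTame hSprime h2 h3 (mkQ_mem_symbols hR hz) fun q => congrFun hT q
  let φ : DirectSum (OutsidePrime S) (fun q => Additive (ZMod (q : ℕ))ˣ) →ₗ[ℤ]
      ∀ q : OutsidePrime S, Additive (ZMod (q : ℕ))ˣ :=
    LinearMap.pi fun q => DirectSum.component ℤ _ _ q
  have hφ : Function.Injective φ := DFunLike.coe_injective
  have hrange : LinearMap.range φ = (LinearMap.ker (barD2 SL2Q)).map T := by
    apply le_antisymm
    · rintro _ ⟨d, rfl⟩
      obtain ⟨k, hk, h⟩ := CentralExt.exists_mem_symbols_of_directSum (relTame_c hSprime) d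
      obtain ⟨z, hz, rfl⟩ := exists_mkQ_eq_of_mem_symbols hR (relBoundaries_le_ker _) hk
      exact ⟨z, hz, funext h⟩
    · rintro _ ⟨z, hz, rfl⟩
      obtain ⟨n, hn⟩ := CentralExt.exists_mem_filt (mkQ_mem_symbols hR hz)
      obtain ⟨d, hd⟩ := CentralExt.exists_directSum_of_mem_filt (relTame_c hSprime) hn
      exact ⟨d, funext hd⟩
  exact ⟨(e.trans ((LinearEquiv.ofEq _ _ hrange.symm).trans
    (LinearEquiv.ofInjective φ hφ).symm)).toAddEquiv⟩

end Cokernel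

/-- if `ℤ_S` has a unit `λ` with `λ² − 1` a unit, then the cokernel of
`H₂(SL₂(ℤ_S), ℤ) → H₂(SL₂(ℚ), ℤ)` is isomorphic to `⊕_{q ∉ S} (ℤ/qℤ)^×`, the sum being
over all primes `q` not in `S`. -/
theorem stmt14 (S : Set ℕ) (hS : S.Nonempty) (hSprime : ∀ p ∈ S, Nat.Prime p)
    (hlam : ∃ lam : (ZS S)ˣ, IsUnit ((lam : ZS S) ^ 2 - 1)) :
    Nonempty
      ((H2 (Matrix.SpecialLinearGroup (Fin 2) ℚ) ⧸
        LinearMap.range (mapH2 (Matrix.SpecialLinearGroup.map (n := Fin 2)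
          (ZS S).subtype))) ≃+
        (DirectSum {q : ℕ // q.Prime ∧ q ∉ S} (fun q => Additive (ZMod (q : ℕ))ˣ))) := by
  exact nonempty_coker_addEquiv hSprime
    (mem_of_isUnit_sq_sub_one hSprime hlam (by decide))
    (mem_of_isUnit_sq_sub_one hSprime hlam (by decide))
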